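/- Let γ : ℝ × (-∞,0] → ℝ² be an ancient complete non-compact embedded smooth curve shortening flow whose entropy equals a positive integer m. Then for every t ≤ 0 and every unit vector v ∈ ℝ², the set of points with nonzero curvature vector a positive multiple of v, namely {u ∈ ℝ : ∃ c > 0, κ(u,t) n(u,t) = c v}, has at most m - 1 elements. -/

import Mathlib

open Real MeasureTheory Set Filter
open scoped RealInnerProductSpace ENNReal

noncomputable section

/-- The Euclidean plane. -/
abbrev R2 := EuclideanSpace ℝ (Fin 2)

/-- The point of `ℝ²` with coordinates `(x, y)`. -/
def toR2 (x y : ℝ) : R2 := (WithLp.equiv 2 (Fin 2 → ℝ)).symm ![x, y]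

/-- Counterclockwise rotation of the plane by `π/2`. -/
def Jrot (v : R2) : R2 := toR2 (-(v 1)) (v 0)

/-- Arclength derivative `∂ₛ := |∂ᵤγ|⁻¹ ∂ᵤ` along the time-`t` curve of the flow `γ`,
applied to a function `f` of `(u, t)`. -/
def aderiv (γ : ℝ → ℝ → R2) {F : Type} [NormedAddCommGroup F] [NormedSpace ℝ F]
    (f : ℝ → ℝ → F) (u t : ℝ) : F :=
  ‖deriv (fun v => γ v t) u‖⁻¹ • deriv (fun v => f v t) u

/-- The unit tangent `T = ∂ᵤγ / |∂ᵤγ|`. -/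
def unitT (γ : ℝ → ℝ → R2) (u t : ℝ) : R2 := aderiv γ γ u t

/-- The unit normal `n = J T`. -/
def unitN (γ : ℝ → ℝ → R2) (u t : ℝ) : R2 := Jrot (unitT γ u t)

/-- The signed curvature `κ = ⟨∂ₛT, n⟩`. -/
def curv (γ : ℝ → ℝ → R2) (u t : ℝ) : ℝ := ⟪aderiv γ (unitT γ) u t, unitN γ u t⟫

/-- `γ : ℝ × I → ℝ²` is a smooth curve shortening flow in fixed-parametrization form:
smooth, regular (`∂ᵤγ ≠ 0`), and `∂ₜγ = ∂ₛ(∂ₛγ)` (time derivative taken within `I`). -/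
structure IsCSF (γ : ℝ → ℝ → R2) (I : Set ℝ) : Prop where
  smooth : ContDiffOn ℝ (⊤ : ℕ∞) (fun p : ℝ × ℝ => γ p.1 p.2) (univ ×ˢ I)
  regular : ∀ (u : ℝ), ∀ t ∈ I, deriv (fun v => γ v t) u ≠ 0
  flow : ∀ (u : ℝ), ∀ t ∈ I, derivWithin (fun s => γ u s) I t = aderiv γ (aderiv γ γ) u t

/-- The Gaussian weighted length `F_{x₀,l}` of the time-`t` curve (as an extended real). -/
def gaussLenE (γ : ℝ → ℝ → R2) (x₀ : R2) (l t : ℝ) : ℝ≥0∞ :=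
  (ENNReal.ofReal (Real.sqrt (4 * π * l)))⁻¹ *
    ∫⁻ u : ℝ, ENNReal.ofReal
      (Real.exp (-‖γ u t - x₀‖ ^ 2 / (4 * l)) * ‖deriv (fun v => γ v t) u‖)

/-- The total curvature of the time-`t` curve (as an extended real). -/
def totalCurvE (γ : ℝ → ℝ → R2) (t : ℝ) : ℝ≥0∞ :=
  ∫⁻ u : ℝ, ENNReal.ofReal (|curv γ u t| * ‖deriv (fun v => γ v t) u‖)

/-- The entropy of the flow: the supremum of the Gaussian weighted lengths over all
times `t ∈ I`, centers `x₀ ∈ ℝ²` and scales `l > 0`. -/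
def entropyE (γ : ℝ → ℝ → R2) (I : Set ℝ) : ℝ≥0∞ :=
  ⨆ t ∈ I, ⨆ x₀ : R2, ⨆ l ∈ Ioi (0:ℝ), gaussLenE γ x₀ l t

lemma sin_strip {h : unitInterval → ℝ} (hc : Continuous h) (hs : ∀ s, 0 ≤ Real.sin (h s))
    {s0 : unitInterval} (h0 : 0 ≤ h s0) (h1 : h s0 ≤ π) (s : unitInterval) :
    0 ≤ h s ∧ h s ≤ π := by
  have hpre : IsPreconnected (range h) := isPreconnected_range hc
  have hpi := Real.pi_pos
  constructor
  · by_contra hlt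
    push Not at hlt
    have hm : max (h s) (-(π/2)) ∈ range h :=
      hpre.ordConnected.out (mem_range_self s) (mem_range_self s0)
        ⟨le_max_left _ _, max_le (by linarith) (by linarith)⟩
    obtain ⟨r, hr⟩ := hm
    have := hs r
    rw [hr] at this
    have h2 : Real.sin (max (h s) (-(π/2))) < 0 :=
      Real.sin_neg_of_neg_of_neg_pi_lt (max_lt hlt (by linarith))
        (lt_of_lt_of_le (by linarith) (le_max_right _ _))
    linarith
  · by_contra hlt
    push Not at hlt
    have hm : min (h s) (3*π/2) ∈ range h :=
      hpre.ordConnected.out (mem_range_self s0) (mem_range_self s)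
        ⟨le_min (by linarith) (by linarith), min_le_left _ _⟩
    obtain ⟨r, hr⟩ := hm
    have := hs r
    rw [hr] at this
    have h2 : Real.sin (min (h s) (3*π/2) - 2*π) < 0 := by
      apply Real.sin_neg_of_neg_of_neg_pi_lt
      · linarith [min_le_right (h s) (3*π/2)]
      · have : π < min (h s) (3*π/2) := lt_min hlt (by linarith)
        linarith
    rw [Real.sin_sub_two_pi] at h2
    linarith

lemma crossing (α β : C(unitInterval, ℝ × ℝ)) (t0 : ℝ) (hα : ∀ s, (α s).2 ≤ t0)
    (hβ : ∀ s, (β s).2 ≤ t0) (α0 : (α 0).2 = t0) (β0 : (β 0).2 = t0) (β1 : (β 1).2 = t0)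
    (h1 : (β 0).1 < (α 0).1) (h2 : (α 0).1 < (β 1).1) (hend : ∀ s, (α 1).2 < (β s).2) :
    ∃ s r, α s = β r := by
  by_contra hne
  push Not at hne
  let F : C(unitInterval × unitInterval, ℂ) :=
    ⟨fun p => ((((α p.1).1 - (β p.2).1 : ℝ) : ℂ) + (((α p.1).2 - (β p.2).2 : ℝ) : ℂ) * Complex.I),
      by fun_prop⟩
  have Fre : ∀ s r, (F (s, r)).re = (α s).1 - (β r).1 := by intro s r; simp [F]
  have Fim : ∀ s r, (F (s, r)).im = (α s).2 - (β r).2 := by intro s r; simp [F]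
  have hF0 : ∀ p, F p ∈ ({0}ᶜ : Set ℂ) := by
    rintro ⟨s, r⟩ h
    simp only [mem_singleton_iff] at h
    have hr := Fre s r
    have hi := Fim s r
    rw [h] at hr hi
    simp at hr hi
    exact hne s r (Prod.ext (by linarith) (by linarith))
  have h00 : (F (0,0)) ≠ 0 := hF0 (0,0)
  let pr : C(ℝ × ℝ, unitInterval × unitInterval) :=
    ⟨fun p => (projIcc 0 1 zero_le_one p.1, projIcc 0 1 zero_le_one p.2), by
      exact (continuous_projIcc.comp continuous_fst).prodMk
        (continuous_projIcc.comp continuous_snd)⟩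
  have hpr : ∀ s r : unitInterval, pr ((s : ℝ), (r : ℝ)) = (s, r) := by
    intro s r; simp [pr]
  obtain ⟨L', ⟨hL0', hL1⟩, -⟩ := Complex.isCoveringMapOn_exp.existsUnique_continuousMap_lifts
    (F.comp pr) (a₀ := ((0 : ℝ), (0 : ℝ))) (e₀ := Complex.log (F (0,0)))
    (by rw [Complex.exp_log h00]; exact congrArg F (hpr 0 0).symm) (by exact fun a => hF0 _)
  let L : C(unitInterval × unitInterval, ℂ) :=
    ⟨fun p => L' ((p.1 : ℝ), (p.2 : ℝ)), by fun_prop⟩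
  have hL0 : L (0,0) = Complex.log (F (0,0)) := hL0'
  have hL' : ∀ p, Complex.exp (L p) = F p := by
    rintro ⟨s, r⟩
    have := congrFun hL1 ((s : ℝ), (r : ℝ))
    simp only [Function.comp_apply, ContinuousMap.comp_apply, hpr] at this
    exact this
  have hre : ∀ s r, (F (s,r)).re = Real.exp (L (s,r)).re * Real.cos (L (s,r)).im := by
    intro s r; rw [← hL', Complex.exp_re]
  have him : ∀ s r, (F (s,r)).im = Real.exp (L (s,r)).re * Real.sin (L (s,r)).im := by
    intro s r; rw [← hL', Complex.exp_im]
  have start : (L (0,0)).im = 0 := by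
    rw [hL0, Complex.log_im, Complex.arg_eq_zero_iff]
    exact ⟨by rw [Fre]; linarith, by rw [Fim, α0, β0]; ring⟩
  have sinpos : ∀ s r, 0 ≤ (F (s,r)).im → 0 ≤ Real.sin (L (s,r)).im := by
    intro s r h
    rw [him] at h
    exact nonneg_of_mul_nonneg_right h (Real.exp_pos _)
  have sinneg : ∀ s r, (F (s,r)).im ≤ 0 → 0 ≤ Real.sin (-(L (s,r)).im) := by
    intro s r h
    rw [him] at h
    rw [Real.sin_neg]
    by_contra hh
    push Not at hh
    have := mul_pos (Real.exp_pos (L (s,r)).re) (by linarith : 0 < Real.sin (L (s,r)).im)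
    linarith
  have up := sin_strip (h := fun r => (L (0,r)).im) (by fun_prop)
    (fun r => sinpos 0 r (by rw [Fim, α0]; linarith [hβ r])) (s0 := 0) (by simp [start])
    (by simp [start, Real.pi_pos.le]) 1
  have d1 := sin_strip (h := fun s => -(L (s,0)).im) (by fun_prop)
    (fun s => sinneg s 0 (by rw [Fim, β0]; linarith [hα s])) (s0 := 0) (by simp [start])
    (by simp [start, Real.pi_pos.le]) 1
  have d2 := sin_strip (h := fun r => -(L (1,r)).im) (by fun_prop)
    (fun r => sinneg 1 r (by rw [Fim]; linarith [hend r])) (s0 := 0) d1.1 d1.2 1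
  have d3 := sin_strip (h := fun s => -(L (s,1)).im) (by fun_prop)
    (fun s => sinneg s 1 (by rw [Fim, β1]; linarith [hα s])) (s0 := 1) d2.1 d2.2 0
  have : (L (0,1)).im = 0 := by linarith [up.1, d3.1]
  have hh := hre 0 1
  rw [this, Fre] at hh
  simp at hh
  have := Real.exp_pos (L (0,1)).re
  linarith

/-- Scalar form of a curve shortening flow (frozen after time `t0 < 0`). -/
structure SFlow (m t0 : ℝ) where
  x : ℝ → ℝ → ℝ
  y : ℝ → ℝ → ℝ
  a : ℝ → ℝ → ℝ
  b : ℝ → ℝ → ℝ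
  k : ℝ → ℝ → ℝ
  g : ℝ → ℝ → ℝ
  cx : Continuous (fun p : ℝ × ℝ => x p.1 p.2)
  cy : Continuous (fun p : ℝ × ℝ => y p.1 p.2)
  ca : Continuous (fun p : ℝ × ℝ => a p.1 p.2)
  cb : Continuous (fun p : ℝ × ℝ => b p.1 p.2)
  ck : Continuous (fun p : ℝ × ℝ => k p.1 p.2)
  cg : Continuous (fun p : ℝ × ℝ => g p.1 p.2)
  hx : ∀ u t, HasDerivAt (fun u => x u t) (a u t * g u t) u
  hy : ∀ u t, HasDerivAt (fun u => y u t) (b u t * g u t) u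
  ha : ∀ u t, HasDerivAt (fun u => a u t) (-(b u t) * k u t * g u t) u
  hb : ∀ u t, HasDerivAt (fun u => b u t) (a u t * k u t * g u t) u
  gpos : ∀ u t, 0 < g u t
  unit : ∀ u t, a u t ^ 2 + b u t ^ 2 = 1
  hxt : ∀ u t, t < t0 → HasDerivAt (fun t => x u t) (-(b u t) * k u t) t
  hyt : ∀ u t, t < t0 → HasDerivAt (fun t => y u t) (a u t * k u t) t
  hgt : ∀ u t, t < t0 → HasDerivAt (fun t => g u t) (-(k u t) ^ 2 * g u t) t
  t0neg : t0 < 0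
  clx : ∀ u t, x u t = x u (min t t0)
  cly : ∀ u t, y u t = y u (min t t0)
  prop_top : ∀ t, Tendsto (fun u => x u t ^ 2 + y u t ^ 2) atTop atTop
  prop_bot : ∀ t, Tendsto (fun u => x u t ^ 2 + y u t ^ 2) atBot atTop
  ent_int : ∀ t l, 0 < l →
    Integrable (fun u => Real.exp (-(x u t ^ 2 + y u t ^ 2) / (4 * l)) * g u t)
  ent : ∀ t l, 0 < l →
    ∫ u, Real.exp (-(x u t ^ 2 + y u t ^ 2) / (4 * l)) * g u t ≤ m * √(4 * π * l)

namespace SFlow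
variable {m t0 : ℝ} (S : SFlow m t0)

def r (u t : ℝ) : ℝ := S.x u t ^ 2 + S.y u t ^ 2
def mu (u t : ℝ) : ℝ := S.x u t * S.a u t + S.y u t * S.b u t
def nu (u t : ℝ) : ℝ := -(S.x u t) * S.b u t + S.y u t * S.a u t
def G (u t : ℝ) : ℝ := Real.exp (S.r u t / (4 * min t t0)) / √(-(min t t0))
def E (u t : ℝ) : ℝ := S.k u t - S.nu u t / (2 * min t t0)

lemma th_neg {m t0 : ℝ} (S : SFlow m t0) (t : ℝ) : min t t0 < 0 :=
  lt_of_le_of_lt (min_le_right _ _) S.t0neg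
lemma th_eq {m t0 : ℝ} (_S : SFlow m t0) {t : ℝ} (h : t < t0) : min t t0 = t := min_eq_left h.le

lemma r_eq (u t : ℝ) : S.r u t = S.mu u t ^ 2 + S.nu u t ^ 2 := by
  have := S.unit u t
  unfold r mu nu
  linear_combination (-(S.x u t ^ 2 + S.y u t ^ 2)) * this

lemma r_nonneg (u t : ℝ) : 0 ≤ S.r u t := by unfold r; positivity

lemma cr : Continuous (fun p : ℝ × ℝ => S.r p.1 p.2) := by
  have := S.cx; have := S.cy
  unfold r; fun_prop
lemma cmu : Continuous (fun p : ℝ × ℝ => S.mu p.1 p.2) := by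
  have := S.cx; have := S.cy; have := S.ca; have := S.cb
  unfold mu; fun_prop
lemma cnu : Continuous (fun p : ℝ × ℝ => S.nu p.1 p.2) := by
  have := S.cx; have := S.cy; have := S.ca; have := S.cb
  unfold nu; fun_prop
lemma cG : Continuous (fun p : ℝ × ℝ => S.G p.1 p.2) := by
  have := S.cr
  unfold G
  refine Continuous.div ?_ (by fun_prop) ?_
  · refine Real.continuous_exp.comp (this.div (by fun_prop) ?_)
    intro p; have := S.th_neg p.2; exact mul_ne_zero (by norm_num) this.ne
  · intro p; have := S.th_neg p.2; exact (Real.sqrt_pos.2 (by linarith)).ne'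
lemma cE : Continuous (fun p : ℝ × ℝ => S.E p.1 p.2) := by
  have := S.ck
  unfold E
  refine this.sub (S.cnu.div (by fun_prop) ?_)
  intro p; have := S.th_neg p.2; exact mul_ne_zero (by norm_num) this.ne

lemma G_pos (u t : ℝ) : 0 < S.G u t := by
  have := S.th_neg t
  exact div_pos (Real.exp_pos _) (Real.sqrt_pos.2 (by linarith))

lemma hr (u t : ℝ) : HasDerivAt (fun u => S.r u t) (2 * S.mu u t * S.g u t) u := by
  have h := ((S.hx u t).pow 2).add ((S.hy u t).pow 2)
  refine h.congr_deriv ?_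
  unfold mu; push_cast; ring
lemma hmu (u t : ℝ) :
    HasDerivAt (fun u => S.mu u t) ((1 + S.k u t * S.nu u t) * S.g u t) u := by
  have h := ((S.hx u t).mul (S.ha u t)).add ((S.hy u t).mul (S.hb u t))
  refine h.congr_deriv ?_
  have := S.unit u t
  unfold nu; linear_combination (S.g u t) * this
lemma hnu (u t : ℝ) :
    HasDerivAt (fun u => S.nu u t) (-(S.k u t) * S.mu u t * S.g u t) u := by
  have h := ((S.hx u t).neg.mul (S.hb u t)).add ((S.hy u t).mul (S.ha u t))
  refine h.congr_deriv ?_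
  simp only [Pi.neg_apply]
  unfold mu; ring
lemma hG (u t : ℝ) :
    HasDerivAt (fun u => S.G u t) (S.G u t * (S.mu u t * S.g u t / (2 * min t t0))) u := by
  have h := (((S.hr u t).div_const (4 * min t t0)).exp).div_const (√(-(min t t0)))
  refine h.congr_deriv ?_
  have h1 := S.th_neg t
  have h2 : √(-(min t t0)) ≠ 0 := (Real.sqrt_pos.2 (by linarith)).ne'
  have h1' := h1.ne
  unfold G; field_simp; ring
lemma hrt (u t : ℝ) (ht : t < t0) :
    HasDerivAt (fun t => S.r u t) (2 * S.k u t * S.nu u t) t := by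
  have h := ((S.hxt u t ht).pow 2).add ((S.hyt u t ht).pow 2)
  refine h.congr_deriv ?_
  unfold nu; push_cast; ring
lemma hGt (u t : ℝ) (ht : t < t0) :
    HasDerivAt (fun t => S.G u t)
      (S.G u t * (-1 / (2 * t) + S.k u t * S.nu u t / (2 * t) - S.r u t / (4 * t ^ 2))) t := by
  have htn : t < 0 := ht.trans S.t0neg
  have hs : 0 < √(-t) := Real.sqrt_pos.2 (by linarith)
  have h1 : HasDerivAt (fun t : ℝ => √(-t)) (-1 / (2 * √(-t))) t :=
    (hasDerivAt_neg t).sqrt (by linarith)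
  have h2 := ((S.hrt u t ht).div ((hasDerivAt_id t).const_mul 4)
    (by simpa using htn.ne)).exp.div h1 hs.ne'
  have h3 : (fun t => S.G u t) =ᶠ[nhds t]
      (fun t => Real.exp (S.r u t / (4 * t)) / √(-t)) := by
    filter_upwards [Iio_mem_nhds ht] with s hs
    unfold G; rw [S.th_eq hs]
  refine (HasDerivAt.congr_of_eventuallyEq h2 h3).congr_deriv ?_
  have hsq : √(-t) ^ 2 = -t := Real.sq_sqrt (by linarith)
  have ht' := htn.ne
  simp only [Pi.div_apply, id]
  unfold G; rw [S.th_eq ht]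
  have hid : t = -√(-t) ^ 2 := by linarith
  generalize √(-t) = q at *
  subst hid
  field_simp
  ring

end SFlow

/-- test functions, composed of a truncation of a linear function -/
structure TestFn {m t0 : ℝ} (S : SFlow m t0) (α β : ℝ) where
  z0 : ℝ → ℝ → ℝ
  z1 : ℝ → ℝ → ℝ
  z2 : ℝ → ℝ → ℝ
  c0 : Continuous (fun p : ℝ × ℝ => z0 p.1 p.2)
  c1 : Continuous (fun p : ℝ × ℝ => z1 p.1 p.2)
  c2 : Continuous (fun p : ℝ × ℝ => z2 p.1 p.2)
  hu0 : ∀ u t, HasDerivAt (fun u => z0 u t)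
    (z1 u t * ((α * S.a u t + β * S.b u t) * S.g u t)) u
  hu1 : ∀ u t, HasDerivAt (fun u => z1 u t)
    (z2 u t * ((α * S.a u t + β * S.b u t) * S.g u t)) u
  ht0 : ∀ u t, t < t0 → HasDerivAt (fun t => z0 u t)
    (z1 u t * (S.k u t * (-α * S.b u t + β * S.a u t))) t
  z0n : ∀ u t, 0 ≤ z0 u t
  z2n : ∀ u t, 0 ≤ z2 u t
  z1b : ∀ u t, z1 u t ^ 2 ≤ 2 * z0 u t * z2 u t
  C : ℝ
  Cn : 0 ≤ C
  b0 : ∀ u t, z0 u t ≤ C * (1 + S.r u t) ^ 2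
  b1 : ∀ u t, |z1 u t| ≤ C * (1 + S.r u t) ^ 2

namespace TestFn
variable {m t0 : ℝ} {S : SFlow m t0} {α β : ℝ} (Z : TestFn S α β)

def F (u t : ℝ) : ℝ := Z.z0 u t * S.G u t * S.g u t
def q (u t : ℝ) : ℝ :=
  (Z.z2 u t * (α * S.a u t + β * S.b u t) ^ 2 + Z.z0 u t * S.E u t ^ 2) * S.G u t * S.g u t
/-- flux -/
def B (u t : ℝ) : ℝ :=
  Z.z1 u t * (α * S.a u t + β * S.b u t) * S.G u t
    - Z.z0 u t * S.mu u t * S.G u t / (2 * min t t0)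
def B' (u t : ℝ) : ℝ :=
  Z.z2 u t * (α * S.a u t + β * S.b u t) ^ 2 * S.g u t * S.G u t
   + Z.z1 u t * (S.k u t * (-α * S.b u t + β * S.a u t)) * S.g u t * S.G u t
   - Z.z0 u t * (1 + S.k u t * S.nu u t) * S.g u t * S.G u t / (2 * min t t0)
   - Z.z0 u t * S.mu u t ^ 2 * S.g u t * S.G u t / (4 * (min t t0) ^ 2)

lemma hB (u t : ℝ) : HasDerivAt (fun u => Z.B u t) (Z.B' u t) u := by
  have h1 : HasDerivAt (fun u => α * S.a u t + β * S.b u t)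
      (S.k u t * (-α * S.b u t + β * S.a u t) * S.g u t) u :=
    (((S.ha u t).const_mul α).add ((S.hb u t).const_mul β)).congr_deriv (by ring)
  have h2 := (((Z.hu1 u t).mul h1).mul (S.hG u t)).sub
    ((((Z.hu0 u t).mul (S.hmu u t)).mul (S.hG u t)).div_const (2 * min t t0))
  refine h2.congr_deriv ?_
  have := (S.th_neg t).ne
  simp only [Pi.mul_apply]
  unfold B'
  field_simp
  ring

lemma hF (u t : ℝ) (ht : t < t0) : HasDerivAt (fun t => Z.F u t) (-(Z.q u t) + Z.B' u t) t := by
  have h := ((Z.ht0 u t ht).mul (S.hGt u t ht)).mul (S.hgt u t ht)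
  refine h.congr_deriv ?_
  have htn : t ≠ 0 := (ht.trans S.t0neg).ne
  simp only [Pi.mul_apply]
  unfold q B' SFlow.E
  rw [S.th_eq ht, S.r_eq]
  field_simp
  ring

lemma cF : Continuous (fun p : ℝ × ℝ => Z.F p.1 p.2) := by
  have := S.cg; have := S.cG; have := Z.c0
  unfold F; fun_prop
lemma cq : Continuous (fun p : ℝ × ℝ => Z.q p.1 p.2) := by
  have := S.cg; have := S.cG; have := Z.c0; have := Z.c2; have := S.cE
  have := S.ca; have := S.cb
  unfold q; fun_prop
lemma cB : Continuous (fun p : ℝ × ℝ => Z.B p.1 p.2) := by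
  have := S.cg; have := S.cG; have := Z.c0; have := Z.c1; have := S.cmu
  have := S.ca; have := S.cb
  unfold B
  refine Continuous.sub (by fun_prop) (Continuous.div (by fun_prop) (by fun_prop) ?_)
  intro p; have := S.th_neg p.2; exact mul_ne_zero (by norm_num) this.ne
lemma cB' : Continuous (fun p : ℝ × ℝ => Z.B' p.1 p.2) := by
  have := S.cg; have := S.cG; have := Z.c0; have := Z.c1; have := Z.c2; have := S.cmu
  have := S.ca; have := S.cb; have := S.ck; have := S.cnu
  unfold B'
  refine Continuous.sub (Continuous.sub (by fun_prop) (Continuous.div (by fun_prop) (by fun_prop) ?_))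
    (Continuous.div (by fun_prop) (by fun_prop) ?_)
  · intro p; have := S.th_neg p.2; exact mul_ne_zero (by norm_num) this.ne
  · intro p; have := S.th_neg p.2; exact mul_ne_zero (by norm_num) (pow_ne_zero _ this.ne)
lemma q_nonneg (u t : ℝ) : 0 ≤ Z.q u t := by
  have := Z.z0n u t; have := Z.z2n u t; have := S.G_pos u t; have := S.gpos u t
  unfold q; positivity
lemma F_nonneg (u t : ℝ) : 0 ≤ Z.F u t := by
  have := Z.z0n u t; have := Z.z2n u t; have := S.G_pos u t; have := S.gpos u t
  unfold F; positivity
end TestFn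

lemma poly_gauss (p : ℕ) (hp : 0 < p) {τ r : ℝ} (hτ : 0 < τ) (hr : 0 ≤ r) :
    (1 + r) ^ p * Real.exp (-r / (4 * τ)) ≤
      (p : ℝ) ^ p * (1 + 8 * τ) ^ p * Real.exp (-r / (8 * τ)) := by
  have hp1 : (1 : ℝ) ≤ p := by exact_mod_cast hp
  have hp0 : (0 : ℝ) < p := by linarith
  set y := r / (8 * τ) with hy
  have hy0 : 0 ≤ y := by positivity
  have hry : r = 8 * τ * y := by rw [hy]; field_simp
  have h1 : 1 + r ≤ (1 + 8 * τ) * (p * Real.exp (y / p)) := by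
    have h2 : 1 + y ≤ p * Real.exp (y / p) := by
      have h3 := Real.add_one_le_exp (y / p)
      have h4 : 1 + y ≤ p * (y / p + 1) := by
        rw [mul_add, mul_div_cancel₀ _ hp0.ne']; linarith
      exact h4.trans (mul_le_mul_of_nonneg_left h3 hp0.le)
    have h5 : 1 + r ≤ (1 + 8 * τ) * (1 + y) := by rw [hry]; nlinarith
    exact h5.trans (mul_le_mul_of_nonneg_left h2 (by positivity))
  have h6 : (1 + r) ^ p ≤ (p : ℝ) ^ p * (1 + 8 * τ) ^ p * Real.exp y := by
    have := pow_le_pow_left₀ (by positivity) h1 p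
    rw [mul_pow, mul_pow, ← Real.exp_nat_mul, mul_div_cancel₀ _ hp0.ne'] at this
    calc _ ≤ _ := this
      _ = _ := by ring
  calc (1 + r) ^ p * Real.exp (-r / (4 * τ)) ≤
      ((p : ℝ) ^ p * (1 + 8 * τ) ^ p * Real.exp y) * Real.exp (-r / (4 * τ)) :=
        mul_le_mul_of_nonneg_right h6 (Real.exp_pos _).le
    _ = _ := by
      rw [mul_assoc, ← Real.exp_add]
      congr 2
      rw [hy]; field_simp; ring

namespace SFlow
variable {m t0 : ℝ} (S : SFlow m t0)

lemma G_eq (u t : ℝ) : S.G u t = Real.exp (-(S.r u t) / (4 * -(min t t0))) / √(-(min t t0)) := by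
  unfold G
  congr 2
  rw [mul_neg, neg_div_neg_eq]

lemma m_nonneg {m t0 : ℝ} (S : SFlow m t0) : 0 ≤ m := by
  have h := S.ent 0 1 one_pos
  have h2 : 0 ≤ ∫ u, Real.exp (-(S.x u 0 ^ 2 + S.y u 0 ^ 2) / (4 * 1)) * S.g u 0 :=
    integral_nonneg fun u => mul_nonneg (Real.exp_pos _).le (S.gpos u 0).le
  have h3 : 0 < √(4 * π * 1) := by positivity
  by_contra hc
  push Not at hc
  nlinarith

lemma mu_le (u t : ℝ) : |S.mu u t| ≤ 1 + S.r u t := by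
  have := S.r_eq u t
  rw [abs_le]; constructor <;> nlinarith [sq_nonneg (S.nu u t), sq_nonneg (S.mu u t - 1), sq_nonneg (S.mu u t + 1)]

lemma ab_le (u t : ℝ) : |S.a u t| ≤ 1 ∧ |S.b u t| ≤ 1 := by
  have := S.unit u t
  constructor <;> rw [abs_le] <;> constructor <;> nlinarith [sq_nonneg (S.a u t), sq_nonneg (S.b u t)]

lemma fs_le (α β : ℝ) (u t : ℝ) : |α * S.a u t + β * S.b u t| ≤ |α| + |β| := by
  have h := S.ab_le u t
  calc _ ≤ |α * S.a u t| + |β * S.b u t| := abs_add_le _ _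
    _ ≤ _ := by
      rw [abs_mul, abs_mul]
      have := abs_nonneg α; have := abs_nonneg β
      nlinarith [h.1, h.2]

end SFlow

namespace TestFn
variable {m t0 : ℝ} {S : SFlow m t0} {α β : ℝ} (Z : TestFn S α β)

/-- weighted mass -/
def W (t : ℝ) : ℝ := ∫ u, Z.F u t
/-- local dissipation -/
def Q (N t : ℝ) : ℝ := ∫ u in (-N)..N, Z.q u t

lemma F_le (u t : ℝ) : Z.F u t ≤ (Z.C * (4 * (1 + 8 * -(min t t0)) ^ 2) / √(-(min t t0))) *
    (Real.exp (-(S.r u t) / (8 * -(min t t0))) * S.g u t) := by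
  have h0 := S.th_neg t
  have hτ : 0 < -(min t t0) := by linarith
  have h1 := poly_gauss 2 (by norm_num) hτ (S.r_nonneg u t)
  have h2 := Z.b0 u t
  have hg := S.gpos u t
  have hs : 0 < √(-(min t t0)) := Real.sqrt_pos.2 hτ
  unfold F
  rw [S.G_eq]
  have hC := Z.Cn
  push_cast at h1
  set e4 := Real.exp (-(S.r u t) / (4 * -(min t t0)))
  set e8 := Real.exp (-(S.r u t) / (8 * -(min t t0)))
  have he4 : 0 < e4 := Real.exp_pos _
  calc Z.z0 u t * (e4 / √(-(min t t0))) * S.g u t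
      ≤ (Z.C * (1 + S.r u t) ^ 2) * (e4 / √(-(min t t0))) * S.g u t := by gcongr
    _ = Z.C * ((1 + S.r u t) ^ 2 * e4) / √(-(min t t0)) * S.g u t := by ring
    _ ≤ Z.C * (2 ^ 2 * (1 + 8 * -(min t t0)) ^ 2 * e8) / √(-(min t t0)) * S.g u t := by gcongr
    _ = _ := by ring

lemma F_int (t : ℝ) : Integrable (fun u => Z.F u t) := by
  have hτ : 0 < -(min t t0) := by have := S.th_neg t; linarith
  have h1 := S.ent_int t (2 * -(min t t0)) (by positivity)
  refine (h1.const_mul (Z.C * (4 * (1 + 8 * -(min t t0)) ^ 2) / √(-(min t t0)))).mono' ?_ ?_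
  · have := Z.cF
    exact (Continuous.aestronglyMeasurable (by fun_prop : Continuous fun u => Z.F u t))
  · refine Eventually.of_forall fun u => ?_
    rw [Real.norm_of_nonneg (Z.F_nonneg u t)]
    refine (Z.F_le u t).trans (le_of_eq ?_)
    unfold SFlow.r
    congr 4
    ring

lemma W_nonneg (t : ℝ) : 0 ≤ Z.W t := integral_nonneg fun u => Z.F_nonneg u t

lemma W_le (t : ℝ) (ht : t ≤ t0) : Z.W t ≤ Z.C * 4 * m * √(8 * π) * (1 + 8 * -t) ^ 2 := by
  have hmin : min t t0 = t := min_eq_left ht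
  have hτ : 0 < -t := by have := S.th_neg t; linarith
  have h1 := S.ent_int t (2 * -t) (by positivity)
  have h2 := S.ent t (2 * -t) (by positivity)
  have hs : 0 < √(-t) := Real.sqrt_pos.2 hτ
  have hC := Z.Cn
  have hle : Z.W t ≤ ∫ u, (Z.C * (4 * (1 + 8 * -t) ^ 2) / √(-t)) *
      (Real.exp (-(S.x u t ^ 2 + S.y u t ^ 2) / (4 * (2 * -t))) * S.g u t) := by
    refine integral_mono (Z.F_int t) (h1.const_mul _) fun u => ?_
    refine (Z.F_le u t).trans (le_of_eq ?_)
    rw [hmin]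
    unfold SFlow.r
    congr 4
    ring
  rw [integral_const_mul] at hle
  refine hle.trans ((mul_le_mul_of_nonneg_left h2 (by positivity)).trans (le_of_eq ?_))
  have : √(4 * π * (2 * -t)) = √(8 * π) * √(-t) := by
    rw [← Real.sqrt_mul (by positivity)]; congr 1; ring
  rw [this]
  field_simp

/-- bound of the flux -/
def KB (_Z : TestFn S α β) (t : ℝ) : ℝ :=
  _Z.C * (|α| + |β| + 1 / (2 * -(min t t0))) * (27 * (1 + 8 * -(min t t0)) ^ 3) / √(-(min t t0))

lemma cKB : Continuous Z.KB := by
  unfold KB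
  refine Continuous.div (Continuous.mul (continuous_const.mul (continuous_const.add
    (Continuous.div continuous_const (by fun_prop) ?_))) (by fun_prop)) (by fun_prop) ?_
  · intro t; have := S.th_neg t; exact mul_ne_zero (by norm_num) (by linarith)
  · intro t; have := S.th_neg t; exact (Real.sqrt_pos.2 (by linarith)).ne'

lemma B_le (u t : ℝ) : |Z.B u t| ≤ Z.KB t * Real.exp (-(S.r u t) / (8 * -(min t t0))) := by
  have hτ : 0 < -(min t t0) := by have := S.th_neg t; linarith
  have h1 := poly_gauss 3 (by norm_num) hτ (S.r_nonneg u t)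
  have hG := S.G_eq u t
  have hGp := S.G_pos u t
  have hs : 0 < √(-(min t t0)) := Real.sqrt_pos.2 hτ
  have hC := Z.Cn
  have hr := S.r_nonneg u t
  have hfs := S.fs_le α β u t
  have hmu := S.mu_le u t
  have hb1 := Z.b1 u t
  have hb0 := Z.b0 u t
  have hz0 := Z.z0n u t
  unfold KB
  set τ := -(min t t0) with hτd
  have hth : min t t0 = -τ := by rw [hτd]; ring
  have e1 : |Z.B u t| ≤ |Z.z1 u t| * |α * S.a u t + β * S.b u t| * S.G u t
      + Z.z0 u t * |S.mu u t| * S.G u t / (2 * τ) := by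
    unfold B
    refine (abs_sub _ _).trans (le_of_eq ?_)
    rw [abs_mul, abs_mul, abs_div, abs_mul, abs_mul, abs_of_pos hGp, abs_of_nonneg hz0, hth,
      show |2 * -τ| = 2 * τ by rw [mul_neg, abs_neg, abs_of_pos (by positivity)]]
  have hone : (1:ℝ) ≤ 1 + S.r u t := by linarith
  have e2 : |Z.B u t| ≤ (Z.C * (1 + S.r u t) ^ 3) * (|α| + |β|) * S.G u t
      + (Z.C * (1 + S.r u t) ^ 2) * (1 + S.r u t) * S.G u t / (2 * τ) := by
    refine e1.trans (add_le_add ?_ ?_)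
    · have : |Z.z1 u t| ≤ Z.C * (1 + S.r u t) ^ 3 :=
        hb1.trans (mul_le_mul_of_nonneg_left (pow_le_pow_right₀ hone (by norm_num)) hC)
      gcongr
    · gcongr
  refine e2.trans ?_
  rw [hG]
  push_cast at h1
  set e4 := Real.exp (-(S.r u t) / (4 * τ))
  set e8 := Real.exp (-(S.r u t) / (8 * τ))
  have he4 : 0 < e4 := Real.exp_pos _
  have ha := abs_nonneg α
  have hb := abs_nonneg β
  calc _ = Z.C * (|α| + |β| + 1 / (2 * τ)) * ((1 + S.r u t) ^ 3 * e4) / √τ := by ring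
    _ ≤ Z.C * (|α| + |β| + 1 / (2 * τ)) * (3 ^ 3 * (1 + 8 * τ) ^ 3 * e8) / √τ := by gcongr
    _ = _ := by ring

lemma KB_nonneg (t : ℝ) : 0 ≤ Z.KB t := by
  have hτ : 0 < -(min t t0) := by have := S.th_neg t; linarith
  have hC := Z.Cn
  have := abs_nonneg α
  have := abs_nonneg β
  unfold KB
  positivity

lemma B_le' (u t : ℝ) : |Z.B u t| ≤ Z.KB t := by
  have hτ : 0 < -(min t t0) := by have := S.th_neg t; linarith
  refine (Z.B_le u t).trans (mul_le_of_le_one_right (Z.KB_nonneg t) (Real.exp_le_one_iff.2 ?_))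
  have := S.r_nonneg u t
  rw [neg_div]; have : 0 ≤ S.r u t / (8 * -(min t t0)) := by positivity
  linarith

lemma exp_tendsto {r : ℝ → ℝ} {l : Filter ℝ} (h : Tendsto r l atTop) {c : ℝ} (hc : 0 < c) :
    Tendsto (fun u => Real.exp (-(r u) / c)) l (nhds 0) := by
  refine Real.tendsto_exp_atBot.comp ?_
  have h1 := (h.atTop_div_const hc)
  have h2 := tendsto_neg_atTop_atBot.comp h1
  refine h2.congr fun u => ?_
  simp [neg_div]

lemma B_tendsto {l : Filter ℝ} (t : ℝ) (h : Tendsto (fun u => S.r u t) l atTop) :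
    Tendsto (fun u => Z.B u t) l (nhds 0) := by
  have hτ : 0 < -(min t t0) := by have := S.th_neg t; linarith
  refine squeeze_zero_norm (fun u => Z.B_le u t) ?_
  simpa using (exp_tendsto h (c := 8 * -(min t t0)) (by positivity)).const_mul (Z.KB t)

lemma B_top (t : ℝ) : Tendsto (fun u => Z.B u t) atTop (nhds 0) := Z.B_tendsto t (S.prop_top t)
lemma B_bot (t : ℝ) : Tendsto (fun u => Z.B u t) atBot (nhds 0) := Z.B_tendsto t (S.prop_bot t)

lemma cQ (N : ℝ) : Continuous (Z.Q N) := by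
  unfold Q
  have h := Z.cq
  exact intervalIntegral.continuous_parametric_intervalIntegral_of_continuous'
    (f := fun t u => Z.q u t) (h.comp continuous_swap) _ _

lemma Q_nonneg {N : ℝ} (hN : 0 ≤ N) (t : ℝ) : 0 ≤ Z.Q N t :=
  intervalIntegral.integral_nonneg (by linarith) fun u _ => Z.q_nonneg u t

lemma Q_mono {N N' : ℝ} (hN : 0 ≤ N) (h : N ≤ N') (t : ℝ) : Z.Q N t ≤ Z.Q N' t := by
  have := Z.cq
  have hc : Continuous fun u => Z.q u t := by fun_prop
  exact intervalIntegral.integral_mono_interval (by linarith) (by linarith) h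
    (Eventually.of_forall fun u => Z.q_nonneg u t) (hc.intervalIntegrable _ _)

lemma identity {t1 t2 : ℝ} (h12 : t1 ≤ t2) (h2 : t2 < t0) (N : ℝ) :
    ∫ t in t1..t2, Z.Q N t = (∫ u in (-N)..N, Z.F u t1) - (∫ u in (-N)..N, Z.F u t2)
      + ∫ t in t1..t2, (Z.B N t - Z.B (-N) t) := by
  have cF := Z.cF; have cq := Z.cq; have cB := Z.cB; have cB' := Z.cB'
  have e1 : ∀ u, Z.F u t2 - Z.F u t1 = ∫ t in t1..t2, (-(Z.q u t) + Z.B' u t) := by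
    intro u
    symm
    refine intervalIntegral.integral_eq_sub_of_hasDerivAt (fun t ht => ?_) ?_
    · rw [uIcc_of_le h12] at ht
      exact Z.hF u t (ht.2.trans_lt h2)
    · exact Continuous.intervalIntegrable (by fun_prop) _ _
  have e2 : ∀ t, ∫ u in (-N)..N, Z.B' u t = Z.B N t - Z.B (-N) t := by
    intro t
    refine intervalIntegral.integral_eq_sub_of_hasDerivAt (fun u _ => Z.hB u t) ?_
    exact Continuous.intervalIntegrable (by fun_prop) _ _
  have e3 : (∫ u in (-N)..N, Z.F u t2) - (∫ u in (-N)..N, Z.F u t1)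
      = ∫ u in (-N)..N, ∫ t in t1..t2, (-(Z.q u t) + Z.B' u t) := by
    rw [← intervalIntegral.integral_sub]
    · exact intervalIntegral.integral_congr fun u _ => e1 u
    · exact Continuous.intervalIntegrable (by fun_prop) _ _
    · exact Continuous.intervalIntegrable (by fun_prop) _ _
  have e4 : ∫ u in (-N)..N, ∫ t in t1..t2, (-(Z.q u t) + Z.B' u t)
      = ∫ t in t1..t2, ∫ u in (-N)..N, (-(Z.q u t) + Z.B' u t) := by
    refine intervalIntegral_intervalIntegral_swap ?_
    have hc : Continuous (Function.uncurry fun u t => (-(Z.q u t) + Z.B' u t)) := by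
      unfold Function.uncurry; fun_prop
    have := (hc.continuousOn (s := uIcc (-N) N ×ˢ uIcc t1 t2)).integrableOn_compact
      (μ := (volume : Measure (ℝ × ℝ))) (isCompact_uIcc.prod isCompact_uIcc)
    exact this.mono_set (prod_mono uIoc_subset_uIcc uIoc_subset_uIcc)
  have e5 : ∫ t in t1..t2, ∫ u in (-N)..N, (-(Z.q u t) + Z.B' u t)
      = -(∫ t in t1..t2, Z.Q N t) + ∫ t in t1..t2, (Z.B N t - Z.B (-N) t) := by
    rw [← intervalIntegral.integral_neg, ← intervalIntegral.integral_add]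
    · refine intervalIntegral.integral_congr fun t _ => ?_
      rw [← e2, intervalIntegral.integral_add, intervalIntegral.integral_neg]; rfl
      · exact Continuous.intervalIntegrable (by fun_prop) _ _
      · exact Continuous.intervalIntegrable (by fun_prop) _ _
    · exact (Z.cQ N).neg.intervalIntegrable _ _
    · exact Continuous.intervalIntegrable (by fun_prop) _ _
  rw [e4, e5] at e3
  linarith

lemma mono {t1 t2 : ℝ} (h12 : t1 ≤ t2) (h2 : t2 < t0) {N0 : ℝ} (hN0 : 0 ≤ N0) :
    ∫ t in t1..t2, Z.Q N0 t ≤ Z.W t1 - Z.W t2 := by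
  have cB := Z.cB
  have hlim : Tendsto (fun N : ℝ => (∫ u in (-N)..N, Z.F u t1) - (∫ u in (-N)..N, Z.F u t2)
      + ∫ t in t1..t2, (Z.B N t - Z.B (-N) t)) atTop
      (nhds (Z.W t1 - Z.W t2 + ∫ t in t1..t2, (0:ℝ))) := by
    refine ((intervalIntegral_tendsto_integral (Z.F_int t1) tendsto_neg_atTop_atBot
      tendsto_id).sub (intervalIntegral_tendsto_integral (Z.F_int t2) tendsto_neg_atTop_atBot
      tendsto_id)).add ?_
    refine intervalIntegral.tendsto_integral_filter_of_dominated_convergence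
      (fun t => 2 * Z.KB t) ?_ ?_ ?_ ?_
    · refine Eventually.of_forall fun N => ?_
      exact Continuous.aestronglyMeasurable (by fun_prop)
    · refine Eventually.of_forall fun N => Eventually.of_forall fun t _ => ?_
      rw [Real.norm_eq_abs]
      have := abs_sub (Z.B N t) (Z.B (-N) t)
      have := Z.B_le' N t
      have := Z.B_le' (-N) t
      linarith
    · exact ((Z.cKB).const_mul 2).intervalIntegrable _ _
    · refine Eventually.of_forall fun t _ => ?_
      simpa using (Z.B_top t).sub ((Z.B_bot t).comp tendsto_neg_atTop_atBot)
  simp only [intervalIntegral.integral_zero, add_zero] at hlim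
  refine ge_of_tendsto hlim ?_
  filter_upwards [eventually_ge_atTop N0] with N hN
  rw [← Z.identity h12 h2]
  exact intervalIntegral.integral_mono h12 ((Z.cQ N0).intervalIntegrable _ _)
    ((Z.cQ N).intervalIntegrable _ _) fun t => Z.Q_mono hN0 hN t

lemma W_anti {t1 t2 : ℝ} (h12 : t1 ≤ t2) (h2 : t2 < t0) : Z.W t2 ≤ Z.W t1 := by
  have h := Z.mono h12 h2 le_rfl
  have : 0 ≤ ∫ t in t1..t2, Z.Q 0 t :=
    intervalIntegral.integral_nonneg h12 fun t _ => Z.Q_nonneg le_rfl t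
  linarith

lemma W_pos_of {u t : ℝ} (h : 0 < Z.z0 u t) : 0 < Z.W t := by
  have := Z.cF
  have hc : Continuous fun u => Z.F u t := by fun_prop
  unfold W
  refine (integral_pos_iff_support_of_nonneg (fun u => Z.F_nonneg u t) (Z.F_int t)).2 ?_
  refine IsOpen.measure_pos _ hc.isOpen_support ⟨u, ?_⟩
  have := S.G_pos u t; have := S.gpos u t
  simp only [Function.mem_support, F]
  positivity

lemma W_pos {u0 : ℝ} (h : 0 < Z.z0 u0 t0) {t : ℝ} (ht : t < t0) : 0 < Z.W t := by
  have hc : Continuous fun t => Z.z0 u0 t := by have := Z.c0; fun_prop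
  have h1 : ∀ᶠ s in nhds t0, 0 < Z.z0 u0 s := hc.continuousAt.eventually_const_lt h
  have h2 : ∀ᶠ s in nhdsWithin t0 (Iio t0), 0 < Z.z0 u0 s ∧ t < s ∧ s < t0 := by
    filter_upwards [h1.filter_mono nhdsWithin_le_nhds, self_mem_nhdsWithin,
      nhdsWithin_le_nhds (Ioi_mem_nhds ht)] with s a b c
    exact ⟨a, c, b⟩
  obtain ⟨s, hs, hts, hst⟩ := h2.exists
  exact (Z.W_pos_of hs).trans_le (Z.W_anti hts.le hst)

end TestFn

lemma conc_alg {z0 z1 z2 f mu nu E τ : ℝ} (hτ : 0 < τ) (h0 : 0 ≤ z0) (h2 : 0 ≤ z2)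
    (h : z1 ^ 2 ≤ 2 * z0 * z2) :
    z1 * f * mu + z0 * E * nu ≤ 4 * τ * (z2 * f ^ 2 + z0 * E ^ 2)
      + z0 * (mu ^ 2 + nu ^ 2) / (8 * τ) := by
  have e1 : z0 * E * nu ≤ 4 * τ * (z0 * E ^ 2) + z0 * nu ^ 2 / (8 * τ) := by
    have : 0 ≤ z0 / (8 * τ) * ((nu - 4 * τ * E) ^ 2 + 16 * τ ^ 2 * E ^ 2) := by positivity
    have e : z0 / (8 * τ) * ((nu - 4 * τ * E) ^ 2 + 16 * τ ^ 2 * E ^ 2)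
      = 4 * τ * (z0 * E ^ 2) + z0 * nu ^ 2 / (8 * τ) - z0 * E * nu := by field_simp; ring
    linarith
  have e2 : z1 * f * mu ≤ 4 * τ * (z2 * f ^ 2) + z0 * mu ^ 2 / (8 * τ) := by
    set A := 4 * τ * (z2 * f ^ 2)
    set D := z0 * mu ^ 2 / (8 * τ)
    have hA : 0 ≤ A := by positivity
    have hD : 0 ≤ D := by positivity
    refine abs_le_of_sq_le_sq' ?_ (add_nonneg hA hD) |>.2
    have e3 : 4 * (A * D) = 2 * z0 * z2 * (f * mu) ^ 2 := by
      simp only [A, D]; field_simp; ring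
    have e4 : (z1 * f * mu) ^ 2 ≤ 4 * (A * D) := by
      rw [e3, mul_assoc z1, mul_pow]
      exact mul_le_mul_of_nonneg_right h (sq_nonneg _)
    nlinarith [sq_nonneg (A - D)]
  calc _ ≤ _ := add_le_add e2 e1
    _ = _ := by ring

namespace TestFn
variable {m t0 : ℝ} {S : SFlow m t0} {α β : ℝ} (Z : TestFn S α β)

lemma hD (u t : ℝ) : HasDerivAt (fun u => Z.z0 u t * S.mu u t * S.G u t)
    (((Z.z1 u t * (α * S.a u t + β * S.b u t) * S.mu u t + Z.z0 u t * S.E u t * S.nu u t)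
      + Z.z0 u t + Z.z0 u t * S.r u t / (2 * min t t0)) * S.G u t * S.g u t) u := by
  refine (((Z.hu0 u t).mul (S.hmu u t)).mul (S.hG u t)).congr_deriv ?_
  have := (S.th_neg t).ne
  simp only [Pi.mul_apply]
  rw [S.r_eq]; unfold SFlow.E
  field_simp
  ring

lemma D_tendsto {l : Filter ℝ} (t : ℝ) (h : Tendsto (fun u => S.r u t) l atTop) :
    Tendsto (fun u => Z.z0 u t * S.mu u t * S.G u t) l (nhds 0) := by
  have hτ : 0 < -(min t t0) := by have := S.th_neg t; linarith
  have key := (exp_tendsto h (c := 8 * -(min t t0)) (by positivity)).const_mul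
    (Z.C * (27 * (1 + 8 * -(min t t0)) ^ 3) / √(-(min t t0)))
  rw [mul_zero] at key
  refine squeeze_zero_norm (fun u => ?_) key
  have h1 := poly_gauss 3 (by norm_num) hτ (S.r_nonneg u t)
  have hs : 0 < √(-(min t t0)) := Real.sqrt_pos.2 hτ
  have hC := Z.Cn
  have hr := S.r_nonneg u t
  have hmu := S.mu_le u t
  have hb0 := Z.b0 u t
  have hz0 := Z.z0n u t
  rw [Real.norm_eq_abs, abs_mul, abs_mul, abs_of_nonneg hz0, abs_of_pos (S.G_pos u t), S.G_eq]
  push_cast at h1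
  set τ := -(min t t0)
  set e4 := Real.exp (-(S.r u t) / (4 * τ))
  set e8 := Real.exp (-(S.r u t) / (8 * τ))
  have he4 : 0 < e4 := Real.exp_pos _
  calc _ ≤ (Z.C * (1 + S.r u t) ^ 2) * (1 + S.r u t) * (e4 / √τ) := by gcongr
    _ = Z.C * ((1 + S.r u t) ^ 3 * e4) / √τ := by ring
    _ ≤ Z.C * (3 ^ 3 * (1 + 8 * τ) ^ 3 * e8) / √τ := by gcongr
    _ = _ := by ring

lemma conc {t A : ℝ} (ht : t < t0) (hA : 0 ≤ A) (hW : 0 < Z.W t)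
    (hQ : ∀ N : ℕ, (-t) * Z.Q N t ≤ A * Z.W t) :
    ∃ u, 0 < Z.z0 u t ∧ S.r u t ≤ (8 + 16 * A) * (-t) := by
  by_contra hc
  push Not at hc
  have hmin := S.th_eq ht
  have hτ : 0 < -t := by have := S.th_neg t; linarith
  set τ := -t with hτd
  have htt : t = -τ := by rw [hτd]; ring
  have cF := Z.cF; have cq := Z.cq
  have c0 := Z.c0; have c1 := Z.c1; have cE := S.cE; have cG := S.cG; have cg := S.cg
  have cr := S.cr; have cmu := S.cmu; have cnu := S.cnu; have ca := S.ca; have cb := S.cb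
  have hpt : ∀ u, ((Z.z1 u t * (α * S.a u t + β * S.b u t) * S.mu u t
      + Z.z0 u t * S.E u t * S.nu u t)
      + Z.z0 u t + Z.z0 u t * S.r u t / (2 * min t t0)) * S.G u t * S.g u t
      ≤ 4 * τ * Z.q u t + Z.F u t - (3 + 6 * A) * Z.F u t := by
    intro u
    have h1 := conc_alg (f := α * S.a u t + β * S.b u t) (mu := S.mu u t) (nu := S.nu u t)
      (E := S.E u t) hτ (Z.z0n u t) (Z.z2n u t) (Z.z1b u t)
    rw [← S.r_eq] at h1
    have h2 : (8 + 16 * A) * Z.z0 u t ≤ Z.z0 u t * S.r u t / τ := by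
      rcases (Z.z0n u t).eq_or_lt with h | h
      · rw [← h]; simp
      · rw [le_div_iff₀ hτ]
        have := (hc u h).le
        nlinarith
    have h3 : Z.z0 u t * S.r u t / (2 * min t t0) = -(Z.z0 u t * S.r u t / τ) / 2 := by
      rw [hmin, htt]; field_simp
    have h4 : Z.z0 u t * S.r u t / (8 * τ) = (Z.z0 u t * S.r u t / τ) / 8 := by
      field_simp
    rw [h3]; rw [h4] at h1
    unfold q F
    have hp : 0 < S.G u t * S.g u t := mul_pos (S.G_pos u t) (S.gpos u t)
    have h5 : (Z.z1 u t * (α * S.a u t + β * S.b u t) * S.mu u t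
      + Z.z0 u t * S.E u t * S.nu u t)
      + Z.z0 u t + -(Z.z0 u t * S.r u t / τ) / 2 ≤
      4 * τ * (Z.z2 u t * (α * S.a u t + β * S.b u t) ^ 2 + Z.z0 u t * S.E u t ^ 2)
        + Z.z0 u t - (3 + 6 * A) * Z.z0 u t := by linarith
    have h6 := mul_le_mul_of_nonneg_right h5 hp.le
    calc _ = _ := by rw [mul_assoc]
      _ ≤ _ := h6
      _ = _ := by ring
  have hInt : ∀ N : ℕ, Z.z0 N t * S.mu N t * S.G N t - Z.z0 (-N) t * S.mu (-N) t * S.G (-N) t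
      ≤ 4 * (A * Z.W t) - (2 + 6 * A) * ∫ u in (-(N:ℝ))..N, Z.F u t := by
    intro N
    have hN : (0:ℝ) ≤ N := Nat.cast_nonneg _
    have hcont : Continuous fun u => ((Z.z1 u t * (α * S.a u t + β * S.b u t) * S.mu u t
      + Z.z0 u t * S.E u t * S.nu u t)
      + Z.z0 u t + Z.z0 u t * S.r u t / (2 * min t t0)) * S.G u t * S.g u t := by fun_prop
    rw [← intervalIntegral.integral_eq_sub_of_hasDerivAt (fun u _ => Z.hD u t)
      (hcont.intervalIntegrable _ _)]
    have h1 : Continuous fun u => 4 * τ * Z.q u t + Z.F u t - (3 + 6 * A) * Z.F u t := by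
      fun_prop
    have h2 := intervalIntegral.integral_mono (μ := volume) (a := -(N:ℝ)) (b := N) (by linarith)
      (hcont.intervalIntegrable _ _) (h1.intervalIntegrable _ _) hpt
    refine h2.trans ?_
    have i1 : IntervalIntegrable (fun u => Z.F u t) volume (-(N:ℝ)) N :=
      Continuous.intervalIntegrable (by fun_prop) _ _
    have i2 : IntervalIntegrable (fun u => Z.q u t) volume (-(N:ℝ)) N :=
      Continuous.intervalIntegrable (by fun_prop) _ _
    rw [intervalIntegral.integral_sub ((i2.const_mul _).add i1) (i1.const_mul _),
      intervalIntegral.integral_add (i2.const_mul _) i1, intervalIntegral.integral_const_mul,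
      intervalIntegral.integral_const_mul]
    have := hQ N
    unfold Q at this
    linarith
  have nat : Tendsto (fun n : ℕ => (n : ℝ)) atTop atTop := tendsto_natCast_atTop_atTop
  have l1 := (((Z.D_tendsto t (S.prop_top t)).comp nat).sub
    ((Z.D_tendsto t (S.prop_bot t)).comp (tendsto_neg_atTop_atBot.comp nat)))
  have l2 := ((intervalIntegral_tendsto_integral (Z.F_int t) (tendsto_neg_atTop_atBot.comp nat)
      nat).const_mul (2 + 6 * A)).const_sub (4 * (A * Z.W t))
  have l3 := le_of_tendsto_of_tendsto' l1 l2 hInt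
  change 0 - 0 ≤ 4 * (A * Z.W t) - (2 + 6 * A) * Z.W t at l3
  nlinarith [mul_nonneg hA hW.le]

end TestFn

lemma slow_step (L : ℕ → ℝ) (C c : ℝ) (h : ∀ n : ℕ, L n ≤ C + c * n) (n0 : ℕ) :
    ∃ n ≥ n0, L (n + 1) - L n ≤ c + 1 := by
  by_contra hc
  push Not at hc
  have h1 : ∀ k : ℕ, L n0 + (c + 1) * k ≤ L (n0 + k) := by
    intro k
    induction k with
    | zero => simp
    | succ k ih =>
      have := hc (n0 + k) (by omega)
      rw [← add_assoc]; push_cast; linarith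
  obtain ⟨k, hk⟩ := exists_nat_gt (C + c * n0 - L n0)
  have h2 := h1 k
  have h3 := h (n0 + k)
  push_cast at h3
  linarith

lemma pigeon {ι : Type} [Fintype ι] (l : ι → ℕ → ℝ) (C : ι → ℝ) (c : ℝ)
    (hmono : ∀ i n, l i n ≤ l i (n + 1)) (h : ∀ i (n : ℕ), l i n ≤ C i + c * n)
    (w : ℕ → ℝ) (K : ℝ) (hw : Monotone w) (hK : ∀ n, w n ≤ K) {ε : ℝ} (hε : 0 < ε) :
    ∃ n, (∀ i, l i (n + 1) - l i n ≤ Fintype.card ι * c + 1) ∧ w (n + 1) - w n ≤ ε := by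
  have hb : BddAbove (range w) := ⟨K, by rintro _ ⟨n, rfl⟩; exact hK n⟩
  have hlim := tendsto_atTop_ciSup hw hb
  have h1 : ∀ᶠ n in atTop, (⨆ i, w i) - ε < w n := hlim.eventually_const_lt (by linarith)
  obtain ⟨n0, hn0⟩ := h1.exists
  obtain ⟨n, hn, hs⟩ := slow_step (fun n => ∑ i, l i n) (∑ i, C i) (Fintype.card ι * c)
    (fun n => by
      calc ∑ i, l i n ≤ ∑ i, (C i + c * n) := Finset.sum_le_sum fun i _ => h i n
        _ = _ := by rw [Finset.sum_add_distrib]; simp; ring) n0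
  refine ⟨n, fun i => ?_, ?_⟩
  · refine le_trans ?_ hs
    rw [← Finset.sum_sub_distrib]
    exact Finset.single_le_sum (f := fun i => l i (n + 1) - l i n)
      (fun j _ => sub_nonneg.2 (hmono j n)) (Finset.mem_univ i)
  · have h2 := le_ciSup hb (n + 1)
    have h3 := hw hn
    linarith

/-- averaging over a compact interval -/
lemma average {p q : ℝ} (hpq : p < q) (f : ℕ → ℝ → ℝ) (hc : ∀ n, Continuous (f n))
    (hm : ∀ n t, f n t ≤ f (n + 1) t) {I : ℝ} (hI : ∀ n, ∫ t in p..q, f n t ≤ I) :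
    ∃ t ∈ Icc p q, ∀ n, (q - p) * f n t ≤ I := by
  have hne : ∀ n, (Icc p q ∩ {t | (q - p) * f n t ≤ I}).Nonempty := by
    intro n
    by_contra hcon
    rw [not_nonempty_iff_eq_empty] at hcon
    have h1 : ∀ t ∈ Icc p q, I / (q - p) < f n t := by
      intro t ht
      by_contra h
      push Not at h
      have : t ∈ Icc p q ∩ {t | (q - p) * f n t ≤ I} := by
        refine ⟨ht, ?_⟩
        rw [le_div_iff₀ (by linarith)] at h
        simp only [mem_ofPred_eq]; linarith
      rw [hcon] at this; exact this
    have h2 : ∫ t in p..q, I / (q - p) < ∫ t in p..q, f n t :=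
      intervalIntegral.integral_lt_integral_of_continuousOn_of_le_of_exists_lt hpq
        continuousOn_const (hc n).continuousOn (fun t ht => (h1 t ⟨ht.1.le, ht.2⟩).le)
        ⟨p, ⟨le_rfl, hpq.le⟩, h1 p ⟨le_rfl, hpq.le⟩⟩
    have h3 := hI n
    rw [intervalIntegral.integral_const, smul_eq_mul, mul_div_cancel₀ _ (by linarith)] at h2
    linarith
  have hclosed : ∀ n, IsClosed {t | (q - p) * f n t ≤ I} := fun n =>
    isClosed_le ((hc n).const_mul _) continuous_const
  obtain ⟨t, ht⟩ := IsCompact.nonempty_iInter_of_sequence_nonempty_isCompact_isClosed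
    (fun n => Icc p q ∩ {t | (q - p) * f n t ≤ I})
    (fun n t ht => ⟨ht.1, le_trans (mul_le_mul_of_nonneg_left (hm n t) (by linarith)) ht.2⟩) hne
    (isCompact_Icc.inter_right (hclosed 0)) (fun n => isClosed_Icc.inter (hclosed n))
  rw [mem_iInter] at ht
  exact ⟨t, (ht 0).1, fun n => (ht n).2⟩

lemma good_time {m t0 : ℝ} (S : SFlow m t0) {ι : Type} [Fintype ι] {α β : ι → ℝ}
    (Z : ∀ i, TestFn S (α i) (β i)) (hpos : ∀ i t, t < t0 → 0 < (Z i).W t)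
    (Z' : TestFn S 0 0) (K : ℝ) (hK : ∀ t < t0, Z'.W t ≤ K) :
    ∃ A : ℝ, 0 ≤ A ∧ ∀ ε > 0, ∃ t < t0,
      (∀ i (N : ℕ), (-t) * (Z i).Q N t ≤ A * (Z i).W t) ∧ ∀ N : ℕ, (-t) * Z'.Q N t ≤ ε := by
  set M : ℝ := Fintype.card ι + 1 with hM
  have hMpos : 0 < M := by positivity
  set bb : ℝ := Fintype.card ι * Real.log 4 + 1
  refine ⟨2 * M * Real.exp bb, by positivity, fun ε hε => ?_⟩
  have ht0 := S.t0neg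
  obtain ⟨n0, hn0⟩ : ∃ n0 : ℕ, -t0 < 2 ^ n0 := pow_unbounded_of_one_lt _ (by norm_num)
  set s : ℕ → ℝ := fun n => -2 ^ (n0 + n) with hs
  have hs0 : ∀ n, s n < t0 := by
    intro n
    have : (2:ℝ) ^ n0 ≤ 2 ^ (n0 + n) := pow_le_pow_right₀ (by norm_num) (by omega)
    simp only [hs]; linarith
  have hstep : ∀ n, s (n + 1) = 2 * s n := by
    intro n; simp only [hs]; rw [← add_assoc, pow_succ]; ring
  have hsneg : ∀ n, s n < 0 := fun n => (hs0 n).trans ht0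
  have hsanti : ∀ n, s (n + 1) ≤ s n := by
    intro n; have := hsneg n; rw [hstep]; linarith
  have hε' : 0 < ε / (2 * M) := by positivity
  obtain ⟨n, hn1, hn2⟩ := pigeon (fun i n => Real.log ((Z i).W (s n)))
    (fun i => Real.log (((Z i).C * 4 * m * √(8 * π) + 1) * (81 * 4 ^ n0))) (Real.log 4)
    (fun i n => Real.log_le_log (hpos i _ (hs0 n)) ((Z i).W_anti (hsanti n) (hs0 n)))
    (fun i n => by
      have h1 := (Z i).W_le (s n) (hs0 n).le
      have hC := (Z i).Cn
      have hm := S.m_nonneg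
      have hA0 : 0 ≤ (Z i).C * 4 * m * √(8 * π) := by positivity
      set A0 := (Z i).C * 4 * m * √(8 * π)
      have e1 : (1 + 8 * -(s n)) ^ 2 ≤ 81 * 4 ^ n0 * 4 ^ n := by
        have h2 : 1 + 8 * -(s n) ≤ 9 * 2 ^ (n0 + n) := by
          have : (1:ℝ) ≤ 2 ^ (n0 + n) := one_le_pow₀ (by norm_num)
          simp only [hs]; linarith
        have h3 : 0 ≤ 1 + 8 * -(s n) := by have := hsneg n; linarith
        calc _ ≤ (9 * 2 ^ (n0 + n)) ^ 2 := pow_le_pow_left₀ h3 h2 2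
          _ = _ := by
            rw [mul_pow, ← pow_mul, mul_comm (n0 + n) 2, pow_mul, pow_add]; norm_num; ring
      have e2 : (Z i).W (s n) ≤ (A0 + 1) * (81 * 4 ^ n0) * 4 ^ n := by
        calc _ ≤ _ := h1
          _ ≤ A0 * (81 * 4 ^ n0 * 4 ^ n) := by gcongr
          _ ≤ (A0 + 1) * (81 * 4 ^ n0 * 4 ^ n) := by gcongr; linarith
          _ = _ := by ring
      refine (Real.log_le_log (hpos i _ (hs0 n)) e2).trans (le_of_eq ?_)
      rw [Real.log_mul (by positivity) (by positivity), Real.log_pow]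
      ring)
    (fun n => Z'.W (s n)) K
    (monotone_nat_of_le_succ fun n => Z'.W_anti (hsanti n) (hs0 n)) (fun n => hK _ (hs0 n)) hε'
  set p := s (n + 1) with hp
  set q := s n with hq
  have hp2 : p = 2 * q := hstep n
  have hqn : q < 0 := hsneg n
  have hpq : p < q := by linarith
  have hWp : ∀ i, 0 < (Z i).W p := fun i => hpos i _ (hs0 _)
  obtain ⟨t, ht, hQ⟩ := average hpq
    (fun N t => (∑ i, (Z i).Q N t / (Z i).W p) + Z'.Q N t / (ε / (2 * M)))
    (fun N => by
      have h1 : ∀ i, Continuous ((Z i).Q N) := fun i => (Z i).cQ N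
      have h2 := Z'.cQ N
      exact (continuous_finsetSum _ fun i _ => (h1 i).div_const _).add (h2.div_const _))
    (fun N t => by
      have hN : ((N:ℕ):ℝ) ≤ ((N + 1 : ℕ) : ℝ) := by push_cast; linarith
      have h1 : ∀ i, (Z i).Q N t ≤ (Z i).Q ((N + 1 : ℕ) : ℝ) t :=
        fun i => (Z i).Q_mono (Nat.cast_nonneg _) hN t
      have h2 : Z'.Q N t ≤ Z'.Q ((N + 1 : ℕ) : ℝ) t := Z'.Q_mono (Nat.cast_nonneg _) hN t
      refine add_le_add (Finset.sum_le_sum fun i _ => ?_) ?_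
      · exact div_le_div_of_nonneg_right (h1 i) (hWp i).le
      · exact div_le_div_of_nonneg_right h2 hε'.le)
    (I := M) (fun N => by
      have hN : (0:ℝ) ≤ (N:ℕ) := Nat.cast_nonneg _
      rw [intervalIntegral.integral_add, intervalIntegral.integral_finsetSum]
      · simp only [intervalIntegral.integral_div]
        rw [hM]
        refine add_le_add ?_ ?_
        · have : ∀ i ∈ Finset.univ, (∫ t in p..q, (Z i).Q N t) / (Z i).W p ≤ 1 := by
            intro i _
            rw [div_le_one (hWp i)]
            have h1 := (Z i).mono hpq.le (hs0 n) hN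
            have h2 := (Z i).W_nonneg q
            linarith
          refine (Finset.sum_le_sum this).trans ?_
          simp
        · rw [div_le_one hε']
          exact (Z'.mono hpq.le (hs0 n) hN).trans hn2
      · intro i _; exact (((Z i).cQ N).div_const _).intervalIntegrable _ _
      · exact (continuous_finsetSum _ fun i _ => ((Z i).cQ N).div_const _).intervalIntegrable _ _
      · exact ((Z'.cQ N).div_const _).intervalIntegrable _ _)
  have htq : t ≤ q := ht.2
  have htp : p ≤ t := ht.1
  have htt0 : t < t0 := htq.trans_lt (hs0 n)
  have hlen : q - p = -q := by linarith
  have hτ : -t ≤ 2 * (q - p) := by linarith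
  refine ⟨t, htt0, fun i N => ?_, fun N => ?_⟩
  · have hN : (0:ℝ) ≤ (N:ℕ) := Nat.cast_nonneg _
    have h1 := hQ N
    have h2 : (Z i).Q N t / (Z i).W p ≤
        (∑ i, (Z i).Q N t / (Z i).W p) + Z'.Q N t / (ε / (2 * M)) := by
      have a1 := Finset.single_le_sum (f := fun i => (Z i).Q N t / (Z i).W p)
        (fun j _ => div_nonneg ((Z j).Q_nonneg hN t) (hWp j).le) (Finset.mem_univ i)
      have a2 : 0 ≤ Z'.Q N t / (ε / (2 * M)) := div_nonneg (Z'.Q_nonneg hN t) hε'.le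
      linarith
    have h3 : (q - p) * ((Z i).Q N t / (Z i).W p) ≤ M :=
      (mul_le_mul_of_nonneg_left h2 (by linarith)).trans h1
    have h4 : (q - p) * (Z i).Q N t ≤ M * (Z i).W p := by
      rw [mul_div_assoc', div_le_iff₀ (hWp i)] at h3; exact h3
    have h5 : (Z i).W p ≤ Real.exp bb * (Z i).W t := by
      have h6 := hn1 i
      have hWq : 0 < (Z i).W q := hpos i _ (hs0 n)
      have h7 : Real.log ((Z i).W p) ≤ bb + Real.log ((Z i).W q) := by
        have : Real.log ((Z i).W (s (n + 1))) - Real.log ((Z i).W (s n)) ≤ bb := h6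
        linarith
      have h8 := Real.exp_le_exp.2 h7
      rw [Real.exp_log (hWp i), Real.exp_add, Real.exp_log hWq] at h8
      exact h8.trans (mul_le_mul_of_nonneg_left ((Z i).W_anti htq (hs0 n)) (Real.exp_pos _).le)
    have h9 := (Z i).Q_nonneg hN t
    calc -t * (Z i).Q N t ≤ 2 * (q - p) * (Z i).Q N t := by gcongr
      _ = 2 * ((q - p) * (Z i).Q N t) := by ring
      _ ≤ 2 * (M * (Real.exp bb * (Z i).W t)) := by
        have := mul_le_mul_of_nonneg_left h5 hMpos.le
        linarith
      _ = _ := by ring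
  · have hN : (0:ℝ) ≤ (N:ℕ) := Nat.cast_nonneg _
    have h1 := hQ N
    have h2 : Z'.Q N t / (ε / (2 * M)) ≤
        (∑ i, (Z i).Q N t / (Z i).W p) + Z'.Q N t / (ε / (2 * M)) := by
      have a1 : 0 ≤ ∑ i, (Z i).Q N t / (Z i).W p :=
        Finset.sum_nonneg fun j _ => div_nonneg ((Z j).Q_nonneg hN t) (hWp j).le
      linarith
    have h3 : (q - p) * (Z'.Q N t / (ε / (2 * M))) ≤ M :=
      (mul_le_mul_of_nonneg_left h2 (by linarith)).trans h1
    rw [mul_div_assoc', div_le_iff₀ hε', show M * (ε / (2 * M)) = ε / 2 by field_simp] at h3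
    have h9 := Z'.Q_nonneg hN t
    calc -t * Z'.Q N t ≤ 2 * (q - p) * Z'.Q N t := by gcongr
      _ = 2 * ((q - p) * Z'.Q N t) := by ring
      _ ≤ ε := by linarith

/-- static curve data -/
structure SCurve (m : ℝ) where
  x : ℝ → ℝ
  y : ℝ → ℝ
  a : ℝ → ℝ
  b : ℝ → ℝ
  k : ℝ → ℝ
  g : ℝ → ℝ
  ck : Continuous k
  cg : Continuous g
  hx : ∀ u, HasDerivAt x (a u * g u) u
  hy : ∀ u, HasDerivAt y (b u * g u) u
  ha : ∀ u, HasDerivAt a (-(b u) * k u * g u) u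
  hb : ∀ u, HasDerivAt b (a u * k u * g u) u
  gpos : ∀ u, 0 < g u
  unit : ∀ u, a u ^ 2 + b u ^ 2 = 1
  prop_top : Tendsto (fun u => x u ^ 2 + y u ^ 2) atTop atTop
  prop_bot : Tendsto (fun u => x u ^ 2 + y u ^ 2) atBot atTop
  ent_int : ∀ l, 0 < l → Integrable (fun u => Real.exp (-(x u ^ 2 + y u ^ 2) / (4 * l)) * g u)
  ent : ∀ l, 0 < l →
    ∫ u, Real.exp (-(x u ^ 2 + y u ^ 2) / (4 * l)) * g u ≤ m * √(4 * π * l)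

namespace SCurve
variable {m : ℝ} (S : SCurve m)

def r (u : ℝ) : ℝ := S.x u ^ 2 + S.y u ^ 2
def mu (u : ℝ) : ℝ := S.x u * S.a u + S.y u * S.b u
def nu (u : ℝ) : ℝ := -(S.x u) * S.b u + S.y u * S.a u
def E (u : ℝ) : ℝ := S.k u + S.nu u / 2
def e (u : ℝ) : ℝ := Real.exp (-(S.r u) / 4)
/-- a bound for the entropy type integrals -/
def K (_S : SCurve m) : ℝ := 9 * (m * √(8 * π))

lemma cx : Continuous S.x := continuous_iff_continuousAt.2 fun u => (S.hx u).continuousAt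
lemma cy : Continuous S.y := continuous_iff_continuousAt.2 fun u => (S.hy u).continuousAt
lemma ca : Continuous S.a := continuous_iff_continuousAt.2 fun u => (S.ha u).continuousAt
lemma cb : Continuous S.b := continuous_iff_continuousAt.2 fun u => (S.hb u).continuousAt
lemma cr : Continuous S.r := by
  have := S.cx; have := S.cy; unfold r; fun_prop
lemma cmu : Continuous S.mu := by
  have := S.cx; have := S.cy; have := S.ca; have := S.cb; unfold mu; fun_prop
lemma cnu : Continuous S.nu := by
  have := S.cx; have := S.cy; have := S.ca; have := S.cb; unfold nu; fun_prop
lemma cE : Continuous S.E := by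
  have := S.ck; have := S.cnu; unfold E; fun_prop
lemma ce : Continuous S.e := by
  have := S.cr; unfold e; fun_prop
lemma e_pos (u : ℝ) : 0 < S.e u := Real.exp_pos _
lemma r_nonneg (u : ℝ) : 0 ≤ S.r u := by unfold r; positivity
lemma r_eq (u : ℝ) : S.r u = S.mu u ^ 2 + S.nu u ^ 2 := by
  have := S.unit u
  unfold r mu nu
  linear_combination (-(S.x u ^ 2 + S.y u ^ 2)) * this

lemma hP (u : ℝ) : HasDerivAt (fun u => S.nu u * S.e u) (-(S.mu u * S.E u * S.e u * S.g u)) u := by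
  have hr : HasDerivAt S.r (2 * S.mu u * S.g u) u := by
    refine (((S.hx u).pow 2).add ((S.hy u).pow 2)).congr_deriv ?_
    unfold mu; push_cast; ring
  have hn : HasDerivAt S.nu (-(S.k u) * S.mu u * S.g u) u := by
    refine (((S.hx u).neg.mul (S.hb u)).add ((S.hy u).mul (S.ha u))).congr_deriv ?_
    simp only [Pi.neg_apply]
    unfold mu; ring
  have he : HasDerivAt S.e (S.e u * (-(2 * S.mu u * S.g u) / 4)) u := (hr.neg.div_const 4).exp
  refine (hn.mul he).congr_deriv ?_
  unfold E; ring

lemma K_nonneg {m : ℝ} (S : SCurve m) : 0 ≤ S.K := by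
  have h := S.ent 2 two_pos
  have h2 : 0 ≤ ∫ u, Real.exp (-(S.x u ^ 2 + S.y u ^ 2) / (4 * 2)) * S.g u :=
    integral_nonneg fun u => mul_nonneg (Real.exp_pos _).le (S.gpos u).le
  have : 4 * π * 2 = 8 * π := by ring
  rw [this] at h
  unfold K; linarith

lemma int_K {c d : ℝ} (h : c ≤ d) : ∫ u in c..d, (1 + S.r u) * S.e u * S.g u ≤ S.K := by
  have hi := S.ent_int 2 two_pos
  have h2 := S.ent 2 two_pos
  have : 4 * π * 2 = 8 * π := by ring
  rw [this] at h2
  have cr := S.cr; have ce := S.ce; have cg := S.cg; have cx := S.cx; have cy := S.cy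
  calc ∫ u in c..d, (1 + S.r u) * S.e u * S.g u
      ≤ ∫ u in c..d, 9 * (Real.exp (-(S.x u ^ 2 + S.y u ^ 2) / (4 * 2)) * S.g u) := by
        refine intervalIntegral.integral_mono h (Continuous.intervalIntegrable (by fun_prop) _ _)
          (Continuous.intervalIntegrable (by fun_prop) _ _) fun u => ?_
        have h3 := poly_gauss 1 (by norm_num) one_pos (S.r_nonneg u)
        norm_num at h3
        have h4 := mul_le_mul_of_nonneg_right h3 (S.gpos u).le
        norm_num
        unfold e
        calc _ ≤ _ := h4
          _ = _ := by unfold r; rw [mul_assoc]; congr 3; ring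
    _ = 9 * ∫ u in c..d, (Real.exp (-(S.x u ^ 2 + S.y u ^ 2) / (4 * 2)) * S.g u) :=
        intervalIntegral.integral_const_mul _ _
    _ ≤ 9 * ∫ u, (Real.exp (-(S.x u ^ 2 + S.y u ^ 2) / (4 * 2)) * S.g u) := by
        rw [intervalIntegral.integral_of_le h]
        refine mul_le_mul_of_nonneg_left ?_ (by norm_num)
        refine setIntegral_le_integral hi (Eventually.of_forall fun u => ?_)
        exact mul_nonneg (Real.exp_pos _).le (S.gpos u).le
    _ ≤ S.K := by unfold K; linarith


lemma int_E {s : ℝ} (hs : 0 < s)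
    (hE : ∀ N : ℕ, ∫ u in (-(N:ℝ))..N, S.E u ^ 2 * S.e u * S.g u ≤ s ^ 2)
    {c d : ℝ} (h : c ≤ d) : ∫ u in c..d, S.E u ^ 2 * S.e u * S.g u ≤ s ^ 2 := by
  obtain ⟨N, hN⟩ := exists_nat_ge (max |c| |d|)
  have h1 := (le_max_left _ _).trans hN
  have h2 := (le_max_right _ _).trans hN
  have cE := S.cE; have ce := S.ce; have cg := S.cg
  refine le_trans (intervalIntegral.integral_mono_interval (neg_le_of_abs_le h1) h
    (le_of_abs_le h2) (Eventually.of_forall fun u => ?_)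
    (Continuous.intervalIntegrable (by fun_prop) _ _)) (hE N)
  have := S.e_pos u; have := S.gpos u
  simp only [Pi.zero_apply]
  positivity

lemma int_CS {s : ℝ} (hs : 0 < s)
    (hE : ∀ N : ℕ, ∫ u in (-(N:ℝ))..N, S.E u ^ 2 * S.e u * S.g u ≤ s ^ 2)
    (w : ℝ → ℝ) (cw : Continuous w) (hw : ∀ u, w u ^ 2 ≤ 1 + S.r u) {c d : ℝ}
    (h : c ≤ d) : ∫ u in c..d, |w u * S.E u| * S.e u * S.g u ≤ s * (S.K + 1) := by
  have cE := S.cE; have ce := S.ce; have cg := S.cg; have cr := S.cr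
  have h1 := S.int_K h
  have h2 := S.int_E hs hE h
  have hK := S.K_nonneg
  have i1 : IntervalIntegrable (fun u => (1 + S.r u) * S.e u * S.g u) volume c d :=
    Continuous.intervalIntegrable (by fun_prop) _ _
  have i2 : IntervalIntegrable (fun u => S.E u ^ 2 * S.e u * S.g u) volume c d :=
    Continuous.intervalIntegrable (by fun_prop) _ _
  calc _ ≤ ∫ u in c..d, (s / 2 * ((1 + S.r u) * S.e u * S.g u)
        + 1 / (2 * s) * (S.E u ^ 2 * S.e u * S.g u)) := by
        refine intervalIntegral.integral_mono h (Continuous.intervalIntegrable (by fun_prop) _ _)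
          (Continuous.intervalIntegrable (by fun_prop) _ _) fun u => ?_
        have h3 : |w u * S.E u| ≤ s / 2 * (1 + S.r u) + 1 / (2 * s) * S.E u ^ 2 := by
          have h4 := hw u
          have h5 : s / 2 * w u ^ 2 ≤ s / 2 * (1 + S.r u) :=
            mul_le_mul_of_nonneg_left h4 (by positivity)
          have e1 : s / 2 * w u ^ 2 + 1 / (2 * s) * S.E u ^ 2 - w u * S.E u
            = 1 / (2 * s) * (s * w u - S.E u) ^ 2 := by field_simp; ring
          have e2 : s / 2 * w u ^ 2 + 1 / (2 * s) * S.E u ^ 2 + w u * S.E u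
            = 1 / (2 * s) * (s * w u + S.E u) ^ 2 := by field_simp; ring
          have p1 : 0 ≤ 1 / (2 * s) * (s * w u - S.E u) ^ 2 := by positivity
          have p2 : 0 ≤ 1 / (2 * s) * (s * w u + S.E u) ^ 2 := by positivity
          rw [abs_le]; constructor <;> linarith
        have := S.e_pos u; have := S.gpos u
        calc _ ≤ (s / 2 * (1 + S.r u) + 1 / (2 * s) * S.E u ^ 2) * S.e u * S.g u := by gcongr
          _ = _ := by ring
    _ = s / 2 * (∫ u in c..d, (1 + S.r u) * S.e u * S.g u)
        + 1 / (2 * s) * ∫ u in c..d, S.E u ^ 2 * S.e u * S.g u := by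
        rw [intervalIntegral.integral_add (i1.const_mul _) (i2.const_mul _),
          intervalIntegral.integral_const_mul, intervalIntegral.integral_const_mul]
    _ ≤ s / 2 * S.K + 1 / (2 * s) * s ^ 2 := by gcongr
    _ = s * (S.K + 1) / 2 := by field_simp
    _ ≤ s * (S.K + 1) := by
        have : 0 ≤ s * (S.K + 1) := by positivity
        linarith

lemma P_le {s : ℝ} (hs : 0 < s)
    (hE : ∀ N : ℕ, ∫ u in (-(N:ℝ))..N, S.E u ^ 2 * S.e u * S.g u ≤ s ^ 2)
    (u : ℝ) : |S.nu u * S.e u| ≤ s * (S.K + 1) := by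
  have cE := S.cE; have ce := S.ce; have cg := S.cg; have cr := S.cr; have cmu := S.cmu
  have h1 : ∀ v, u ≤ v → |S.nu u * S.e u| ≤ s * (S.K + 1) + |S.nu v * S.e v| := by
    intro v huv
    have h2 := intervalIntegral.integral_eq_sub_of_hasDerivAt (a := u) (b := v)
      (fun u _ => S.hP u) (Continuous.intervalIntegrable (by fun_prop) _ _)
    have h3 := intervalIntegral.abs_integral_le_integral_abs (μ := volume)
      (f := fun u => -(S.mu u * S.E u * S.e u * S.g u)) huv
    have h4 : (∫ u in u..v, |(-(S.mu u * S.E u * S.e u * S.g u))|) ≤ s * (S.K + 1) := by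
      refine le_trans (le_of_eq ?_) (S.int_CS hs hE S.mu cmu (fun u => ?_) huv)
      · refine intervalIntegral.integral_congr fun w _ => ?_
        rw [abs_neg, abs_mul, abs_mul, abs_of_pos (S.e_pos w), abs_of_pos (S.gpos w)]
      · have := S.r_eq u; nlinarith [sq_nonneg (S.nu u)]
    rw [h2] at h3
    have h5 := abs_sub_abs_le_abs_sub (S.nu u * S.e u) (S.nu v * S.e v)
    rw [abs_sub_comm] at h5
    linarith
  have hlim : Tendsto (fun v => s * (S.K + 1) + |S.nu v * S.e v|) atTop
      (nhds (s * (S.K + 1) + 0)) := by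
    refine tendsto_const_nhds.add ?_
    have key := (TestFn.exp_tendsto S.prop_top (c := 8) (by norm_num)).const_mul 9
    rw [mul_zero] at key
    refine squeeze_zero (fun v => abs_nonneg _) (fun v => ?_) key
    have h3 := poly_gauss 1 (by norm_num) one_pos (S.r_nonneg v)
    norm_num at h3
    rw [abs_mul, abs_of_pos (S.e_pos v)]
    have h4 : |S.nu v| ≤ 1 + S.r v := by
      have := S.r_eq v
      rw [abs_le]; constructor <;>
        nlinarith [sq_nonneg (S.mu v), sq_nonneg (S.nu v - 1), sq_nonneg (S.nu v + 1)]
    exact (mul_le_mul_of_nonneg_right h4 (S.e_pos v).le).trans h3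
  rw [add_zero] at hlim
  refine ge_of_tendsto hlim ?_
  filter_upwards [eventually_ge_atTop u] with v hv using h1 v hv

lemma nu_le {s : ℝ} (hs : 0 < s)
    (hE : ∀ N : ℕ, ∫ u in (-(N:ℝ))..N, S.E u ^ 2 * S.e u * S.g u ≤ s ^ 2)
    {L : ℝ} {u : ℝ} (hL : 1 ≤ L * S.e u) : |S.nu u| ≤ s * (S.K + 1) * L := by
  have h1 := S.P_le hs hE u
  rw [abs_mul, abs_of_pos (S.e_pos u)] at h1
  have hK := S.K_nonneg
  have hL0 : 0 < L := by
    by_contra h; push Not at h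
    have := S.e_pos u
    nlinarith
  have h2 : |S.nu u| * 1 ≤ |S.nu u| * (L * S.e u) := mul_le_mul_of_nonneg_left hL (abs_nonneg _)
  nlinarith

/-- smallness of the total curvature inside a ball -/
lemma curv_le {s : ℝ} (hs : 0 < s)
    (hE : ∀ N : ℕ, ∫ u in (-(N:ℝ))..N, S.E u ^ 2 * S.e u * S.g u ≤ s ^ 2)
    {L : ℝ} {c d : ℝ} (h : c ≤ d) (hL : ∀ u ∈ Icc c d, 1 ≤ L * S.e u) :
    ∫ u in c..d, |S.k u| * S.g u ≤ s * ((S.K + 1) * (L + L ^ 2 * S.K)) := by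
  have cE := S.cE; have ce := S.ce; have cg := S.cg; have cr := S.cr; have ck := S.ck
  have hK := S.K_nonneg
  have hL0 : 0 < L := by
    by_contra h'; push Not at h'
    have := S.e_pos c
    have := hL c ⟨le_rfl, h⟩
    nlinarith
  have h1 := S.int_K h
  have h2 := S.int_CS hs hE (fun _ => 1) continuous_const
    (fun u => by have := S.r_nonneg u; nlinarith) h
  have i1 : IntervalIntegrable (fun u => (1 + S.r u) * S.e u * S.g u) volume c d :=
    Continuous.intervalIntegrable (by fun_prop) _ _
  have i2 : IntervalIntegrable (fun u => |1 * S.E u| * S.e u * S.g u) volume c d :=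
    Continuous.intervalIntegrable (by fun_prop) _ _
  calc _ ≤ ∫ u in c..d, (L * (|1 * S.E u| * S.e u * S.g u)
        + s * (S.K + 1) * L ^ 2 * ((1 + S.r u) * S.e u * S.g u)) := by
        refine intervalIntegral.integral_mono_on h (Continuous.intervalIntegrable (by fun_prop) _ _)
          (Continuous.intervalIntegrable (by fun_prop) _ _) fun u hu => ?_
        have hn := S.nu_le hs hE (hL u hu)
        have hl := hL u hu
        have hg := S.gpos u
        have he := S.e_pos u
        have hr := S.r_nonneg u
        have hk : |S.k u| ≤ |S.E u| + s * (S.K + 1) * L := by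
          have e1 : S.k u = S.E u - S.nu u / 2 := by unfold E; ring
          rw [e1]
          refine (abs_sub _ _).trans ?_
          have : |S.nu u / 2| = |S.nu u| / 2 := by rw [abs_div]; norm_num
          have := abs_nonneg (S.nu u)
          linarith
        rw [one_mul]
        have q1 : |S.E u| ≤ L * (|S.E u| * S.e u) := by
          have := mul_le_mul_of_nonneg_left hl (abs_nonneg (S.E u))
          nlinarith
        have q2 : s * (S.K + 1) * L ≤ s * (S.K + 1) * L ^ 2 * ((1 + S.r u) * S.e u) := by
          have q3 : 1 ≤ L * ((1 + S.r u) * S.e u) := by nlinarith [mul_nonneg hr (mul_pos hL0 he).le]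
          have q4 : 0 ≤ s * (S.K + 1) * L := by positivity
          nlinarith [mul_le_mul_of_nonneg_left q3 q4]
        calc |S.k u| * S.g u ≤ (L * (|S.E u| * S.e u)
              + s * (S.K + 1) * L ^ 2 * ((1 + S.r u) * S.e u)) * S.g u := by
              gcongr; linarith
          _ = _ := by ring
    _ = L * (∫ u in c..d, |1 * S.E u| * S.e u * S.g u)
        + s * (S.K + 1) * L ^ 2 * ∫ u in c..d, (1 + S.r u) * S.e u * S.g u := by
        rw [intervalIntegral.integral_add (i2.const_mul _) (i1.const_mul _),
          intervalIntegral.integral_const_mul, intervalIntegral.integral_const_mul]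
    _ ≤ L * (s * (S.K + 1)) + s * (S.K + 1) * L ^ 2 * S.K := by gcongr
    _ = _ := by ring

lemma osc {s : ℝ} (hs : 0 < s)
    (hE : ∀ N : ℕ, ∫ u in (-(N:ℝ))..N, S.E u ^ 2 * S.e u * S.g u ≤ s ^ 2)
    {L : ℝ} {c d : ℝ} (h : c ≤ d) (hL : ∀ u ∈ Icc c d, 1 ≤ L * S.e u) :
    |S.a d - S.a c| ≤ s * ((S.K + 1) * (L + L ^ 2 * S.K)) ∧
    |S.b d - S.b c| ≤ s * ((S.K + 1) * (L + L ^ 2 * S.K)) := by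
  have cg := S.cg; have ck := S.ck; have ca := S.ca; have cb := S.cb
  have h0 := S.curv_le hs hE h hL
  have hab : ∀ u, |S.a u| ≤ 1 ∧ |S.b u| ≤ 1 := by
    intro u
    have := S.unit u
    constructor <;> rw [abs_le] <;> constructor <;> nlinarith [sq_nonneg (S.a u), sq_nonneg (S.b u)]
  constructor
  · rw [← intervalIntegral.integral_eq_sub_of_hasDerivAt (fun u _ => S.ha u)
      (Continuous.intervalIntegrable (by fun_prop) _ _)]
    refine (intervalIntegral.abs_integral_le_integral_abs h).trans (le_trans ?_ h0)
    refine intervalIntegral.integral_mono h (Continuous.intervalIntegrable (by fun_prop) _ _)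
          (Continuous.intervalIntegrable (by fun_prop) _ _) fun u => ?_
    simp only
    rw [abs_mul, abs_mul, abs_neg, abs_of_pos (S.gpos u)]
    have := (hab u).2; have := S.gpos u; have := abs_nonneg (S.k u)
    gcongr
    nlinarith
  · rw [← intervalIntegral.integral_eq_sub_of_hasDerivAt (fun u _ => S.hb u)
      (Continuous.intervalIntegrable (by fun_prop) _ _)]
    refine (intervalIntegral.abs_integral_le_integral_abs h).trans (le_trans ?_ h0)
    refine intervalIntegral.integral_mono h (Continuous.intervalIntegrable (by fun_prop) _ _)
          (Continuous.intervalIntegrable (by fun_prop) _ _) fun u => ?_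
    simp only
    rw [abs_mul, abs_mul, abs_of_pos (S.gpos u)]
    have := (hab u).1; have := S.gpos u; have := abs_nonneg (S.k u)
    gcongr
    nlinarith
end SCurve

namespace SCurve
variable {m : ℝ} (S : SCurve m)

/-- an arc of the curve in the ball of radius `ρ` -/
def IsArc (ρ c d : ℝ) : Prop :=
  S.r c = ρ ^ 2 ∧ S.r d = ρ ^ 2 ∧ ∀ u ∈ Ioo c d, S.r u < ρ ^ 2

lemma exists_arc {ρ p : ℝ} (hp : S.r p < ρ ^ 2) : ∃ c d, S.IsArc ρ c d ∧ p ∈ Ioo c d := by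
  have cr := S.cr
  -- right end
  have right : ∃ d, p < d ∧ S.r d = ρ ^ 2 ∧ ∀ u ∈ Ico p d, S.r u < ρ ^ 2 := by
    set A := {u | p ≤ u ∧ ρ ^ 2 ≤ S.r u} with hA
    have hclosed : IsClosed A :=
      (isClosed_le continuous_const continuous_id).inter (isClosed_le continuous_const cr)
    have hne : A.Nonempty := by
      obtain ⟨u, h1, h2⟩ := ((S.prop_top.eventually_ge_atTop (ρ ^ 2)).and
        (eventually_ge_atTop p)).exists
      exact ⟨u, h2, h1⟩
    have hbdd : BddBelow A := ⟨p, fun u hu => hu.1⟩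
    have hmem := hclosed.csInf_mem hne hbdd
    set d := sInf A
    have hlt : ∀ u ∈ Ico p d, S.r u < ρ ^ 2 := by
      intro u hu
      by_contra h
      push Not at h
      exact absurd (csInf_le hbdd ⟨hu.1, h⟩) (not_le.2 hu.2)
    have hpd : p < d := by
      rcases hmem.1.eq_or_lt with h | h
      · exfalso; have := hmem.2; rw [← h] at this; linarith
      · exact h
    refine ⟨d, hpd, le_antisymm ?_ hmem.2, hlt⟩
    have : d ∈ closure (Ico p d) := by rw [closure_Ico hpd.ne]; exact ⟨hpd.le, le_rfl⟩
    exact closure_minimal (fun u hu => (hlt u hu).le) (isClosed_le cr continuous_const) this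
  have left : ∃ d, d < p ∧ S.r d = ρ ^ 2 ∧ ∀ u ∈ Ioc d p, S.r u < ρ ^ 2 := by
    set A := {u | u ≤ p ∧ ρ ^ 2 ≤ S.r u} with hA
    have hclosed : IsClosed A :=
      (isClosed_le continuous_id continuous_const).inter (isClosed_le continuous_const cr)
    have hne : A.Nonempty := by
      obtain ⟨u, h1, h2⟩ := ((S.prop_bot.eventually_ge_atTop (ρ ^ 2)).and
        (eventually_le_atBot p)).exists
      exact ⟨u, h2, h1⟩
    have hbdd : BddAbove A := ⟨p, fun u hu => hu.1⟩
    have hmem := hclosed.csSup_mem hne hbdd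
    set d := sSup A
    have hlt : ∀ u ∈ Ioc d p, S.r u < ρ ^ 2 := by
      intro u hu
      by_contra h
      push Not at h
      exact absurd (le_csSup hbdd ⟨hu.2, h⟩) (not_le.2 hu.1)
    have hpd : d < p := by
      rcases hmem.1.eq_or_lt with h | h
      · exfalso; have := hmem.2; rw [h] at this; linarith
      · exact h
    refine ⟨d, hpd, le_antisymm ?_ hmem.2, hlt⟩
    have : d ∈ closure (Ioc d p) := by rw [closure_Ioc hpd.ne]; exact ⟨le_rfl, hpd.le⟩
    exact closure_minimal (fun u hu => (hlt u hu).le) (isClosed_le cr continuous_const) this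
  obtain ⟨d, hd1, hd2, hd3⟩ := right
  obtain ⟨c, hc1, hc2, hc3⟩ := left
  refine ⟨c, d, ⟨hc2, hd2, fun u hu => ?_⟩, hc1, hd1⟩
  rcases le_total u p with h | h
  · exact hc3 u ⟨hu.1, h⟩
  · exact hd3 u ⟨h, hu.2⟩

lemma arc_eq {ρ c d c' d' z : ℝ} (h : S.IsArc ρ c d) (h' : S.IsArc ρ c' d')
    (hz : z ∈ Ioo c d) (hz' : z ∈ Ioo c' d') : c = c' ∧ d = d' := by
  obtain ⟨h1, h2, h3⟩ := h
  obtain ⟨h1', h2', h3'⟩ := h'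
  obtain ⟨z1, z2⟩ := hz
  obtain ⟨z1', z2'⟩ := hz'
  constructor
  · rcases lt_trichotomy c c' with q | q | q
    · have := h3 c' ⟨q, by linarith⟩; linarith
    · exact q
    · have := h3' c ⟨q, by linarith⟩; linarith
  · rcases lt_trichotomy d d' with q | q | q
    · have := h3' d ⟨by linarith, q⟩; linarith
    · exact q
    · have := h3 d' ⟨by linarith, q⟩; linarith

lemma arc_closed {ρ c d : ℝ} (h : S.IsArc ρ c d) : ∀ u ∈ Icc c d, S.r u ≤ ρ ^ 2 := by
  intro u hu
  rcases hu.1.eq_or_lt with q | q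
  · rw [← q]; exact h.1.le
  rcases hu.2.eq_or_lt with q' | q'
  · rw [q']; exact h.2.1.le
  exact (h.2.2 u ⟨q, q'⟩).le

/-- mass of an arc -/
lemma arc_mass {ρ R η c d p : ℝ} (hR : 0 ≤ R) (hρ : R + 2 ≤ ρ) (hη0 : 0 < η)
    (hη : η * (1 + 2 * ρ) ≤ 1)
    (harc : S.IsArc ρ c d) (hp : p ∈ Ioo c d) (hpR : S.r p ≤ R ^ 2)
    (hT : ∀ u ∈ Icc c d, |S.a u - S.a p| ≤ η ∧ |S.b u - S.b p| ≤ η ∧ |S.nu u| ≤ η) :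
    Real.exp (-(η * (1 + 2 * ρ)) ^ 2 / 4) * ∫ q in (-(ρ - 1))..(ρ - 1), Real.exp (-q ^ 2 / 4)
      ≤ ∫ u in c..d, S.e u * S.g u := by
  have cx := S.cx; have cy := S.cy; have ca := S.ca; have cb := S.cb
  have cg := S.cg; have ce := S.ce
  have hcl := S.arc_closed harc
  have hcd : c ≤ d := (hp.1.trans hp.2).le
  have hρ0 : 0 < ρ := by linarith
  set A := S.a p with hA
  set B := S.b p with hB
  have hAB : A ^ 2 + B ^ 2 = 1 := S.unit p
  set X : ℝ → ℝ := fun u => S.x u * A + S.y u * B with hX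
  set Y : ℝ → ℝ := fun u => -(S.x u) * B + S.y u * A with hY
  set X' : ℝ → ℝ := fun u => (S.a u * A + S.b u * B) * S.g u with hX'
  have hXY : ∀ u, X u ^ 2 + Y u ^ 2 = S.r u := by
    intro u; simp only [hX, hY]; unfold r
    linear_combination (S.x u ^ 2 + S.y u ^ 2) * hAB
  have hdX : ∀ u, HasDerivAt X (X' u) u := by
    intro u
    refine (((S.hx u).mul_const A).add ((S.hy u).mul_const B)).congr_deriv ?_
    simp only [hX']; ring
  have cX' : Continuous X' := by fun_prop
  have cX : Continuous X := by fun_prop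
  set η2 := η * (1 + 2 * ρ) with hη2
  have hη1 : η ≤ 1 := by nlinarith
  have hcos : ∀ u ∈ Icc c d, 0 ≤ S.a u * A + S.b u * B := by
    intro u hu
    obtain ⟨h1, h2, -⟩ := hT u hu
    have hη3 : η ≤ 1 / 2 := by nlinarith
    have u1 := S.unit u
    rw [abs_le] at h1 h2
    nlinarith [mul_nonneg (sub_nonneg.2 h1.2) (by linarith [h1.1] : 0 ≤ (S.a u - A) + η),
      mul_nonneg (sub_nonneg.2 h2.2) (by linarith [h2.1] : 0 ≤ (S.b u - B) + η)]
  have hcos1 : ∀ u, S.a u * A + S.b u * B ≤ 1 := by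
    intro u
    nlinarith [S.unit u, sq_nonneg (S.a u - A), sq_nonneg (S.b u - B)]
  have hYle : ∀ u ∈ Icc c d, Y u ^ 2 ≤ η2 ^ 2 := by
    intro u hu
    obtain ⟨h1, h2, h3⟩ := hT u hu
    have hr := hcl u hu
    unfold r at hr
    have hxr : |S.x u| ≤ ρ := abs_le_of_sq_le_sq (by nlinarith [sq_nonneg (S.y u)]) hρ0.le
    have hyr : |S.y u| ≤ ρ := abs_le_of_sq_le_sq (by nlinarith [sq_nonneg (S.x u)]) hρ0.le
    have e1 : Y u = S.nu u + (S.x u * (S.b u - B) - S.y u * (S.a u - A)) := by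
      simp only [hY]; unfold nu; ring
    have e2 : |Y u| ≤ η2 := by
      rw [e1]
      refine (abs_add_le _ _).trans ?_
      have e3 := abs_sub (S.x u * (S.b u - B)) (S.y u * (S.a u - A))
      rw [abs_mul, abs_mul] at e3
      have e4 : |S.x u| * |S.b u - B| ≤ ρ * η := by gcongr
      have e5 : |S.y u| * |S.a u - A| ≤ ρ * η := by gcongr
      rw [hη2]; linarith
    have := abs_nonneg (Y u)
    rw [← sq_abs]; gcongr
  have hmono : MonotoneOn X (Icc c d) := by
    refine monotoneOn_of_deriv_nonneg (convex_Icc _ _) cX.continuousOn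
      (fun u _ => (hdX u).differentiableAt.differentiableWithinAt) fun u hu => ?_
    rw [(hdX u).deriv]
    rw [interior_Icc] at hu
    exact mul_nonneg (hcos u (Ioo_subset_Icc_self hu)) (S.gpos u).le
  have hη20 : 0 ≤ η2 := by positivity
  have hend : ∀ u ∈ Icc c d, S.r u = ρ ^ 2 → (ρ - 1) ^ 2 ≤ X u ^ 2 := by
    intro u hu hur
    have := hYle u hu
    have := hXY u
    nlinarith
  have hXp : X p ^ 2 ≤ R ^ 2 := by have := hXY p; nlinarith [sq_nonneg (Y p)]
  have hXp1 := abs_le_of_sq_le_sq' hXp hR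
  have hpm : p ∈ Icc c d := ⟨hp.1.le, hp.2.le⟩
  have hXd : ρ - 1 ≤ X d := by
    have h1 := hend d ⟨hcd, le_rfl⟩ harc.2.1
    have h2 := hmono hpm ⟨hcd, le_rfl⟩ hp.2.le
    by_contra h
    push Not at h
    nlinarith
  have hXc : X c ≤ -(ρ - 1) := by
    have h1 := hend c ⟨le_rfl, hcd⟩ harc.1
    have h2 := hmono ⟨le_rfl, hcd⟩ hpm hp.1.le
    by_contra h
    push Not at h
    nlinarith
  have hcv : ∫ u in c..d, Real.exp (-(X u) ^ 2 / 4) * X' u =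
      ∫ q in (X c)..(X d), Real.exp (-q ^ 2 / 4) :=
    intervalIntegral.integral_comp_mul_deriv (f := X) (f' := X')
      (g := fun q => Real.exp (-q ^ 2 / 4)) (fun u _ => hdX u) cX'.continuousOn
      (by fun_prop)
  have h5 : ∫ q in (-(ρ - 1))..(ρ - 1), Real.exp (-q ^ 2 / 4) ≤
      ∫ q in (X c)..(X d), Real.exp (-q ^ 2 / 4) := by
    refine intervalIntegral.integral_mono_interval hXc (by linarith) hXd
      (Eventually.of_forall fun q => (Real.exp_pos _).le)
      (Continuous.intervalIntegrable (by fun_prop) _ _)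
  calc _ ≤ Real.exp (-η2 ^ 2 / 4) * ∫ q in (X c)..(X d), Real.exp (-q ^ 2 / 4) :=
        mul_le_mul_of_nonneg_left h5 (Real.exp_pos _).le
    _ = ∫ u in c..d, Real.exp (-η2 ^ 2 / 4) * (Real.exp (-(X u) ^ 2 / 4) * X' u) := by
        rw [← hcv, intervalIntegral.integral_const_mul]
    _ ≤ _ := by
        refine intervalIntegral.integral_mono_on hcd (Continuous.intervalIntegrable (by fun_prop) _ _)
          (Continuous.intervalIntegrable (by fun_prop) _ _) fun u hu => ?_
        rw [← mul_assoc, ← Real.exp_add]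
        have hg := S.gpos u
        have h6 : Real.exp (-η2 ^ 2 / 4 + -(X u) ^ 2 / 4) ≤ S.e u := by
          unfold e
          rw [Real.exp_le_exp, ← hXY]
          have := hYle u hu
          linarith
        have h7 : X' u ≤ S.g u := by
          simp only [hX']; have := hcos1 u; nlinarith
        have h8 : 0 ≤ X' u := mul_nonneg (hcos u hu) hg.le
        gcongr
        exact (S.e_pos u).le

/-- disjoint arcs -/
lemma arcs_sum {n : ℕ} {c d : Fin n → ℝ} (hcd : ∀ i, c i ≤ d i)
    (hdis : ∀ i j, i ≠ j → Disjoint (Ioo (c i) (d i)) (Ioo (c j) (d j))) :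
    ∑ i, ∫ u in (c i)..(d i), S.e u * S.g u ≤ m * √(4 * π) := by
  have hi := S.ent_int 1 one_pos
  have h1 := S.ent 1 one_pos
  have heq : ∀ u, Real.exp (-(S.x u ^ 2 + S.y u ^ 2) / (4 * 1)) * S.g u = S.e u * S.g u := by
    intro u; unfold e r; rw [mul_one]
  simp only [heq] at hi h1
  rw [mul_one] at h1
  refine le_trans ?_ h1
  calc ∑ i, ∫ u in (c i)..(d i), S.e u * S.g u = ∑ i, ∫ u in Ioo (c i) (d i), S.e u * S.g u := by
        refine Finset.sum_congr rfl fun i _ => ?_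
        rw [intervalIntegral.integral_of_le (hcd i), integral_Ioc_eq_integral_Ioo]
    _ = ∫ u in ⋃ i, Ioo (c i) (d i), S.e u * S.g u := by
        rw [integral_iUnion_fintype (fun i => measurableSet_Ioo) (fun i j hij => hdis i j hij)
          (fun i => hi.integrableOn)]
    _ ≤ _ := setIntegral_le_integral hi (Eventually.of_forall fun u =>
        mul_nonneg (S.e_pos u).le (S.gpos u).le)

end SCurve

lemma gauss_total : ∫ q : ℝ, Real.exp (-q ^ 2 / 4) = √(4 * π) := by
  have := integral_gaussian (1 / 4)
  rw [show π / (1 / 4) = 4 * π by ring] at this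
  rw [← this]
  congr 1; ext q; congr 1; ring

lemma gauss_int : Integrable fun q : ℝ => Real.exp (-q ^ 2 / 4) := by
  have := integrable_exp_neg_mul_sq (b := 1 / 4) (by norm_num)
  refine this.congr (Eventually.of_forall fun q => ?_)
  simp only; congr 1; ring

lemma static_main (m : ℕ) {R η : ℝ} (hR : 0 ≤ R) (hη : 0 < η) :
    ∃ ε > 0, ∀ S : SCurve (m : ℝ),
      (∀ N : ℕ, ∫ u in (-(N:ℝ))..N, S.E u ^ 2 * S.e u * S.g u ≤ ε) →
      ∃ c d : ℝ → ℝ, (∀ p, S.r p ≤ R ^ 2 → p ∈ Ioo (c p) (d p) ∧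
          ∀ z ∈ Ioo (c p) (d p), |S.a z - S.a p| ≤ η ∧ |S.b z - S.b p| ≤ η) ∧
        ∀ f : Fin (m + 1) → ℝ, (∀ i, S.r (f i) ≤ R ^ 2) →
          ∃ i j, i ≠ j ∧ c (f i) = c (f j) ∧ d (f i) = d (f j) := by
  have hπ : 0 < √(4 * π) := by positivity
  set I : ℝ → ℝ := fun ρ => ∫ q in (-(ρ - 1))..(ρ - 1), Real.exp (-q ^ 2 / 4) with hI
  have hlt : (m : ℝ) * √(4 * π) < (m + 1) * √(4 * π) := by nlinarith
  -- choice of ρ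
  obtain ⟨ρ, hρ1, hρ2⟩ : ∃ ρ, R + 2 ≤ ρ ∧ (m : ℝ) * √(4 * π) < (m + 1) * I ρ := by
    have t1 : Tendsto (fun ρ : ℝ => ρ - 1) atTop atTop := tendsto_atTop_add_const_right _ _ tendsto_id
    have h1 := (intervalIntegral_tendsto_integral gauss_int (tendsto_neg_atTop_atBot.comp t1)
      t1).const_mul ((m : ℝ) + 1)
    rw [gauss_total] at h1
    obtain ⟨ρ, h2, h3⟩ := ((h1.eventually_const_lt hlt).and (eventually_ge_atTop (R + 2))).exists
    exact ⟨ρ, h3, h2⟩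
  -- choice of η'
  obtain ⟨η', hη'0, hη'1, hη'2, hη'3⟩ : ∃ η' > 0, η' ≤ η ∧ η' * (1 + 2 * ρ) ≤ 1 ∧
      (m : ℝ) * √(4 * π) < (m + 1) * (Real.exp (-(η' * (1 + 2 * ρ)) ^ 2 / 4) * I ρ) := by
    have c1 : Continuous fun z : ℝ => ((m : ℝ) + 1) * (Real.exp (-(z * (1 + 2 * ρ)) ^ 2 / 4) * I ρ) := by
      fun_prop
    have c2 : Continuous fun z : ℝ => z * (1 + 2 * ρ) := by fun_prop
    have e1 : ∀ᶠ z in nhds (0:ℝ), (m : ℝ) * √(4 * π) <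
        (m + 1) * (Real.exp (-(z * (1 + 2 * ρ)) ^ 2 / 4) * I ρ) := by
      refine c1.continuousAt.eventually_const_lt ?_
      simpa using hρ2
    have e2 : ∀ᶠ z in nhds (0:ℝ), z * (1 + 2 * ρ) < 1 :=
      c2.continuousAt.eventually_lt_const (by simp)
    have e3 : ∀ᶠ z in nhdsWithin (0:ℝ) (Ioi 0), (m : ℝ) * √(4 * π) <
        (m + 1) * (Real.exp (-(z * (1 + 2 * ρ)) ^ 2 / 4) * I ρ) ∧ z * (1 + 2 * ρ) < 1 ∧
        0 < z ∧ z < η := by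
      filter_upwards [e1.filter_mono nhdsWithin_le_nhds, e2.filter_mono nhdsWithin_le_nhds,
        self_mem_nhdsWithin, nhdsWithin_le_nhds (Iio_mem_nhds hη)] with z a b c d
      exact ⟨a, b, c, d⟩
    obtain ⟨z, h1, h2, h3, h4⟩ := e3.exists
    exact ⟨z, h3, h4.le, h2.le, h1⟩
  set L := Real.exp (ρ ^ 2 / 4) with hL
  set K : ℝ := 9 * (m * √(8 * π)) with hK
  have hK0 : 0 ≤ K := by positivity
  have hL1 : 0 < L := Real.exp_pos _
  set C3 := (K + 1) * (L + L ^ 2 * K) with hC3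
  have hC30 : 0 < C3 := by positivity
  set s := η' / C3 with hs
  have hs0 : 0 < s := by positivity
  have hsC : s * C3 = η' := by rw [hs]; field_simp
  refine ⟨s ^ 2, by positivity, fun S hE => ?_⟩
  have hSK : S.K = K := rfl
  have hLe : ∀ u, S.r u ≤ ρ ^ 2 → 1 ≤ L * S.e u := by
    intro u hu
    rw [hL]; unfold SCurve.e
    rw [← Real.exp_add, Real.one_le_exp_iff]
    linarith
  have hex : ∀ p, ∃ c d, S.r p ≤ R ^ 2 → S.IsArc ρ c d ∧ p ∈ Ioo c d := by
    intro p
    by_cases h : S.r p ≤ R ^ 2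
    · obtain ⟨c, d, h1, h2⟩ := S.exists_arc (ρ := ρ) (p := p) (by nlinarith)
      exact ⟨c, d, fun _ => ⟨h1, h2⟩⟩
    · exact ⟨0, 0, fun h' => absurd h' h⟩
  choose c d hcd using hex
  have hT : ∀ p, S.r p ≤ R ^ 2 → ∀ u ∈ Icc (c p) (d p),
      |S.a u - S.a p| ≤ η' ∧ |S.b u - S.b p| ≤ η' ∧ |S.nu u| ≤ η' := by
    intro p hp u hu
    obtain ⟨h1, h2⟩ := hcd p hp
    have h3 := S.arc_closed h1
    have hn : |S.nu u| ≤ η' := by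
      refine (S.nu_le hs0 hE (hLe u (h3 u hu))).trans ?_
      rw [hSK, ← hsC, hC3, mul_assoc]
      have : 0 ≤ L ^ 2 * K := by positivity
      gcongr
      linarith
    rcases le_total u p with h | h
    · have h4 := S.osc hs0 hE h (fun z hz => hLe z (h3 z ⟨hu.1.trans hz.1, hz.2.trans h2.2.le⟩))
      rw [hSK, ← hC3, hsC] at h4
      rw [abs_sub_comm, abs_sub_comm (S.b u)]
      exact ⟨h4.1, h4.2, hn⟩
    · have h4 := S.osc hs0 hE h (fun z hz => hLe z (h3 z ⟨h2.1.le.trans hz.1, hz.2.trans hu.2⟩))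
      rw [hSK, ← hC3, hsC] at h4
      exact ⟨h4.1, h4.2, hn⟩
  refine ⟨c, d, fun p hp => ⟨(hcd p hp).2, fun z hz => ?_⟩, fun f hf => ?_⟩
  · have := hT p hp z ⟨hz.1.le, hz.2.le⟩
    exact ⟨this.1.trans hη'1, this.2.1.trans hη'1⟩
  · by_contra hcon
    push Not at hcon
    have hdis : ∀ i j, i ≠ j → Disjoint (Ioo (c (f i)) (d (f i))) (Ioo (c (f j)) (d (f j))) := by
      intro i j hij
      rw [Set.disjoint_left]
      intro z hz hz'
      have := S.arc_eq (hcd _ (hf i)).1 (hcd _ (hf j)).1 hz hz'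
      exact hcon i j hij this.1 this.2
    have h1 := S.arcs_sum (fun i => ((hcd _ (hf i)).2.1.trans (hcd _ (hf i)).2.2).le) hdis
    have h2 : ∀ i ∈ Finset.univ, Real.exp (-(η' * (1 + 2 * ρ)) ^ 2 / 4) * I ρ ≤
        ∫ u in (c (f i))..(d (f i)), S.e u * S.g u := fun i _ =>
      S.arc_mass hR hρ1 hη'0 hη'2 (hcd _ (hf i)).1 (hcd _ (hf i)).2 (hf i) (hT _ (hf i))
    have h3 := Finset.sum_le_sum h2
    simp at h3
    linarith

lemma deriv_zero_of_pow {F ψ : ℝ → ℝ} {s0 F' : ℝ} (hF : HasDerivAt F F' s0) {n : ℕ} (hn : 1 < n)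
    (h : ∀ s, |ψ s| ≤ |F s - F s0| ^ n) : HasDerivAt ψ 0 s0 := by
  have h0 : ψ s0 = 0 := by
    have := h s0
    rw [sub_self, abs_zero, zero_pow (by omega)] at this
    exact abs_eq_zero.1 (le_antisymm this (abs_nonneg _))
  rw [hasDerivAt_iff_isLittleO]
  simp only [h0, smul_zero, sub_zero]
  have h1 : ψ =O[nhds s0] fun s => |F s - F s0| ^ n :=
    Asymptotics.isBigO_of_le _ fun s => by
      rw [Real.norm_eq_abs, Real.norm_eq_abs, abs_of_nonneg (a := |F s - F s0| ^ n) (by positivity)]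
      exact h s
  have h2 : (fun s => |F s - F s0| ^ n) =O[nhds s0] fun s => ‖s - s0‖ ^ n :=
    (hF.isBigO_sub.norm_norm).pow n
  exact (h1.trans h2).trans_isLittleO (Asymptotics.isLittleO_pow_sub_sub s0 hn)

/-- component of a superlevel set -/
def comp (f : ℝ × ℝ → ℝ) (M : ℝ) (p0 : ℝ × ℝ) : Set (ℝ × ℝ) :=
  connectedComponentIn {p | M < f p} p0

open Classical in
/-- truncation -/
def trunc (f : ℝ × ℝ → ℝ) (M : ℝ) (p0 p : ℝ × ℝ) : ℝ :=
  if p ∈ comp f M p0 then f p - M else 0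

section
variable {f : ℝ × ℝ → ℝ} {M : ℝ} {p0 : ℝ × ℝ}

lemma comp_open (hf : Continuous f) : IsOpen (comp f M p0) :=
  IsOpen.connectedComponentIn (isOpen_lt continuous_const hf)

lemma comp_lt {p : ℝ × ℝ} (h : p ∈ comp f M p0) : M < f p :=
  connectedComponentIn_subset {p | M < f p} p0 h

lemma trunc_nonneg (p : ℝ × ℝ) : 0 ≤ trunc f M p0 p := by
  unfold trunc
  split_ifs with h
  · have := comp_lt h; linarith
  · exact le_rfl

lemma trunc_pos {p : ℝ × ℝ} : 0 < trunc f M p0 p ↔ p ∈ comp f M p0 := by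
  unfold trunc
  split_ifs with h
  · have := comp_lt h; simp only [h, iff_true]; linarith
  · simp [h]

lemma trunc_le (p : ℝ × ℝ) : trunc f M p0 p ≤ max (f p - M) 0 := by
  unfold trunc
  split_ifs with h
  · exact le_max_left _ _
  · exact le_max_right _ _

lemma trunc_loc_in (hf : Continuous f) {p : ℝ × ℝ} (h : p ∈ comp f M p0) :
    ∀ᶠ q in nhds p, trunc f M p0 q = f q - M := by
  filter_upwards [(comp_open hf).mem_nhds h] with q hq
  unfold trunc; rw [if_pos hq]

lemma trunc_loc_out (hf : Continuous f) {p : ℝ × ℝ} (h : p ∉ comp f M p0) (hM : M < f p) :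
    ∀ᶠ q in nhds p, trunc f M p0 q = 0 := by
  have hp : p ∈ comp f M p := mem_connectedComponentIn hM
  filter_upwards [(comp_open hf).mem_nhds hp] with q hq
  unfold trunc; rw [if_neg]
  intro hq'
  apply h
  have h1 : comp f M p = comp f M q := connectedComponentIn_eq hq
  have h2 : comp f M p0 = comp f M q := connectedComponentIn_eq hq'
  rw [h2, ← h1]; exact hp

lemma trunc_zero {p : ℝ × ℝ} (h : p ∉ comp f M p0) : trunc f M p0 p = 0 := by
  unfold trunc; rw [if_neg h]

lemma trunc_cont (hf : Continuous f) : Continuous (trunc f M p0) := by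
  rw [continuous_iff_continuousAt]
  intro p
  by_cases h : p ∈ comp f M p0
  · exact ContinuousAt.congr (f := fun q => f q - M) (by fun_prop)
      ((trunc_loc_in hf h).mono fun q hq => hq.symm)
  · by_cases hM : M < f p
    · exact ContinuousAt.congr (f := fun _ => 0) continuousAt_const
        ((trunc_loc_out hf h hM).mono fun q hq => hq.symm)
    · push Not at hM
      unfold ContinuousAt
      rw [trunc_zero h]
      have h1 : Continuous fun q => max (f q - M) 0 := by fun_prop
      have h2 := h1.tendsto p
      rw [max_eq_right (by linarith)] at h2
      exact squeeze_zero trunc_nonneg trunc_le h2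

lemma trunc_deriv (hf : Continuous f) {h : ℝ → ℝ × ℝ} {s0 f' : ℝ} (hh : ContinuousAt h s0)
    (hd : HasDerivAt (fun s => f (h s)) f' s0) {n : ℕ} (hn : 1 < n) :
    HasDerivAt (fun s => trunc f M p0 (h s) ^ n) (n * trunc f M p0 (h s0) ^ (n - 1) * f') s0 := by
  by_cases hc : h s0 ∈ comp f M p0
  · have h1 := hh.eventually (trunc_loc_in hf hc)
    have h2 := (hd.sub_const M).pow n
    rw [h1.self_of_nhds]
    exact h2.congr_of_eventuallyEq (h1.mono fun s hs => by simp only [Pi.pow_apply]; rw [hs])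
  · rw [trunc_zero hc, zero_pow (by omega), mul_zero, zero_mul]
    by_cases hM : M < f (h s0)
    · have h1 := hh.eventually (trunc_loc_out hf hc hM)
      refine (hasDerivAt_const s0 (0:ℝ)).congr_of_eventuallyEq (h1.mono fun s hs => ?_)
      simp only; rw [hs, zero_pow (by omega)]
    · push Not at hM
      refine deriv_zero_of_pow hd hn fun s => ?_
      rw [abs_pow, abs_of_nonneg (trunc_nonneg _)]
      refine pow_le_pow_left₀ (trunc_nonneg _) ((trunc_le _).trans (max_le ?_ (abs_nonneg _))) _
      exact le_trans (by linarith) (le_abs_self _)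
end

namespace SFlow
variable {m t0 : ℝ} (S : SFlow m t0)

/-- linear height function -/
def lin (α β : ℝ) (p : ℝ × ℝ) : ℝ := α * S.x p.1 p.2 + β * S.y p.1 p.2

lemma clin (α β : ℝ) : Continuous (S.lin α β) := by
  have := S.cx; have := S.cy; unfold lin; fun_prop

lemma hlin_u (α β u t : ℝ) : HasDerivAt (fun u => S.lin α β (u, t))
    ((α * S.a u t + β * S.b u t) * S.g u t) u :=
  (((S.hx u t).const_mul α).add ((S.hy u t).const_mul β)).congr_deriv (by ring)

lemma hlin_t (α β u t : ℝ) (ht : t < t0) : HasDerivAt (fun t => S.lin α β (u, t))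
    (S.k u t * (-α * S.b u t + β * S.a u t)) t :=
  (((S.hxt u t ht).const_mul α).add ((S.hyt u t ht).const_mul β)).congr_deriv (by ring)

lemma lin_bound (α β M : ℝ) (p p0 : ℝ × ℝ) :
    trunc (S.lin α β) M p0 p ^ 2 ≤ 3 * (α ^ 2 + β ^ 2 + M ^ 2) * (1 + S.r p.1 p.2) := by
  have h1 := trunc_nonneg (f := S.lin α β) (M := M) (p0 := p0) p
  have h2 := trunc_le (f := S.lin α β) (M := M) (p0 := p0) p
  have h3 : trunc (S.lin α β) M p0 p ^ 2 ≤ (S.lin α β p - M) ^ 2 := by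
    rcases le_total (S.lin α β p - M) 0 with h | h
    · rw [max_eq_right h] at h2
      have : trunc (S.lin α β) M p0 p = 0 := le_antisymm h2 h1
      rw [this]; nlinarith [sq_nonneg (S.lin α β p - M)]
    · rw [max_eq_left h] at h2
      exact pow_le_pow_left₀ h1 h2 2
  refine h3.trans ?_
  unfold lin r
  set x := S.x p.1 p.2
  set y := S.y p.1 p.2
  have e1 : (α * x + β * y - M) ^ 2 ≤ 3 * ((α * x) ^ 2 + (β * y) ^ 2 + M ^ 2) := by
    nlinarith [sq_nonneg (α * x - β * y), sq_nonneg (α * x + M), sq_nonneg (β * y + M)]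
  refine e1.trans ?_
  nlinarith [sq_nonneg (α * y), sq_nonneg (β * x), sq_nonneg (M * x), sq_nonneg (M * y),
    sq_nonneg α, sq_nonneg β]

/-- test function attached to a component of a superlevel set -/
def compFn (α β M : ℝ) (p0 : ℝ × ℝ) : TestFn S α β where
  z0 u t := trunc (S.lin α β) M p0 (u, t) ^ 4
  z1 u t := 4 * trunc (S.lin α β) M p0 (u, t) ^ 3
  z2 u t := 12 * trunc (S.lin α β) M p0 (u, t) ^ 2
  c0 := by have := trunc_cont (M := M) (p0 := p0) (S.clin α β); fun_prop
  c1 := by have := trunc_cont (M := M) (p0 := p0) (S.clin α β); fun_prop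
  c2 := by have := trunc_cont (M := M) (p0 := p0) (S.clin α β); fun_prop
  hu0 u t := by
    refine (trunc_deriv (S.clin α β) (h := fun u => (u, t)) (by fun_prop)
      (S.hlin_u α β u t) (n := 4) (by norm_num)).congr_deriv ?_
    norm_num
  hu1 u t := by
    refine ((trunc_deriv (S.clin α β) (h := fun u => (u, t)) (by fun_prop)
      (S.hlin_u α β u t) (n := 3) (by norm_num)).const_mul 4).congr_deriv ?_
    norm_num; ring
  ht0 u t ht := by
    refine (trunc_deriv (S.clin α β) (h := fun t => (u, t)) (by fun_prop)
      (S.hlin_t α β u t ht) (n := 4) (by norm_num)).congr_deriv ?_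
    norm_num
  z0n u t := by positivity
  z2n u t := by positivity
  z1b u t := by
    have : 0 ≤ trunc (S.lin α β) M p0 (u, t) ^ 6 := by positivity
    nlinarith
  C := 4 * (3 * (α ^ 2 + β ^ 2 + M ^ 2) + (3 * (α ^ 2 + β ^ 2 + M ^ 2)) ^ 2)
  Cn := by positivity
  b0 u t := by
    have h := S.lin_bound α β M (u, t) p0
    have hr := S.r_nonneg u t
    simp only at h
    set w := trunc (S.lin α β) M p0 (u, t)
    set c := 3 * (α ^ 2 + β ^ 2 + M ^ 2) with hc
    have hc0 : 0 ≤ c := by positivity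
    have h2 := pow_le_pow_left₀ (by positivity) h 2
    have h3 : w ^ 4 = (w ^ 2) ^ 2 := by ring
    rw [h3]
    refine h2.trans ?_
    rw [mul_pow]
    have : 0 ≤ (1 + S.r u t) ^ 2 := by positivity
    gcongr
    nlinarith [sq_nonneg c]
  b1 u t := by
    have h := S.lin_bound α β M (u, t) p0
    have hr := S.r_nonneg u t
    have hw := trunc_nonneg (f := S.lin α β) (M := M) (p0 := p0) (u, t)
    simp only at h
    set w := trunc (S.lin α β) M p0 (u, t)
    set c := 3 * (α ^ 2 + β ^ 2 + M ^ 2) with hc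
    have hc0 : 0 ≤ c := by positivity
    have h2 := pow_le_pow_left₀ (by positivity) h 2
    rw [abs_of_nonneg (by positivity)]
    have h3 : w ^ 3 ≤ w ^ 2 + (w ^ 2) ^ 2 := by
      nlinarith [mul_nonneg (sq_nonneg w) (sq_nonneg (w - 1)), mul_nonneg (sq_nonneg w) hw]
    have h4 : c * (1 + S.r u t) ≤ c * (1 + S.r u t) ^ 2 := by
      gcongr; nlinarith
    rw [mul_pow] at h2
    nlinarith

lemma compFn_pos {α β M : ℝ} {p0 : ℝ × ℝ} {u t : ℝ} :
    0 < (S.compFn α β M p0).z0 u t ↔ (u, t) ∈ comp (S.lin α β) M p0 := by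
  rw [← trunc_pos]
  change 0 < trunc (S.lin α β) M p0 (u, t) ^ 4 ↔ _
  constructor
  · intro h
    rcases (trunc_nonneg (f := S.lin α β) (M := M) (p0 := p0) (u, t)).eq_or_lt with h' | h'
    · rw [← h'] at h; norm_num at h
    · exact h'
  · intro h; positivity

/-- constant test function -/
def oneFn : TestFn S 0 0 where
  z0 _ _ := 1
  z1 _ _ := 0
  z2 _ _ := 0
  c0 := by fun_prop
  c1 := by fun_prop
  c2 := by fun_prop
  hu0 u t := by simpa using hasDerivAt_const u (1:ℝ)
  hu1 u t := by simpa using hasDerivAt_const u (0:ℝ)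
  ht0 u t _ := by simpa using hasDerivAt_const t (1:ℝ)
  z0n _ _ := by norm_num
  z2n _ _ := by norm_num
  z1b _ _ := by norm_num
  C := 1
  Cn := by norm_num
  b0 u t := by have := S.r_nonneg u t; nlinarith
  b1 u t := by have := S.r_nonneg u t; rw [abs_zero]; positivity

lemma oneFn_W (t : ℝ) (ht : t < t0) : S.oneFn.W t ≤ m * √(4 * π) := by
  have hmin := S.th_eq ht
  have hτ : 0 < -t := by have := S.th_neg t; linarith
  have h1 := S.ent t (-t) hτ
  have hs : 0 < √(-t) := Real.sqrt_pos.2 hτ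
  have e1 : S.oneFn.W t = (∫ u, Real.exp (-(S.x u t ^ 2 + S.y u t ^ 2) / (4 * -t)) * S.g u t) / √(-t) := by
    rw [← integral_div]
    unfold TestFn.W TestFn.F
    congr 1; ext u
    rw [S.G_eq, hmin]
    change 1 * _ * _ = _
    unfold r; ring
  rw [e1, div_le_iff₀ hs]
  refine h1.trans (le_of_eq ?_)
  rw [Real.sqrt_mul (by positivity)]; ring

/-- rescaled time slice -/
def slice (t : ℝ) (ht : t < t0) : SCurve m where
  x u := S.x u t / √(-t)
  y u := S.y u t / √(-t)
  a u := S.a u t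
  b u := S.b u t
  k u := S.k u t * √(-t)
  g u := S.g u t / √(-t)
  ck := by have := S.ck; fun_prop
  cg := by have := S.cg; fun_prop
  hx u := ((S.hx u t).div_const _).congr_deriv (by ring)
  hy u := ((S.hy u t).div_const _).congr_deriv (by ring)
  ha u := (S.ha u t).congr_deriv (by
    have : 0 < √(-t) := Real.sqrt_pos.2 (by have := S.t0neg; linarith)
    field_simp)
  hb u := (S.hb u t).congr_deriv (by
    have : 0 < √(-t) := Real.sqrt_pos.2 (by have := S.t0neg; linarith)
    field_simp)
  gpos u := div_pos (S.gpos u t) (Real.sqrt_pos.2 (by have := S.t0neg; linarith))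
  unit u := S.unit u t
  prop_top := by
    have h := (S.prop_top t).atTop_div_const (r := √(-t) ^ 2)
      (pow_pos (Real.sqrt_pos.2 (by have := S.t0neg; linarith)) 2)
    exact h.congr fun u => by ring
  prop_bot := by
    have h := (S.prop_bot t).atTop_div_const (r := √(-t) ^ 2)
      (pow_pos (Real.sqrt_pos.2 (by have := S.t0neg; linarith)) 2)
    exact h.congr fun u => by ring
  ent_int l hl := by
    have hτ : 0 < -t := by have := S.t0neg; linarith
    refine ((S.ent_int t (l * -t) (by positivity)).div_const (√(-t))).congr
      (Eventually.of_forall fun u => ?_)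
    simp only
    rw [div_pow, div_pow, Real.sq_sqrt hτ.le, mul_div_assoc]
    congr 2
    field_simp
    ring
  ent l hl := by
    have hτ : 0 < -t := by have := S.t0neg; linarith
    have hs : 0 < √(-t) := Real.sqrt_pos.2 hτ
    have h := S.ent t (l * -t) (by positivity)
    have e1 : (fun u => Real.exp (-((S.x u t / √(-t)) ^ 2 + (S.y u t / √(-t)) ^ 2) / (4 * l))
        * (S.g u t / √(-t))) = fun u =>
        (Real.exp (-(S.x u t ^ 2 + S.y u t ^ 2) / (4 * (l * -t))) * S.g u t) / √(-t) := by
      ext u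
      rw [div_pow, div_pow, Real.sq_sqrt hτ.le, mul_div_assoc]
      congr 2
      field_simp
      ring
    rw [e1, integral_div, div_le_iff₀ hs]
    refine h.trans (le_of_eq ?_)
    rw [← mul_assoc, Real.sqrt_mul (by positivity) (-t), mul_assoc m]

lemma slice_r (t : ℝ) (ht : t < t0) (u : ℝ) : (S.slice t ht).r u = S.r u t / (-t) := by
  have hτ : 0 < -t := by have := S.t0neg; linarith
  unfold SCurve.r r
  change (S.x u t / √(-t)) ^ 2 + (S.y u t / √(-t)) ^ 2 = _
  rw [div_pow, div_pow, Real.sq_sqrt hτ.le]; ring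

lemma slice_Q (t : ℝ) (ht : t < t0) (N : ℝ) :
    ∫ u in (-N)..N, (S.slice t ht).E u ^ 2 * (S.slice t ht).e u * (S.slice t ht).g u
      = (-t) * S.oneFn.Q N t := by
  have hmin := S.th_eq ht
  have hτ : 0 < -t := by have := S.t0neg; linarith
  have hs : 0 < √(-t) := Real.sqrt_pos.2 hτ
  have hsq : √(-t) ^ 2 = -t := Real.sq_sqrt hτ.le
  unfold TestFn.Q
  rw [← intervalIntegral.integral_const_mul]
  refine intervalIntegral.integral_congr fun u _ => ?_
  unfold TestFn.q SCurve.e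
  rw [S.slice_r, S.G_eq, hmin]
  unfold SCurve.E SCurve.nu E nu
  rw [hmin]
  change (S.k u t * √(-t) + (-(S.x u t / √(-t)) * S.b u t + S.y u t / √(-t) * S.a u t) / 2) ^ 2
    * Real.exp (-(S.r u t / -t) / 4) * (S.g u t / √(-t)) = -t * ((0 * _ + 1 * _) * _ * S.g u t)
  have he : -(S.r u t / -t) / 4 = -(S.r u t) / (4 * -t) := by field_simp
  rw [he]
  generalize Real.exp (-(S.r u t) / (4 * -t)) = e
  have hid : t = -√(-t) ^ 2 := by linarith
  generalize √(-t) = q at *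
  subst hid
  field_simp
  ring

end SFlow

lemma same_comp {f : ℝ × ℝ → ℝ} {M M' : ℝ} {P Q : ℝ × ℝ} {p q t : ℝ}
    (hp : (p, t) ∈ comp f M P) (hq : (q, t) ∈ comp f M' Q) (hM : M ≤ M') (hQ : M' < f Q)
    (hseg : ∀ z ∈ uIcc p q, M < f (z, t)) : Q ∈ comp f M P := by
  have e1 : comp f M P = comp f M (p, t) := connectedComponentIn_eq hp
  have hpre : IsPreconnected (uIcc p q ×ˢ {t} : Set (ℝ × ℝ)) :=
    isPreconnected_uIcc.prod isPreconnected_singleton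
  have h1 : (uIcc p q ×ˢ {t} : Set (ℝ × ℝ)) ⊆ connectedComponentIn {x | M < f x} (p, t) := by
    refine hpre.subset_connectedComponentIn ⟨left_mem_uIcc, rfl⟩ ?_
    rintro ⟨z, s⟩ ⟨hz, hs⟩
    simp only [mem_singleton_iff] at hs
    subst hs
    exact hseg z hz
  have hq1 : (q, t) ∈ comp f M (p, t) := h1 ⟨right_mem_uIcc, rfl⟩
  have e2 : comp f M (p, t) = comp f M (q, t) := connectedComponentIn_eq hq1
  have h2 : comp f M' Q ⊆ connectedComponentIn {x | M < f x} (q, t) := by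
    refine isPreconnected_connectedComponentIn.subset_connectedComponentIn hq ?_
    intro x hx
    exact lt_of_le_of_lt hM (comp_lt hx)
  rw [e1, e2]
  exact h2 (mem_connectedComponentIn hQ)

/-- clamping of the time variable -/
def clampT (t0 : ℝ) : C(ℝ × ℝ, ℝ × ℝ) := ⟨fun p => (p.1, min p.2 t0), by fun_prop⟩

lemma comp_path {f : ℝ × ℝ → ℝ} (hf : Continuous f) {M t0 : ℝ} {P Q : ℝ × ℝ}
    (hQ : Q ∈ comp f M P) (hP2 : P.2 = t0) (hQ2 : Q.2 ≤ t0)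
    (hcl : ∀ u t, f (u, t) = f (u, min t t0)) :
    ∃ c : C(unitInterval, ℝ × ℝ), c 0 = P ∧ c 1 = Q ∧ (∀ s, (c s).2 ≤ t0) ∧ ∀ s, M < f (c s) := by
  have hP : M < f P := by
    have : (comp f M P).Nonempty := ⟨Q, hQ⟩
    exact (connectedComponentIn_nonempty_iff (F := {p | M < f p}) (x := P)).1 this
  have hconn : IsConnected (comp f M P) :=
    (isConnected_connectedComponentIn_iff (F := {p | M < f p}) (x := P)).2 hP
  have hpath : IsPathConnected (comp f M P) := (comp_open hf).isConnected_iff_isPathConnected.1 hconn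
  obtain ⟨γ, hγ⟩ := hpath.joinedIn P (mem_connectedComponentIn hP) Q hQ
  refine ⟨(clampT t0).comp γ.toContinuousMap, ?_, ?_, fun s => ?_, fun s => ?_⟩
  · change clampT t0 (γ 0) = P
    rw [γ.source]; unfold clampT
    ext
    · rfl
    · change min P.2 t0 = P.2; rw [hP2, min_self]
  · change clampT t0 (γ 1) = Q
    rw [γ.target]; unfold clampT
    ext
    · rfl
    · change min Q.2 t0 = Q.2; exact min_eq_left hQ2
  · exact min_le_right _ _
  · have := comp_lt (hγ s)
    change M < f ((γ s).1, min (γ s).2 t0)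
    rw [← hcl]; exact this

namespace SFlow
variable {m t0 : ℝ} (S : SFlow m t0)

lemma lin_cl (α β u t : ℝ) : S.lin α β (u, t) = S.lin α β (u, min t t0) := by
  unfold lin; simp only; rw [S.clx u t, S.cly u t]

lemma no_join {α β M aL aR w : ℝ} (h1 : aL < w) (h2 : w < aR) (hw : S.lin α β (w, t0) < M)
    (h : (aR, t0) ∈ comp (S.lin α β) M (aL, t0)) : False := by
  obtain ⟨c, hc0, hc1, hc2, hc3⟩ := comp_path (S.clin α β) h rfl le_rfl (S.lin_cl α β)
  -- lowest time
  have hcont : Continuous fun s => (c s).2 := by fun_prop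
  obtain ⟨s1, -, hs1⟩ := (isCompact_univ (X := unitInterval)).exists_isMinOn
    ⟨0, mem_univ _⟩ hcont.continuousOn
  set T := (c s1).2 - 1 with hT
  have hTlt : ∀ s, T < (c s).2 := by
    intro s
    have : (c s1).2 ≤ (c s).2 := hs1 (mem_univ s)
    linarith
  have hTt0 : T < t0 := by have := hc2 s1; linarith
  have hneg : ∀ p, S.lin (-α) (-β) p = -(S.lin α β p) := by intro p; unfold lin; ring
  have hw' : -M < S.lin (-α) (-β) (w, t0) := by rw [hneg]; linarith
  have hz : 0 < (S.compFn (-α) (-β) (-M) (w, t0)).z0 w t0 :=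
    S.compFn_pos.2 (mem_connectedComponentIn hw')
  have hW := (S.compFn (-α) (-β) (-M) (w, t0)).W_pos hz hTt0
  obtain ⟨u, hu⟩ : ∃ u, 0 < (S.compFn (-α) (-β) (-M) (w, t0)).z0 u T := by
    by_contra hcon
    push Not at hcon
    have : (S.compFn (-α) (-β) (-M) (w, t0)).W T = 0 := by
      unfold TestFn.W TestFn.F
      have : ∀ u, (S.compFn (-α) (-β) (-M) (w, t0)).z0 u T = 0 := fun u =>
        le_antisymm (hcon u) ((S.compFn (-α) (-β) (-M) (w, t0)).z0n u T)
      simp [this]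
    linarith
  rw [S.compFn_pos] at hu
  obtain ⟨e, he0, he1, he2, he3⟩ := comp_path (S.clin (-α) (-β)) hu rfl hTt0.le (S.lin_cl (-α) (-β))
  obtain ⟨s, r, hsr⟩ := crossing e c t0 he2 hc2 (by rw [he0]) (by rw [hc0]) (by rw [hc1])
    (by rw [he0, hc0]; exact h1) (by rw [he0, hc1]; exact h2) (by rw [he1]; exact hTlt)
  have q1 := hc3 r
  have q2 := he3 s
  rw [hneg, hsr] at q2
  linarith

end SFlow

lemma main_contra {t0 : ℝ} (m : ℕ) (S : SFlow (m:ℝ) t0) (a : Fin (m + 1) → ℝ)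
    (w : Fin m → ℝ) (hw1 : ∀ j : Fin m, a j.castSucc < w j) (hw2 : ∀ j : Fin m, w j < a j.succ)
    (α β : Fin (m + 1) → ℝ) (s : ℝ) (hs : 0 < s) (hα : ∀ l, |α l| ≤ 2) (hβ : ∀ l, |β l| ≤ 2)
    (hsep : ∀ l l', l ≠ l' → s ≤ |α l * β l' - α l' * β l|)
    (hf1 : ∀ l (j : Fin m), S.lin (α l) (β l) (w j, t0) < S.lin (α l) (β l) (a j.castSucc, t0))
    (hf2 : ∀ l (j : Fin m), S.lin (α l) (β l) (w j, t0) < S.lin (α l) (β l) (a j.succ, t0)) :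
    False := by
  have ha : StrictMono a := Fin.strictMono_iff_lt_succ.2 fun j => (hw1 j).trans (hw2 j)
  -- levels
  have hlev : ∀ l i, ∃ M, M < S.lin (α l) (β l) (a i, t0) ∧
      ∀ j : Fin m, (j.castSucc = i ∨ j.succ = i) → S.lin (α l) (β l) (w j, t0) < M := by
    intro l i
    have h1 : ∀ᶠ M in nhdsWithin (S.lin (α l) (β l) (a i, t0)) (Iio (S.lin (α l) (β l) (a i, t0))),
        ∀ j : Fin m, (j.castSucc = i ∨ j.succ = i) → S.lin (α l) (β l) (w j, t0) < M := by
      rw [eventually_all]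
      intro j
      by_cases hj : j.castSucc = i ∨ j.succ = i
      · have h2 : S.lin (α l) (β l) (w j, t0) < S.lin (α l) (β l) (a i, t0) := by
          rcases hj with h | h
          · rw [← h]; exact hf1 l j
          · rw [← h]; exact hf2 l j
        filter_upwards [nhdsWithin_le_nhds (Ioi_mem_nhds h2)] with M hM _ using hM
      · exact Eventually.of_forall fun M h => absurd h hj
    obtain ⟨M, h2, h3⟩ := (h1.and self_mem_nhdsWithin).exists
    exact ⟨M, h3, h2⟩
  choose M hM1 hM2 using hlev
  -- non joining
  have hnj : ∀ l i j, i ≠ j → (a j, t0) ∈ comp (S.lin (α l) (β l)) (M l i) (a i, t0) → False := by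
    intro l i j hij hmem
    rcases lt_or_gt_of_ne hij with h | h
    · have hi : i ≠ Fin.last m := (h.trans_le (Fin.le_last j)).ne
      obtain ⟨k, rfl⟩ := Fin.exists_castSucc_eq.2 hi
      have hkj : k.succ ≤ j := Fin.castSucc_lt_iff_succ_le.1 h
      exact S.no_join (hw1 k) ((hw2 k).trans_le (ha.monotone hkj)) (hM2 l _ k (Or.inl rfl)) hmem
    · have hi : i ≠ 0 := (lt_of_le_of_lt (Fin.zero_le j) h).ne'
      obtain ⟨k, rfl⟩ := Fin.exists_succ_eq.2 hi
      have hkj : j ≤ k.castSucc := Fin.le_castSucc_iff.2 h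
      have e1 : comp (S.lin (α l) (β l)) (M l k.succ) (a k.succ, t0)
        = comp (S.lin (α l) (β l)) (M l k.succ) (a j, t0) := connectedComponentIn_eq hmem
      have h3 : (a k.succ, t0) ∈ comp (S.lin (α l) (β l)) (M l k.succ) (a j, t0) := by
        rw [← e1]; exact mem_connectedComponentIn (hM1 l _)
      exact S.no_join ((ha.monotone hkj).trans_lt (hw1 k)) (hw2 k) (hM2 l _ k (Or.inr rfl)) h3
  -- test functions
  obtain ⟨A, hA, hgood⟩ := good_time S (ι := Fin (m + 1) × Fin (m + 1))
    (α := fun i => α i.1) (β := fun i => β i.1)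
    (fun i => S.compFn (α i.1) (β i.1) (M i.1 i.2) (a i.2, t0))
    (fun i t ht => TestFn.W_pos _
      (S.compFn_pos.2 (mem_connectedComponentIn (hM1 i.1 i.2))) ht)
    S.oneFn (m * √(4 * π)) (fun t ht => S.oneFn_W t ht)
  set R := √(8 + 16 * A) with hR
  have hR2 : R ^ 2 = 8 + 16 * A := Real.sq_sqrt (by positivity)
  obtain ⟨ε, hε, hstat⟩ := static_main m (R := R) (η := s / 64) (Real.sqrt_nonneg _) (by positivity)
  obtain ⟨t, ht, hQ1, hQ2⟩ := hgood ε hε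
  have hτ : 0 < -t := by have := S.t0neg; linarith
  have hpts : ∀ l i, ∃ u, (u, t) ∈ comp (S.lin (α l) (β l)) (M l i) (a i, t0) ∧
      S.r u t ≤ (8 + 16 * A) * (-t) := by
    intro l i
    obtain ⟨u, h1, h2⟩ := TestFn.conc (S.compFn (α l) (β l) (M l i) (a i, t0)) ht hA
      (TestFn.W_pos _ (S.compFn_pos.2 (mem_connectedComponentIn (hM1 l i))) ht) (hQ1 (l, i))
    exact ⟨u, S.compFn_pos.1 h1, h2⟩
  choose b hb1 hb2 using hpts
  obtain ⟨c, d, harc, hpig⟩ := hstat (S.slice t ht) (fun N => by rw [S.slice_Q]; exact hQ2 N)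
  have hbR : ∀ l i, (S.slice t ht).r (b l i) ≤ R ^ 2 := by
    intro l i
    rw [S.slice_r, hR2, div_le_iff₀ hτ]
    exact hb2 l i
  -- for each direction, a tangency
  have htan : ∀ l, ∃ i z, z ∈ Ioo (c (b l i)) (d (b l i)) ∧
      α l * S.a z t + β l * S.b z t = 0 := by
    intro l
    obtain ⟨i, j, hij, hc, hd⟩ := hpig (fun i => b l i) (hbR l)
    by_contra hcon
    push Not at hcon
    have hne := hcon i
    set J := Ioo (c (b l i)) (d (b l i)) with hJ
    have hbi : b l i ∈ J := (harc _ (hbR l i)).1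
    have hbj : b l j ∈ J := by
      have := (harc _ (hbR l j)).1
      rw [← hc, ← hd] at this; exact this
    have hJord : OrdConnected J := ordConnected_Ioo
    have hsub : uIcc (b l i) (b l j) ⊆ J := hJord.uIcc_subset hbi hbj
    have ca := S.ca; have cb := S.cb
    have hcont : Continuous fun z => α l * S.a z t + β l * S.b z t := by fun_prop
    have clin := S.clin (α l) (β l)
    have hclin : Continuous fun z => S.lin (α l) (β l) (z, t) := by fun_prop
    have hpre : IsPreconnected J := isPreconnected_Ioo
    -- min principle on the segment
    have hmin : ∀ z ∈ uIcc (b l i) (b l j),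
        min (S.lin (α l) (β l) (b l i, t)) (S.lin (α l) (β l) (b l j, t)) ≤
          S.lin (α l) (β l) (z, t) := by
      have hmono : MonotoneOn (fun z => S.lin (α l) (β l) (z, t)) J ∨
          AntitoneOn (fun z => S.lin (α l) (β l) (z, t)) J := by
        by_cases hpos : ∀ z ∈ J, 0 ≤ α l * S.a z t + β l * S.b z t
        · left
          refine monotoneOn_of_deriv_nonneg (convex_Ioo _ _) hclin.continuousOn
            (fun u _ => (S.hlin_u _ _ u t).differentiableAt.differentiableWithinAt) fun u hu => ?_
          rw [(S.hlin_u _ _ u t).deriv]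
          exact mul_nonneg (hpos u (interior_subset hu)) (S.gpos u t).le
        · right
          push Not at hpos
          obtain ⟨z0, hz0, hz0n⟩ := hpos
          refine antitoneOn_of_deriv_nonpos (convex_Ioo _ _) hclin.continuousOn
            (fun u _ => (S.hlin_u _ _ u t).differentiableAt.differentiableWithinAt) fun u hu => ?_
          rw [(S.hlin_u _ _ u t).deriv]
          refine mul_nonpos_of_nonpos_of_nonneg ?_ (S.gpos u t).le
          by_contra hup
          push Not at hup
          obtain ⟨z, hz, hz'⟩ := hpre.intermediate_value hz0 (interior_subset hu)
            hcont.continuousOn ⟨hz0n.le, hup.le⟩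
          exact hne z hz hz'
      intro z hz
      have hzJ := hsub hz
      rcases le_total (b l i) (b l j) with h | h
      · rw [uIcc_of_le h] at hz
        rcases hmono with hm | hm
        · exact (min_le_left _ _).trans (hm hbi hzJ hz.1)
        · exact (min_le_right _ _).trans (hm hzJ hbj hz.2)
      · rw [uIcc_of_ge h] at hz
        rcases hmono with hm | hm
        · exact (min_le_right _ _).trans (hm hbj hzJ hz.1)
        · exact (min_le_left _ _).trans (hm hzJ hbi hz.2)
    have hgi := comp_lt (hb1 l i)
    have hgj := comp_lt (hb1 l j)
    rcases le_total (M l i) (M l j) with h | h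
    · refine hnj l i j hij (same_comp (hb1 l i) (hb1 l j) h (hM1 l j) fun z hz => ?_)
      exact lt_of_lt_of_le (lt_min hgi (h.trans_lt hgj)) (hmin z hz)
    · refine hnj l j i hij.symm (same_comp (hb1 l j) (hb1 l i) h (hM1 l i) fun z hz => ?_)
      rw [uIcc_comm] at hz
      exact lt_of_lt_of_le (lt_min (h.trans_lt hgi) hgj) (hmin z hz)
  choose i z hz hz0 using htan
  obtain ⟨l, l', hll, hc, hd⟩ := hpig (fun l => b l (i l)) (fun l => hbR l _)
  have hz' : z l' ∈ Ioo (c (b l (i l))) (d (b l (i l))) := by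
    have := hz l'
    rw [hc, hd]; exact this
  obtain ⟨p1, p2⟩ := (harc _ (hbR l (i l))).2 _ (hz l)
  obtain ⟨p3, p4⟩ := (harc _ (hbR l (i l))).2 _ hz'
  change |S.a (z l) t - S.a _ t| ≤ _ at p1
  change |S.b (z l) t - S.b _ t| ≤ _ at p2
  change |S.a (z l') t - S.a _ t| ≤ _ at p3
  change |S.b (z l') t - S.b _ t| ≤ _ at p4
  have hda : |S.a (z l) t - S.a (z l') t| ≤ s / 32 := by
    rw [abs_le] at *; constructor <;> linarith [p1.1, p1.2, p3.1, p3.2]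
  have hdb : |S.b (z l) t - S.b (z l') t| ≤ s / 32 := by
    rw [abs_le] at *; constructor <;> linarith [p2.1, p2.2, p4.1, p4.2]
  have hu := S.unit (z l) t
  have h0 := hz0 l
  have h0' := hz0 l'
  have hsp := hsep l l' hll
  have hab := S.ab_le (z l) t
  have e1 : α l * β l' - α l' * β l = (α l * S.b (z l) t - β l * S.a (z l) t) *
      (α l' * (S.a (z l) t - S.a (z l') t) + β l' * (S.b (z l) t - S.b (z l') t)) := by
    linear_combination (β l * α l' - α l * β l') * hu
      + (α l * S.b (z l) t - β l * S.a (z l) t) * h0'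
      + (S.a (z l) t * β l' - S.b (z l) t * α l') * h0
  rw [e1, abs_mul] at hsp
  have q1 : |α l * S.b (z l) t - β l * S.a (z l) t| ≤ 4 := by
    refine (abs_sub _ _).trans ?_
    rw [abs_mul, abs_mul]
    nlinarith [hα l, hβ l, hab.1, hab.2, abs_nonneg (α l), abs_nonneg (β l),
      abs_nonneg (S.a (z l) t), abs_nonneg (S.b (z l) t)]
  have q2 : |α l' * (S.a (z l) t - S.a (z l') t) + β l' * (S.b (z l) t - S.b (z l') t)| ≤ s / 8 := by
    refine (abs_add_le _ _).trans ?_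
    rw [abs_mul, abs_mul]
    have r1 : |α l'| * |S.a (z l) t - S.a (z l') t| ≤ 2 * (s / 32) :=
      mul_le_mul (hα l') hda (abs_nonneg _) (by norm_num)
    have r2 : |β l'| * |S.b (z l) t - S.b (z l') t| ≤ 2 * (s / 32) :=
      mul_le_mul (hβ l') hdb (abs_nonneg _) (by norm_num)
    linarith
  have q3 := mul_le_mul q1 q2 (abs_nonneg _) (by norm_num)
  linarith

def dU (X : ℝ × ℝ → ℝ) (p : ℝ × ℝ) : ℝ := fderiv ℝ X p (1, 0)
def dV (X : ℝ × ℝ → ℝ) (p : ℝ × ℝ) : ℝ := fderiv ℝ X p (0, 1)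

def Om : Set (ℝ × ℝ) := {p | p.2 < 0}
lemma Om_open : IsOpen Om := isOpen_lt continuous_snd continuous_const

/-- smooth on negative times -/
def Smo (X : ℝ × ℝ → ℝ) : Prop := ContDiffOn ℝ (⊤ : ℕ∞) X Om

namespace Smo
variable {X Y : ℝ × ℝ → ℝ}

lemma at_ (hX : Smo X) {p : ℝ × ℝ} (hp : p.2 < 0) : ContDiffAt ℝ (⊤ : ℕ∞) X p :=
  ContDiffOn.contDiffAt hX (Om_open.mem_nhds hp)

lemma diff (hX : Smo X) {p : ℝ × ℝ} (hp : p.2 < 0) : DifferentiableAt ℝ X p :=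
  (hX.at_ hp).differentiableAt (by simp)

lemma fd (hX : Smo X) (w : ℝ × ℝ) : Smo (fun p => fderiv ℝ X p w) := by
  intro p hp
  have h : ContDiffAt ℝ (⊤ : ℕ∞) (fderiv ℝ X) p := (hX.at_ hp).fderiv_right (by simp)
  exact (h.clm_apply contDiffAt_const).contDiffWithinAt

lemma du (hX : Smo X) : Smo (dU X) := hX.fd _
lemma dv (hX : Smo X) : Smo (dV X) := hX.fd _

lemma hU (hX : Smo X) {u t : ℝ} (ht : t < 0) :
    HasDerivAt (fun u => X (u, t)) (dU X (u, t)) u := by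
  have h1 : HasDerivAt (fun u : ℝ => (u, t)) ((1 : ℝ), (0 : ℝ)) u :=
    (hasDerivAt_id u).prodMk (hasDerivAt_const u t)
  exact (hX.diff (p := (u, t)) ht).hasFDerivAt.comp_hasDerivAt u h1

lemma hV (hX : Smo X) {u t : ℝ} (ht : t < 0) :
    HasDerivAt (fun t => X (u, t)) (dV X (u, t)) t := by
  have h1 : HasDerivAt (fun t : ℝ => (u, t)) ((0 : ℝ), (1 : ℝ)) t :=
    (hasDerivAt_const t u).prodMk (hasDerivAt_id t)
  exact (hX.diff (p := (u, t)) ht).hasFDerivAt.comp_hasDerivAt t h1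

lemma comm (hX : Smo X) {p : ℝ × ℝ} (hp : p.2 < 0) : dU (dV X) p = dV (dU X) p := by
  have h : ContDiffAt ℝ (⊤ : ℕ∞) (fderiv ℝ X) p := (hX.at_ hp).fderiv_right (by simp)
  have hd : DifferentiableAt ℝ (fderiv ℝ X) p := h.differentiableAt (by simp)
  have hs : IsSymmSndFDerivAt ℝ X p := (hX.at_ hp).isSymmSndFDerivAt
    (by simpa using WithTop.coe_le_coe.2 (le_top : (2 : ℕ∞) ≤ ⊤))
  have key : ∀ v w : ℝ × ℝ, fderiv ℝ (fun q => fderiv ℝ X q v) p w = fderiv ℝ (fderiv ℝ X) p w v := by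
    intro v w
    rw [fderiv_clm_apply hd (differentiableAt_const v)]
    simp
  unfold dU dV
  rw [key, key]
  exact hs _ _

lemma clamp (hX : Smo X) {t0 : ℝ} (h0 : t0 < 0) :
    Continuous (fun p : ℝ × ℝ => X (p.1, min p.2 t0)) := by
  have : ContinuousOn X Om := ContDiffOn.continuousOn hX
  refine this.comp_continuous (f := fun p : ℝ × ℝ => (p.1, min p.2 t0)) (by fun_prop) ?_
  intro p
  exact lt_of_le_of_lt (min_le_right _ _) h0

end Smo

/-- scalar data -/
structure SData (X Y : ℝ × ℝ → ℝ) : Prop where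
  sx : Smo X
  sy : Smo Y
  reg : ∀ p : ℝ × ℝ, p.2 < 0 → 0 < dU X p ^ 2 + dU Y p ^ 2

def gg (X Y : ℝ × ℝ → ℝ) (p : ℝ × ℝ) : ℝ := √(dU X p ^ 2 + dU Y p ^ 2)
def aa (X Y : ℝ × ℝ → ℝ) (p : ℝ × ℝ) : ℝ := dU X p / gg X Y p
def bb (X Y : ℝ × ℝ → ℝ) (p : ℝ × ℝ) : ℝ := dU Y p / gg X Y p
def kk (X Y : ℝ × ℝ → ℝ) (p : ℝ × ℝ) : ℝ :=
  (aa X Y p * dU (bb X Y) p - bb X Y p * dU (aa X Y) p) / gg X Y p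

namespace SData
variable {X Y : ℝ × ℝ → ℝ}

lemma gp (D : SData X Y) {p : ℝ × ℝ} (hp : p.2 < 0) : 0 < gg X Y p := Real.sqrt_pos.2 (D.reg p hp)
lemma gsq (D : SData X Y) {p : ℝ × ℝ} (hp : p.2 < 0) : gg X Y p ^ 2 = dU X p ^ 2 + dU Y p ^ 2 :=
  Real.sq_sqrt (D.reg p hp).le

lemma sg (D : SData X Y) : Smo (gg X Y) := by
  unfold gg
  have h : ContDiffOn ℝ (⊤ : ℕ∞) (fun p => dU X p ^ 2 + dU Y p ^ 2) Om :=
    (ContDiffOn.pow D.sx.du 2).add (ContDiffOn.pow D.sy.du 2)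
  exact h.sqrt (fun p hp => (D.reg p hp).ne')
lemma sa (D : SData X Y) : Smo (aa X Y) := ContDiffOn.div D.sx.du D.sg (fun p hp => (D.gp hp).ne')
lemma sb (D : SData X Y) : Smo (bb X Y) := ContDiffOn.div D.sy.du D.sg (fun p hp => (D.gp hp).ne')
lemma sk (D : SData X Y) : Smo (kk X Y) :=
  ContDiffOn.div ((ContDiffOn.mul D.sa D.sb.du).sub (ContDiffOn.mul D.sb D.sa.du)) D.sg
    (fun p hp => (D.gp hp).ne')

lemma ag (D : SData X Y) {p : ℝ × ℝ} (hp : p.2 < 0) : dU X p = aa X Y p * gg X Y p := by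
  have := (D.gp hp).ne'
  unfold aa; field_simp
lemma bg (D : SData X Y) {p : ℝ × ℝ} (hp : p.2 < 0) : dU Y p = bb X Y p * gg X Y p := by
  have := (D.gp hp).ne'
  unfold bb; field_simp
lemma un (D : SData X Y) {p : ℝ × ℝ} (hp : p.2 < 0) : aa X Y p ^ 2 + bb X Y p ^ 2 = 1 := by
  have h1 := D.gsq hp
  have := (D.gp hp).ne'
  unfold aa bb; field_simp; linarith

lemma orth (D : SData X Y) {u t : ℝ} (ht : t < 0) :
    aa X Y (u, t) * dU (aa X Y) (u, t) + bb X Y (u, t) * dU (bb X Y) (u, t) = 0 := by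
  have h := ((D.sa.hU (u := u) ht).pow 2).add ((D.sb.hU (u := u) ht).pow 2)
  have h2 : HasDerivAt (fun u => aa X Y (u, t) ^ 2 + bb X Y (u, t) ^ 2) 0 u := by
    have e : (fun u => aa X Y (u, t) ^ 2 + bb X Y (u, t) ^ 2) = fun _ => 1 := by
      funext u; exact D.un (p := (u, t)) ht
    rw [e]; exact hasDerivAt_const _ _
  have h3 := h.unique h2
  norm_num at h3
  linarith

lemma au (D : SData X Y) {u t : ℝ} (ht : t < 0) :
    dU (aa X Y) (u, t) = -(bb X Y (u, t)) * kk X Y (u, t) * gg X Y (u, t) := by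
  have h1 := D.orth (u := u) ht
  have h2 := D.un (p := (u, t)) ht
  have := (D.gp (p := (u, t)) ht).ne'
  unfold kk; field_simp
  linear_combination (-dU (aa X Y) (u, t)) * h2 + aa X Y (u,t) * h1
lemma bu (D : SData X Y) {u t : ℝ} (ht : t < 0) :
    dU (bb X Y) (u, t) = aa X Y (u, t) * kk X Y (u, t) * gg X Y (u, t) := by
  have h1 := D.orth (u := u) ht
  have h2 := D.un (p := (u, t)) ht
  have := (D.gp (p := (u, t)) ht).ne'
  unfold kk; field_simp
  linear_combination (-dU (bb X Y) (u, t)) * h2 + bb X Y (u,t) * h1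

lemma gt (D : SData X Y) (hx : ∀ p : ℝ × ℝ, p.2 < 0 → dV X p = dU (aa X Y) p / gg X Y p)
    (hy : ∀ p : ℝ × ℝ, p.2 < 0 → dV Y p = dU (bb X Y) p / gg X Y p) {u t : ℝ} (ht : t < 0) :
    dV X (u, t) = -(bb X Y (u, t)) * kk X Y (u, t) ∧
    dV Y (u, t) = aa X Y (u, t) * kk X Y (u, t) ∧
    dV (gg X Y) (u, t) = -(kk X Y (u, t)) ^ 2 * gg X Y (u, t) := by
  have ex : ∀ u, dV X (u, t) = -(bb X Y (u, t)) * kk X Y (u, t) := by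
    intro u
    have := (D.gp (p := (u, t)) ht).ne'
    rw [hx _ ht, D.au ht]; field_simp
  have ey : ∀ u, dV Y (u, t) = aa X Y (u, t) * kk X Y (u, t) := by
    intro u
    have := (D.gp (p := (u, t)) ht).ne'
    rw [hy _ ht, D.bu ht]; field_simp
  refine ⟨ex u, ey u, ?_⟩
  have e1 : dV (dU X) (u, t) = -(dU (bb X Y) (u, t)) * kk X Y (u, t)
      + -(bb X Y (u, t)) * dU (kk X Y) (u, t) := by
    rw [← D.sx.comm (p := (u, t)) ht]
    have h := (D.sb.hU (u := u) ht).neg.mul (D.sk.hU (u := u) ht)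
    have h2 := D.sx.dv.hU (u := u) ht
    have e : (fun u => dV X (u, t)) = fun u => -(bb X Y (u, t)) * kk X Y (u, t) := funext ex
    rw [e] at h2
    exact h2.unique h
  have e2 : dV (dU Y) (u, t) = dU (aa X Y) (u, t) * kk X Y (u, t)
      + aa X Y (u, t) * dU (kk X Y) (u, t) := by
    rw [← D.sy.comm (p := (u, t)) ht]
    have h := (D.sa.hU (u := u) ht).mul (D.sk.hU (u := u) ht)
    have h2 := D.sy.dv.hU (u := u) ht
    have e : (fun u => dV Y (u, t)) = fun u => aa X Y (u, t) * kk X Y (u, t) := funext ey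
    rw [e] at h2
    exact h2.unique h
  have h := ((D.sx.du.hV (u := u) ht).pow 2).add ((D.sy.du.hV (u := u) ht).pow 2)
  have h2 := (D.sg.hV (u := u) ht).pow 2
  have e : (fun t => gg X Y (u, t)) ^ 2 =ᶠ[nhds t]
      (fun t => dU X (u, t)) ^ 2 + (fun t => dU Y (u, t)) ^ 2 := by
    filter_upwards [Iio_mem_nhds ht] with s hs
    exact D.gsq (p := (u, s)) hs
  have h3 := (h2.congr_of_eventuallyEq e.symm).unique h
  norm_num at h3
  rw [e1, e2, D.au ht, D.bu ht, D.ag (p := (u, t)) ht, D.bg (p := (u, t)) ht] at h3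
  have hg := (D.gp (p := (u, t)) ht).ne'
  have hu := D.un (p := (u, t)) ht
  have : gg X Y (u, t) * dV (gg X Y) (u, t) =
      gg X Y (u, t) * (-(kk X Y (u, t)) ^ 2 * gg X Y (u, t)) := by
    linear_combination h3 / 2 - gg X Y (u, t) ^ 2 * kk X Y (u, t) ^ 2 * hu
  exact mul_left_cancel₀ hg this

end SData

def mkFlow {X Y : ℝ × ℝ → ℝ} (D : SData X Y) (m t0 : ℝ) (h0 : t0 < 0)
    (hx : ∀ p : ℝ × ℝ, p.2 < 0 → dV X p = dU (aa X Y) p / gg X Y p)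
    (hy : ∀ p : ℝ × ℝ, p.2 < 0 → dV Y p = dU (bb X Y) p / gg X Y p)
    (p1 : ∀ t, t < 0 → Tendsto (fun u => X (u, t) ^ 2 + Y (u, t) ^ 2) atTop atTop)
    (p2 : ∀ t, t < 0 → Tendsto (fun u => X (u, t) ^ 2 + Y (u, t) ^ 2) atBot atTop)
    (e1 : ∀ t l, t < 0 → 0 < l →
      Integrable (fun u => Real.exp (-(X (u, t) ^ 2 + Y (u, t) ^ 2) / (4 * l)) * gg X Y (u, t)))
    (e2 : ∀ t l, t < 0 → 0 < l →
      ∫ u, Real.exp (-(X (u, t) ^ 2 + Y (u, t) ^ 2) / (4 * l)) * gg X Y (u, t) ≤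
        m * √(4 * π * l)) : SFlow m t0 where
  x u t := X (u, min t t0)
  y u t := Y (u, min t t0)
  a u t := aa X Y (u, min t t0)
  b u t := bb X Y (u, min t t0)
  k u t := kk X Y (u, min t t0)
  g u t := gg X Y (u, min t t0)
  cx := D.sx.clamp h0
  cy := D.sy.clamp h0
  ca := D.sa.clamp h0
  cb := D.sb.clamp h0
  ck := D.sk.clamp h0
  cg := D.sg.clamp h0
  hx u t := by
    have h : min t t0 < 0 := lt_of_le_of_lt (min_le_right _ _) h0
    rw [← D.ag (p := (u, min t t0)) h]; exact D.sx.hU h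
  hy u t := by
    have h : min t t0 < 0 := lt_of_le_of_lt (min_le_right _ _) h0
    rw [← D.bg (p := (u, min t t0)) h]; exact D.sy.hU h
  ha u t := by
    have h : min t t0 < 0 := lt_of_le_of_lt (min_le_right _ _) h0
    rw [← D.au h]; exact D.sa.hU h
  hb u t := by
    have h : min t t0 < 0 := lt_of_le_of_lt (min_le_right _ _) h0
    rw [← D.bu h]; exact D.sb.hU h
  gpos u t := D.gp (p := (u, min t t0)) (lt_of_le_of_lt (min_le_right _ _) h0)
  unit u t := D.un (p := (u, min t t0)) (lt_of_le_of_lt (min_le_right _ _) h0)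
  hxt u t ht := by
    have h := D.sx.hV (u := u) (ht.trans h0)
    rw [(D.gt hx hy (ht.trans h0)).1] at h
    rw [min_eq_left ht.le]
    refine h.congr_of_eventuallyEq ?_
    filter_upwards [Iio_mem_nhds ht] with s hs
    rw [min_eq_left (le_of_lt hs)]
  hyt u t ht := by
    have h := D.sy.hV (u := u) (ht.trans h0)
    rw [(D.gt hx hy (ht.trans h0)).2.1] at h
    rw [min_eq_left ht.le]
    refine h.congr_of_eventuallyEq ?_
    filter_upwards [Iio_mem_nhds ht] with s hs
    rw [min_eq_left (le_of_lt hs)]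
  hgt u t ht := by
    have h := D.sg.hV (u := u) (ht.trans h0)
    rw [(D.gt hx hy (ht.trans h0)).2.2] at h
    rw [min_eq_left ht.le]
    refine h.congr_of_eventuallyEq ?_
    filter_upwards [Iio_mem_nhds ht] with s hs
    rw [min_eq_left (le_of_lt hs)]
  t0neg := h0
  clx u t := by rw [min_assoc, min_self]
  cly u t := by rw [min_assoc, min_self]
  prop_top t := p1 _ (lt_of_le_of_lt (min_le_right _ _) h0)
  prop_bot t := p2 _ (lt_of_le_of_lt (min_le_right _ _) h0)
  ent_int t l hl := e1 _ l (lt_of_le_of_lt (min_le_right _ _) h0) hl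
  ent t l hl := e2 _ l (lt_of_le_of_lt (min_le_right _ _) h0) hl

def cX (γ : ℝ → ℝ → R2) (p : ℝ × ℝ) : ℝ := γ p.1 p.2 0
def cY (γ : ℝ → ℝ → R2) (p : ℝ × ℝ) : ℝ := γ p.1 p.2 1

lemma HasDerivAt.coord {f : ℝ → R2} {f' : R2} {u : ℝ} (h : HasDerivAt f f' u) (i : Fin 2) :
    HasDerivAt (fun u => f u i) (f' i) u :=
  (EuclideanSpace.proj i : R2 →L[ℝ] ℝ).hasFDerivAt.comp_hasDerivAt u h

lemma norm_R2 (v : R2) : ‖v‖ = √(v 0 ^ 2 + v 1 ^ 2) := by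
  rw [EuclideanSpace.norm_eq]; simp [Fin.sum_univ_two]

lemma inner_R2 (v w : R2) : ⟪v, w⟫ = v 0 * w 0 + v 1 * w 1 := by
  rw [PiLp.inner_apply]; simp [Fin.sum_univ_two]; ring

namespace IsCSF
variable {γ : ℝ → ℝ → R2}

lemma coordOn (h : IsCSF γ (Iic 0)) (i : Fin 2) :
    ContDiffOn ℝ (⊤ : ℕ∞) (fun p : ℝ × ℝ => γ p.1 p.2 i) (univ ×ˢ Iic 0) :=
  (EuclideanSpace.proj i : R2 →L[ℝ] ℝ).contDiff.comp_contDiffOn h.smooth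

lemma smoC (h : IsCSF γ (Iic 0)) (i : Fin 2) : Smo (fun p : ℝ × ℝ => γ p.1 p.2 i) :=
  (h.coordOn i).mono (fun _ hp => ⟨mem_univ _, mem_Iic.2 (le_of_lt hp)⟩)

lemma slice (h : IsCSF γ (Iic 0)) {t : ℝ} (ht : t ≤ 0) : ContDiff ℝ (⊤ : ℕ∞) (fun u => γ u t) := by
  have h1 : ContDiff ℝ (⊤ : ℕ∞) (fun u : ℝ => (u, t)) := contDiff_id.prodMk contDiff_const
  exact h.smooth.comp_contDiff h1 (fun u => ⟨mem_univ _, ht⟩)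

lemma hasU (h : IsCSF γ (Iic 0)) {t : ℝ} (ht : t ≤ 0) (u : ℝ) :
    HasDerivAt (fun u => γ u t) (deriv (fun u => γ u t) u) u :=
  ((h.slice ht).differentiable (by simp) u).hasDerivAt

lemma derivU (h : IsCSF γ (Iic 0)) {t : ℝ} (ht : t < 0) (u : ℝ) :
    deriv (fun u => γ u t) u 0 = dU (cX γ) (u, t) ∧ deriv (fun u => γ u t) u 1 = dU (cY γ) (u, t) :=
  ⟨((h.hasU ht.le u).coord 0).unique ((h.smoC 0).hU ht),
    ((h.hasU ht.le u).coord 1).unique ((h.smoC 1).hU ht)⟩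

lemma normU (h : IsCSF γ (Iic 0)) {t : ℝ} (ht : t < 0) (u : ℝ) :
    ‖deriv (fun u => γ u t) u‖ = gg (cX γ) (cY γ) (u, t) := by
  rw [norm_R2, (h.derivU ht u).1, (h.derivU ht u).2]; rfl

lemma sdata (h : IsCSF γ (Iic 0)) : SData (cX γ) (cY γ) where
  sx := h.smoC 0
  sy := h.smoC 1
  reg p hp := by
    have h1 : 0 < ‖deriv (fun u => γ u p.2) p.1‖ := norm_pos_iff.2 (h.regular _ _ (le_of_lt hp))
    rw [h.normU hp] at h1
    exact Real.sqrt_pos.1 h1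

lemma unitT_coord (h : IsCSF γ (Iic 0)) {t : ℝ} (ht : t < 0) (u : ℝ) :
    unitT γ u t 0 = aa (cX γ) (cY γ) (u, t) ∧ unitT γ u t 1 = bb (cX γ) (cY γ) (u, t) := by
  unfold unitT aderiv aa bb
  rw [h.normU ht]
  constructor
  · rw [PiLp.smul_apply, (h.derivU ht u).1, smul_eq_mul, div_eq_inv_mul]
  · rw [PiLp.smul_apply, (h.derivU ht u).2, smul_eq_mul, div_eq_inv_mul]

lemma diffT (h : IsCSF γ (Iic 0)) {t : ℝ} (ht : t ≤ 0) : Differentiable ℝ (fun u => unitT γ u t) := by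
  have h1 : ContDiff ℝ (⊤ : ℕ∞) (deriv (fun u => γ u t)) :=
    ((contDiff_infty_iff_deriv (f := fun u => γ u t)).1 (h.slice ht)).2
  have h2 : Differentiable ℝ (deriv (fun u => γ u t)) := h1.differentiable (by simp)
  intro u
  have hn : deriv (fun u => γ u t) u ≠ 0 := h.regular u t ht
  exact ((h2 u).norm ℝ hn).inv (norm_ne_zero_iff.2 hn) |>.smul (h2 u)

lemma flowC (h : IsCSF γ (Iic 0)) {t : ℝ} (ht : t < 0) (u : ℝ) :
    dV (cX γ) (u, t) = dU (aa (cX γ) (cY γ)) (u, t) / gg (cX γ) (cY γ) (u, t) ∧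
    dV (cY γ) (u, t) = dU (bb (cX γ) (cY γ)) (u, t) / gg (cX γ) (cY γ) (u, t) := by
  have h1 := h.flow u t ht.le
  rw [derivWithin_of_mem_nhds (Iic_mem_nhds ht)] at h1
  have hd : DifferentiableAt ℝ (fun s => γ u s) t := by
    have h2 : ContDiffAt ℝ (⊤ : ℕ∞) (fun p : ℝ × ℝ => γ p.1 p.2) (u, t) :=
      h.smooth.contDiffAt (prod_mem_nhds univ_mem (Iic_mem_nhds ht))
    have h3 := h2.differentiableAt (by simp)
    exact h3.comp (f := fun s : ℝ => (u, s)) t (by fun_prop)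
  have h2 := hd.hasDerivAt
  rw [h1] at h2
  have hT := (h.diffT ht.le u).hasDerivAt
  have hA : aderiv γ (aderiv γ γ) u t = (gg (cX γ) (cY γ) (u, t))⁻¹ • deriv (fun u => unitT γ u t) u := by
    unfold aderiv
    rw [← h.normU ht]; rfl
  rw [hA] at h2
  have d0 : deriv (fun u => unitT γ u t) u 0 = dU (aa (cX γ) (cY γ)) (u, t) := by
    have e := hT.coord 0
    have e' : (fun u => unitT γ u t 0) = fun u => aa (cX γ) (cY γ) (u, t) :=
      funext fun u => (h.unitT_coord ht u).1
    rw [e'] at e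
    exact e.unique (h.sdata.sa.hU ht)
  have d1 : deriv (fun u => unitT γ u t) u 1 = dU (bb (cX γ) (cY γ)) (u, t) := by
    have e := hT.coord 1
    have e' : (fun u => unitT γ u t 1) = fun u => bb (cX γ) (cY γ) (u, t) :=
      funext fun u => (h.unitT_coord ht u).2
    rw [e'] at e
    exact e.unique (h.sdata.sb.hU ht)
  constructor
  · have e := ((h.smoC 0).hV (u := u) ht).unique (h2.coord 0)
    rw [PiLp.smul_apply, d0, smul_eq_mul, ← div_eq_inv_mul] at e
    exact e
  · have e := ((h.smoC 1).hV (u := u) ht).unique (h2.coord 1)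
    rw [PiLp.smul_apply, d1, smul_eq_mul, ← div_eq_inv_mul] at e
    exact e

lemma nsq (h : IsCSF γ (Iic 0)) (u t : ℝ) : ‖γ u t‖ ^ 2 = cX γ (u, t) ^ 2 + cY γ (u, t) ^ 2 := by
  rw [norm_R2, Real.sq_sqrt (by positivity)]; rfl

lemma ent_bd (h : IsCSF γ (Iic 0)) {m : ℕ} (hE : entropyE γ (Iic 0) = (m : ℝ≥0∞)) {t l : ℝ} (ht : t < 0) (hl : 0 < l) :
    Integrable (fun u => Real.exp (-(cX γ (u, t) ^ 2 + cY γ (u, t) ^ 2) / (4 * l)) *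
      gg (cX γ) (cY γ) (u, t)) ∧
    ∫ u, Real.exp (-(cX γ (u, t) ^ 2 + cY γ (u, t) ^ 2) / (4 * l)) *
      gg (cX γ) (cY γ) (u, t) ≤ m * √(4 * π * l) := by
  have h1 : gaussLenE γ 0 l t ≤ m := by
    rw [← hE]; unfold entropyE
    exact le_iSup₂_of_le t ht.le (le_iSup_of_le 0 (le_iSup₂_of_le l hl le_rfl))
  unfold gaussLenE at h1
  set F := fun u => Real.exp (-(cX γ (u, t) ^ 2 + cY γ (u, t) ^ 2) / (4 * l)) *
      gg (cX γ) (cY γ) (u, t) with hF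
  have eF : ∀ u, Real.exp (-‖γ u t - 0‖ ^ 2 / (4 * l)) * ‖deriv (fun v => γ v t) u‖ = F u := by
    intro u
    rw [sub_zero, h.normU ht, h.nsq]
  simp only [eF] at h1
  have hs : 0 < √(4 * π * l) := Real.sqrt_pos.2 (by positivity)
  have hF0 : ∀ u, 0 ≤ F u := fun u => mul_nonneg (Real.exp_pos _).le (Real.sqrt_nonneg _)
  have h2 : ∫⁻ u, ENNReal.ofReal (F u) ≤ ENNReal.ofReal (m * √(4 * π * l)) := by
    rw [ENNReal.ofReal_mul (by positivity), ENNReal.ofReal_natCast]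
    have h3 : ENNReal.ofReal (√(4 * π * l)) ≠ 0 := by simpa using hs
    rw [← ENNReal.div_le_iff_le_mul (Or.inl h3) (Or.inl ENNReal.ofReal_ne_top), div_eq_mul_inv,
      mul_comm]
    exact h1
  have hcF : Continuous F := by
    have c1 := h.sdata.sx.clamp ht
    have c2 := h.sdata.sy.clamp ht
    have c3 := h.sdata.sg.clamp ht
    have cc : Continuous (fun u : ℝ => (u, t)) := by fun_prop
    have c1 := c1.comp cc
    have c2 := c2.comp cc
    have c3 := c3.comp cc
    simp only [Function.comp_def, min_self] at c1 c2 c3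
    exact (Real.continuous_exp.comp ((((c1.pow 2).add (c2.pow 2)).neg).div_const _)).mul c3
  have hInt : Integrable F := by
    refine ⟨hcF.aestronglyMeasurable, ?_⟩
    rw [hasFiniteIntegral_iff_ofReal (Eventually.of_forall hF0)]
    exact lt_of_le_of_lt h2 ENNReal.ofReal_lt_top
  refine ⟨hInt, ?_⟩
  rw [integral_eq_lintegral_of_nonneg_ae (Eventually.of_forall hF0) hcF.aestronglyMeasurable]
  exact ENNReal.toReal_le_of_le_ofReal (by positivity) h2

lemma prop_bd (h : IsCSF γ (Iic 0)) (hp : ∀ t ∈ Iic (0:ℝ), IsProperMap fun u => γ u t) {t : ℝ} (ht : t < 0) :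
    Tendsto (fun u => cX γ (u, t) ^ 2 + cY γ (u, t) ^ 2) (cocompact ℝ) atTop := by
  have h1 : Tendsto (fun u => γ u t) (cocompact ℝ) (cocompact R2) :=
    (isProperMap_iff_tendsto_cocompact.1 (hp t ht.le)).2
  have h2 := (tendsto_norm_cocompact_atTop (E := R2)).comp h1
  have h3 := (tendsto_pow_atTop (α := ℝ) (two_ne_zero)).comp h2
  refine h3.congr (fun u => ?_)
  exact h.nsq u t

def toFlow (h : IsCSF γ (Iic 0)) {m : ℕ} (hE : entropyE γ (Iic 0) = (m : ℝ≥0∞))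
    (hp : ∀ t ∈ Iic (0:ℝ), IsProperMap fun u => γ u t) (t0 : ℝ) (h0 : t0 < 0) : SFlow (m : ℝ) t0 :=
  mkFlow h.sdata m t0 h0 (fun p hp => (h.flowC hp p.1).1) (fun p hp => (h.flowC hp p.1).2)
    (fun _ ht => (h.prop_bd hp ht).mono_left atTop_le_cocompact)
    (fun _ ht => (h.prop_bd hp ht).mono_left atBot_le_cocompact)
    (fun _ _ ht hl => (h.ent_bd hE ht hl).1) (fun _ _ ht hl => (h.ent_bd hE ht hl).2)

lemma toFlow_lin (h : IsCSF γ (Iic 0)) {m : ℕ} (hE : entropyE γ (Iic 0) = (m : ℝ≥0∞))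
    (hp : ∀ t ∈ Iic (0:ℝ), IsProperMap fun u => γ u t) (t0 : ℝ) (h0 : t0 < 0) (α β u : ℝ) :
    (h.toFlow hE hp t0 h0).lin α β (u, t0) = α * γ u t0 0 + β * γ u t0 1 := by
  unfold SFlow.lin toFlow mkFlow
  simp [cX, cY]

/-- strict local minimum -/
lemma locmin (h : IsCSF γ (Iic 0)) {t : ℝ} (ht : t ≤ 0) {v : R2} (hv : ‖v‖ = 1) {u c : ℝ} (hc : 0 < c)
    (hu : curv γ u t • unitN γ u t = c • v) :
    ∃ ε > 0, ∀ z, z ≠ u → |z - u| < ε → ⟪γ u t, v⟫ < ⟪γ z t, v⟫ := by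
  set A := aderiv γ (unitT γ) u t with hA
  have hk : curv γ u t = ⟪A, unitN γ u t⟫ := rfl
  have hk0 : curv γ u t ≠ 0 := by
    intro h0
    rw [h0, zero_smul] at hu
    have : v = 0 := by
      rcases smul_eq_zero.1 hu.symm with h | h
      · exact absurd h hc.ne'
      · exact h
    rw [this] at hv; simp at hv
  have hAv : 0 < ⟪A, v⟫ := by
    have : c * ⟪A, v⟫ = curv γ u t ^ 2 := by
      rw [← real_inner_smul_right, ← hu, real_inner_smul_right, ← hk]; ring
    have h2 : 0 < curv γ u t ^ 2 := by positivity
    rw [← this] at h2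
    exact (pos_iff_pos_of_mul_pos h2).1 hc
  have hTv : ⟪unitT γ u t, v⟫ = 0 := by
    have h1 : ⟪unitT γ u t, unitN γ u t⟫ = 0 := by
      rw [inner_R2]; unfold unitN Jrot toR2; simp; ring
    have : c * ⟪unitT γ u t, v⟫ = 0 := by
      rw [← real_inner_smul_right, ← hu, real_inner_smul_right, h1, mul_zero]
    exact (mul_eq_zero.1 this).resolve_left hc.ne'
  have hT := (h.diffT ht u).hasDerivAt
  have hpos : ∀ z, 0 < ‖deriv (fun v => γ v t) z‖ := fun z => norm_pos_iff.2 (h.regular z t ht)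
  have hH : HasDerivAt (fun z => ⟪unitT γ z t, v⟫) ⟪deriv (fun z => unitT γ z t) u, v⟫ u := by
    have := hT.inner ℝ (hasDerivAt_const u v)
    simpa using this
  have hH' : 0 < ⟪deriv (fun z => unitT γ z t) u, v⟫ := by
    have e : A = ‖deriv (fun v => γ v t) u‖⁻¹ • deriv (fun z => unitT γ z t) u := rfl
    rw [e, real_inner_smul_left] at hAv
    exact (pos_iff_pos_of_mul_pos hAv).1 (inv_pos.2 (hpos u))
  have hf : ∀ z, HasDerivAt (fun z => ⟪γ z t, v⟫)
      (‖deriv (fun v => γ v t) z‖ * ⟪unitT γ z t, v⟫) z := by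
    intro z
    have := (h.hasU ht z).inner ℝ (hasDerivAt_const z v)
    refine this.congr_deriv ?_
    have hz := (hpos z).ne'
    unfold unitT aderiv
    rw [real_inner_smul_left, inner_zero_right]
    field_simp
    ring
  have hcf : Continuous (fun z => ⟪γ z t, v⟫) :=
    continuous_iff_continuousAt.2 fun z => (hf z).continuousAt
  have hsl := hH.tendsto_slope.eventually (lt_mem_nhds hH')
  rw [eventually_nhdsWithin_iff, Metric.eventually_nhds_iff] at hsl
  obtain ⟨ε, hε, hb⟩ := hsl
  refine ⟨ε, hε, fun z hz hzε => ?_⟩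
  have hsgn : ∀ y, y ≠ u → |y - u| < ε → 0 < (y - u)⁻¹ * ⟪unitT γ y t, v⟫ := by
    intro y hy hyε
    have := hb (y := y) (by rwa [Real.dist_eq]) hy
    rwa [slope_def_field, hTv, sub_zero, div_eq_inv_mul] at this
  rcases lt_or_gt_of_ne hz with hlt | hgt
  · have hanti : StrictAntiOn (fun z => ⟪γ z t, v⟫) (Icc z u) := by
      refine strictAntiOn_of_deriv_neg (convex_Icc z u) hcf.continuousOn ?_
      intro y hy
      rw [interior_Icc] at hy
      rw [(hf y).deriv]
      have h1 := hsgn y hy.2.ne (by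
        rw [abs_lt] at hzε ⊢; constructor <;> linarith [hy.1, hy.2])
      have h2 : (y - u)⁻¹ < 0 := inv_neg''.2 (by linarith [hy.2])
      exact mul_neg_of_pos_of_neg (hpos y) (by nlinarith)
    exact hanti ⟨le_rfl, hlt.le⟩ ⟨hlt.le, le_rfl⟩ hlt
  · have hmono : StrictMonoOn (fun z => ⟪γ z t, v⟫) (Icc u z) := by
      refine strictMonoOn_of_deriv_pos (convex_Icc u z) hcf.continuousOn ?_
      intro y hy
      rw [interior_Icc] at hy
      rw [(hf y).deriv]
      have h1 := hsgn y hy.1.ne' (by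
        rw [abs_lt] at hzε ⊢; constructor <;> linarith [hy.1, hy.2])
      have h2 : 0 < (y - u)⁻¹ := inv_pos.2 (by linarith [hy.1])
      exact mul_pos (hpos y) ((pos_iff_pos_of_mul_pos h1).1 h2)
    exact hmono ⟨le_rfl, hgt.le⟩ ⟨hgt.le, le_rfl⟩ hgt
end IsCSF

lemma between {f : ℝ → ℝ} (hf : Continuous f) {p q : ℝ} (hpq : p < q)
    (h1 : ∃ ε > 0, ∀ z, z ≠ p → |z - p| < ε → f p < f z)
    (h2 : ∃ ε > 0, ∀ z, z ≠ q → |z - q| < ε → f q < f z) :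
    ∃ a, p < a ∧ a < q ∧ f p < f a ∧ f q < f a := by
  obtain ⟨a, ha, hmax⟩ := isCompact_Icc.exists_isMaxOn (nonempty_Icc.2 hpq.le) hf.continuousOn
  obtain ⟨e1, he1, h1⟩ := h1
  obtain ⟨e2, he2, h2⟩ := h2
  have g1 : f p < f a := by
    have hm : 0 < min (e1 / 2) (q - p) := lt_min (by linarith) (by linarith)
    have hm1 := min_le_left (e1 / 2) (q - p)
    have hm2 := min_le_right (e1 / 2) (q - p)
    have := h1 (p + min (e1 / 2) (q - p)) (by linarith) (by
      rw [add_sub_cancel_left, abs_of_pos hm]; linarith)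
    exact this.trans_le (hmax ⟨by linarith, by linarith⟩)
  have g2 : f q < f a := by
    have hm : 0 < min (e2 / 2) (q - p) := lt_min (by linarith) (by linarith)
    have hm1 := min_le_left (e2 / 2) (q - p)
    have hm2 := min_le_right (e2 / 2) (q - p)
    have := h2 (q - min (e2 / 2) (q - p)) (by linarith) (by
      rw [sub_sub_cancel_left, abs_neg, abs_of_pos hm]; linarith)
    exact this.trans_le (hmax ⟨by linarith, by linarith⟩)
  refine ⟨a, lt_of_le_of_ne ha.1 ?_, lt_of_le_of_ne ha.2 ?_, g1, g2⟩
  · rintro rfl; exact lt_irrefl _ g1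
  · rintro rfl; exact lt_irrefl _ g2

lemma choose_peaks {f : ℝ → ℝ} (hf : Continuous f) {m : ℕ} (w : Fin m → ℝ) (hw : StrictMono w)
    (h : ∀ j, ∃ ε > 0, ∀ z, z ≠ w j → |z - w j| < ε → f (w j) < f z) :
    ∃ a : Fin (m + 1) → ℝ, (∀ j : Fin m, a j.castSucc < w j ∧ f (w j) < f (a j.castSucc)) ∧
      ∀ j : Fin m, w j < a j.succ ∧ f (w j) < f (a j.succ) := by
  have key : ∀ i : Fin (m + 1), ∃ a : ℝ,
      (∀ j : Fin m, j.castSucc = i → a < w j ∧ f (w j) < f a) ∧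
      (∀ j : Fin m, j.succ = i → w j < a ∧ f (w j) < f a) := by
    intro i
    have hL : ∀ j, ∃ a, a < w j ∧ f (w j) < f a := by
      intro j
      obtain ⟨ε, hε, hh⟩ := h j
      exact ⟨w j - ε / 2, by linarith, hh _ (by linarith) (by
        rw [sub_sub_cancel_left, abs_neg, abs_of_pos (by linarith)]; linarith)⟩
    have hR : ∀ j, ∃ a, w j < a ∧ f (w j) < f a := by
      intro j
      obtain ⟨ε, hε, hh⟩ := h j
      exact ⟨w j + ε / 2, by linarith, hh _ (by linarith) (by
        rw [add_sub_cancel_left, abs_of_pos (by linarith)]; linarith)⟩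
    by_cases c1 : ∃ j : Fin m, j.castSucc = i
    · obtain ⟨j, hj⟩ := c1
      by_cases c2 : ∃ j' : Fin m, j'.succ = i
      · obtain ⟨j', hj'⟩ := c2
        have hlt : j' < j := by
          have e := hj.trans hj'.symm
          rw [Fin.ext_iff] at e; simp at e
          rw [Fin.lt_def]; omega
        obtain ⟨a, h1, h2, h3, h4⟩ := between hf (hw hlt) (h j') (h j)
        refine ⟨a, fun k hk => ?_, fun k hk => ?_⟩
        · obtain rfl : k = j := Fin.castSucc_injective _ (hk.trans hj.symm)
          exact ⟨h2, h4⟩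
        · obtain rfl : k = j' := Fin.succ_injective _ (hk.trans hj'.symm)
          exact ⟨h1, h3⟩
      · obtain ⟨a, ha⟩ := hL j
        refine ⟨a, fun k hk => ?_, fun k hk => absurd ⟨k, hk⟩ c2⟩
        obtain rfl : k = j := Fin.castSucc_injective _ (hk.trans hj.symm)
        exact ha
    · by_cases c2 : ∃ j' : Fin m, j'.succ = i
      · obtain ⟨j', hj'⟩ := c2
        obtain ⟨a, ha⟩ := hR j'
        refine ⟨a, fun k hk => absurd ⟨k, hk⟩ c1, fun k hk => ?_⟩
        obtain rfl : k = j' := Fin.succ_injective _ (hk.trans hj'.symm)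
        exact ha
      · exact ⟨0, fun k hk => absurd ⟨k, hk⟩ c1, fun k hk => absurd ⟨k, hk⟩ c2⟩
  choose a ha1 ha2 using key
  exact ⟨a, fun j => ha1 _ j rfl, fun j => ha2 _ j rfl⟩

lemma IsCSF.no_m {γ : ℝ → ℝ → R2} (h : IsCSF γ (Iic 0)) {m : ℕ}
    (hE : entropyE γ (Iic 0) = (m : ℝ≥0∞))
    (hp : ∀ t ∈ Iic (0:ℝ), IsProperMap fun u => γ u t) {t : ℝ} (ht : t ≤ 0) {v : R2}
    (hv : ‖v‖ = 1) (s : Finset ℝ) (hs : s.card = m)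
    (hsub : ∀ u ∈ s, ∃ c : ℝ, 0 < c ∧ curv γ u t • unitN γ u t = c • v) : False := by
  set w : Fin m → ℝ := fun j => s.orderEmbOfFin hs j with hwdef
  have hw : StrictMono w := (s.orderEmbOfFin hs).strictMono
  have hcf : Continuous (fun u => ⟪γ u t, v⟫) := (h.slice ht).continuous.inner continuous_const
  obtain ⟨a, ha1, ha2⟩ := choose_peaks hcf w hw (fun j => by
    obtain ⟨c, hc, hu⟩ := hsub (w j) (s.orderEmbOfFin_mem hs j)
    exact h.locmin ht hv hc hu)
  -- perturbation
  let Φ : ℝ → ℝ → ℝ → ℝ := fun l u σ =>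
    (v 0 - σ * l * v 1) * γ u (t - σ) 0 + (v 1 + σ * l * v 0) * γ u (t - σ) 1
  have hΦ0 : ∀ l u, Φ l u 0 = ⟪γ u t, v⟫ := by
    intro l u; simp only [Φ]; rw [inner_R2]; simp; ring
  have hγc : ∀ u (i : Fin 2), Tendsto (fun σ : ℝ => γ u (t - σ) i) (nhdsWithin 0 (Ioi 0))
      (nhds (γ u t i)) := by
    intro u i
    have h1 := (h.coordOn i).continuousOn (u, t) ⟨mem_univ _, ht⟩
    have h2 : Tendsto (fun σ : ℝ => (u, t - σ)) (nhdsWithin 0 (Ioi 0))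
        (nhdsWithin (u, t) (univ ×ˢ Iic 0)) := by
      refine tendsto_nhdsWithin_iff.2 ⟨?_, ?_⟩
      · have : Continuous (fun σ : ℝ => (u, t - σ)) := by fun_prop
        have := this.tendsto 0
        rw [sub_zero] at this
        exact this.mono_left nhdsWithin_le_nhds
      · filter_upwards [self_mem_nhdsWithin] with σ hσ
        have : 0 < σ := hσ
        exact ⟨mem_univ _, show t - σ ≤ 0 by linarith⟩
    exact h1.tendsto.comp h2
  have hΦc : ∀ l u, Tendsto (Φ l u) (nhdsWithin 0 (Ioi 0)) (nhds ⟪γ u t, v⟫) := by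
    intro l u
    have c1 : Tendsto (fun σ : ℝ => v 0 - σ * l * v 1) (nhdsWithin 0 (Ioi 0)) (nhds (v 0)) := by
      have : Continuous (fun σ : ℝ => v 0 - σ * l * v 1) := by fun_prop
      have := this.tendsto 0
      simp only [zero_mul, sub_zero] at this
      exact this.mono_left nhdsWithin_le_nhds
    have c2 : Tendsto (fun σ : ℝ => v 1 + σ * l * v 0) (nhdsWithin 0 (Ioi 0)) (nhds (v 1)) := by
      have : Continuous (fun σ : ℝ => v 1 + σ * l * v 0) := by fun_prop
      have := this.tendsto 0
      simp only [zero_mul, add_zero] at this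
      exact this.mono_left nhdsWithin_le_nhds
    have e : ⟪γ u t, v⟫ = v 0 * γ u t 0 + v 1 * γ u t 1 := by rw [inner_R2]; ring
    rw [e]
    exact (c1.mul (hγc u 0)).add (c2.mul (hγc u 1))
  have ev1 : ∀ᶠ σ in nhdsWithin (0:ℝ) (Ioi 0), ∀ l : Fin (m + 1), ∀ j : Fin m,
      Φ (l : ℕ) (w j) σ < Φ (l : ℕ) (a j.castSucc) σ := by
    refine eventually_all.2 fun l => eventually_all.2 fun j => ?_
    exact (hΦc _ _).eventually_lt (hΦc _ _) (ha1 j).2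
  have ev2 : ∀ᶠ σ in nhdsWithin (0:ℝ) (Ioi 0), ∀ l : Fin (m + 1), ∀ j : Fin m,
      Φ (l : ℕ) (w j) σ < Φ (l : ℕ) (a j.succ) σ := by
    refine eventually_all.2 fun l => eventually_all.2 fun j => ?_
    exact (hΦc _ _).eventually_lt (hΦc _ _) (ha2 j).2
  have ev3 : ∀ᶠ σ in nhdsWithin (0:ℝ) (Ioi 0), σ * (m : ℝ) < 1 := by
    have : Continuous (fun σ : ℝ => σ * m) := by fun_prop
    have := this.tendsto 0
    rw [zero_mul] at this
    exact (this.mono_left nhdsWithin_le_nhds).eventually (gt_mem_nhds one_pos)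
  obtain ⟨σ, ⟨⟨⟨h1, h2⟩, h3⟩, h4⟩⟩ :=
    (((ev1.and ev2).and ev3).and ((self_mem_nhdsWithin : Ioi (0:ℝ) ∈ nhdsWithin (0:ℝ) (Ioi 0)))).exists
  have hσ : 0 < σ := h4
  have hv2 : v 0 ^ 2 + v 1 ^ 2 = 1 := by
    rw [norm_R2] at hv
    have h0 : 0 ≤ v 0 ^ 2 + v 1 ^ 2 := by positivity
    nlinarith [Real.sq_sqrt h0]
  have hv0 : |v 0| ≤ 1 := abs_le_one_iff_mul_self_le_one.2 (by nlinarith)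
  have hv1 : |v 1| ≤ 1 := abs_le_one_iff_mul_self_le_one.2 (by nlinarith)
  have hl : ∀ l : Fin (m + 1), |σ * ((l : ℕ) : ℝ)| ≤ 1 := by
    intro l
    have : ((l : ℕ) : ℝ) ≤ m := by exact_mod_cast Nat.lt_succ_iff.1 l.2
    rw [abs_of_nonneg (by positivity)]
    nlinarith
  have h0 : t - σ < 0 := by linarith
  refine main_contra m (h.toFlow hE hp (t - σ) h0) a w (fun j => (ha1 j).1) (fun j => (ha2 j).1)
    (fun l => v 0 - σ * ((l : ℕ) : ℝ) * v 1) (fun l => v 1 + σ * ((l : ℕ) : ℝ) * v 0) σ hσ ?_ ?_ ?_ ?_ ?_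
  · intro l
    have := abs_sub (v 0) (σ * ((l : ℕ) : ℝ) * v 1)
    rw [abs_mul] at this
    have := mul_le_one₀ (hl l) (abs_nonneg _) hv1
    linarith
  · intro l
    have := abs_add_le (v 1) (σ * ((l : ℕ) : ℝ) * v 0)
    rw [abs_mul] at this
    have := mul_le_one₀ (hl l) (abs_nonneg _) hv0
    linarith
  · intro l l' hne
    have e : (v 0 - σ * ((l : ℕ) : ℝ) * v 1) * (v 1 + σ * ((l' : ℕ) : ℝ) * v 0) -
        (v 0 - σ * ((l' : ℕ) : ℝ) * v 1) * (v 1 + σ * ((l : ℕ) : ℝ) * v 0) =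
        σ * ((((l' : ℕ) : ℤ) - ((l : ℕ) : ℤ) : ℤ) : ℝ) := by
      push_cast
      linear_combination σ * (((l' : ℕ) : ℝ) - ((l : ℕ) : ℝ)) * hv2
    simp only [e]
    rw [abs_mul, abs_of_pos hσ]
    have hz : (((l' : ℕ) : ℤ) - ((l : ℕ) : ℤ)) ≠ 0 := by
      intro hz; apply hne; ext; omega
    have : (1 : ℝ) ≤ |((((l' : ℕ) : ℤ) - ((l : ℕ) : ℤ) : ℤ) : ℝ)| := by
      exact_mod_cast Int.one_le_abs hz
    nlinarith
  · intro l j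
    rw [h.toFlow_lin, h.toFlow_lin]
    exact h1 l j
  · intro l j
    rw [h.toFlow_lin, h.toFlow_lin]
    exact h2 l j

lemma final_main
    (γ : ℝ → ℝ → R2) (m : ℕ) (hm : 0 < m)
    (hcsf : IsCSF γ (Iic 0))
    (hproper : ∀ t ∈ Iic (0:ℝ), IsProperMap fun u => γ u t)
    (hEnt : entropyE γ (Iic 0) = (m : ℝ≥0∞)) :
    ∀ t ∈ Iic (0:ℝ), ∀ v : R2, ‖v‖ = 1 →
      {u : ℝ | ∃ c : ℝ, 0 < c ∧ curv γ u t • unitN γ u t = c • v}.Finite ∧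
      {u : ℝ | ∃ c : ℝ, 0 < c ∧ curv γ u t • unitN γ u t = c • v}.ncard ≤ m - 1 := by
  intro t ht v hv
  set W := {u : ℝ | ∃ c : ℝ, 0 < c ∧ curv γ u t • unitN γ u t = c • v} with hW
  have hfin : W.Finite := by
    by_contra hinf
    obtain ⟨s, hs, hc⟩ := (show W.Infinite from hinf).exists_subset_card_eq m
    exact hcsf.no_m hEnt hproper ht hv s hc (fun u hu => hs hu)
  refine ⟨hfin, ?_⟩
  by_contra hlt
  have hge : m ≤ hfin.toFinset.card := by
    rw [← ncard_eq_toFinset_card W hfin]; omega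
  obtain ⟨s, hs, hc⟩ := Finset.exists_subset_card_eq hge
  exact hcsf.no_m hEnt hproper ht hv s hc (fun u hu => hfin.mem_toFinset.1 (hs hu))

/-- For an ancient complete non-compact embedded smooth curve shortening
flow with entropy a positive integer `m`, at each time and for each unit vector `v`, there
are at most `m - 1` points whose curvature vector is a positive multiple of `v`. -/
theorem card_parallel_curvature_vectors_le
    (γ : ℝ → ℝ → R2) (m : ℕ) (hm : 0 < m)
    (hcsf : IsCSF γ (Iic 0))
    (hemb : ∀ t ∈ Iic (0:ℝ), Function.Injective fun u => γ u t)
    (hproper : ∀ t ∈ Iic (0:ℝ), IsProperMap fun u => γ u t)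
    (hEnt : entropyE γ (Iic 0) = (m : ℝ≥0∞)) :
    ∀ t ∈ Iic (0:ℝ), ∀ v : R2, ‖v‖ = 1 →
      {u : ℝ | ∃ c : ℝ, 0 < c ∧ curv γ u t • unitN γ u t = c • v}.Finite ∧
      {u : ℝ | ∃ c : ℝ, 0 < c ∧ curv γ u t • unitN γ u t = c • v}.ncard ≤ m - 1 := by
  exact final_main γ m hm hcsf hproper hEnt
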